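/- Let ρ : SO(3) → SO(5) be the irreducible 5-dimensional representation. Then for any continuous map f : S⁴ → SO(3), the composition ρ ∘ f : S⁴ → SO(5) is null-homotopic. Consequently, the structure group of S⁵ cannot be reduced to ρ(SO(3)). -/

import Mathlib

/-- The special orthogonal group SO(n) as a set of matrices. -/
def SOSet (n : ℕ) : Set (Matrix (Fin n) (Fin n) ℝ) :=
  {A | A * A.transpose = 1 ∧ A.det = 1}

/-- The characteristic (clutching) map of the tangent bundle of Sⁿ: for x in the equator
S^{n-1} ⊆ ℝⁿ, the reflection through x^⊥ composed with a fixed reflection, an element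
of SO(n). -/
noncomputable def charMatrix (n : ℕ) (x : EuclideanSpace ℝ (Fin n)) :
    Matrix (Fin n) (Fin n) ℝ :=
  (1 - (2 : ℝ) • Matrix.vecMulVec (fun i => x i) (fun i => x i)) *
    Matrix.diagonal (fun i : Fin n => if i.val = 0 then (-1 : ℝ) else 1)

/-- The structure group of Sⁿ reduces to a subgroup G ⊆ GL(n,ℝ) (a set of matrices):
the characteristic map χₙ : S^{n-1} → SO(n) ⊆ GL(n,ℝ) is homotopic, through invertible
matrices, to a map with image in G. -/
def SphereStructureGroupReducesTo (n : ℕ) (G : Set (Matrix (Fin n) (Fin n) ℝ)) : Prop :=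
  ∃ χ g : C(Metric.sphere (0 : EuclideanSpace ℝ (Fin n)) 1, Matrix (Fin n) (Fin n) ℝ),
    (∀ x : Metric.sphere (0 : EuclideanSpace ℝ (Fin n)) 1, χ x = charMatrix n ↑x) ∧
    (∀ x, g x ∈ G) ∧
    ContinuousMap.HomotopicWith χ g fun h => ∀ x, IsUnit (h x)

section

open Topology unitInterval Matrix

/-- Partial products of transporters along the subdivision of the unit interval. -/
noncomputable def liftProd {X M G : Type*} [Monoid G] (τ : M → M → G) (H : X → I → M) (n : ℕ) :
    ℕ → X → I → G
  | 0, _, _ => 1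
  | k + 1, x, t => τ (H x (min t (Set.projIcc 0 1 zero_le_one ((k : ℝ) / n))))
      (H x (min t (Set.projIcc 0 1 zero_le_one (((k + 1 : ℕ) : ℝ) / n)))) * liftProd τ H n k x t

lemma dist_min_projIcc_le (t : I) (n k : ℕ) (hn : 0 < n) :
    dist (min t (Set.projIcc 0 1 zero_le_one ((k : ℝ) / n)))
      (min t (Set.projIcc 0 1 zero_le_one (((k + 1 : ℕ) : ℝ) / n))) ≤ 1 / n := by
  have h0 : (0 : ℝ) < n := by exact_mod_cast hn
  have h1 : ((k + 1 : ℕ) : ℝ) / n = k / n + 1 / n := by push_cast; ring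
  have h2 : (0 : ℝ) < 1 / n := by positivity
  rw [h1, Subtype.dist_eq, Real.dist_eq, abs_le]
  have hm : ∀ a b : I, ((min a b : I) : ℝ) = min (a : ℝ) b := fun a b => by
    rcases le_total a b with h | h
    · rw [min_eq_left h, min_eq_left (by exact_mod_cast h)]
    · rw [min_eq_right h, min_eq_right (by exact_mod_cast h)]
  rw [hm, hm, Set.coe_projIcc, Set.coe_projIcc]
  constructor <;> simp only [min_def, max_def] <;> split_ifs <;> linarith

/-- A homotopy in a metric space with local transporters lifts to the monoid of transporters. -/
theorem exists_homotopy_lift {X M G : Type*} [PseudoMetricSpace X] [CompactSpace X]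
    [PseudoMetricSpace M] [Monoid G] [TopologicalSpace G] [ContinuousMul G]
    (τ : M → M → G) {δ : ℝ} (hδ : 0 < δ)
    (hτ : ContinuousOn (fun p : M × M => τ p.1 p.2) {p | dist p.1 p.2 < δ})
    (hτ1 : ∀ m, τ m m = 1) (Rel : G → M → M → Prop)
    (hrel : ∀ m m', dist m m' < δ → Rel (τ m m') m m')
    (htrans : ∀ g g' m m' m'', Rel g m m' → Rel g' m' m'' → Rel (g' * g) m m'')
    (H : X → I → M) (hH : Continuous fun p : X × I => H p.1 p.2) :
    ∃ L : X → I → G, (Continuous fun p : X × I => L p.1 p.2) ∧ (∀ x, L x 0 = 1) ∧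
      (∀ x t, Rel (L x t) (H x 0) (H x t)) ∧
      (∀ (S : Submonoid G) (x : X),
        (∀ s s', dist (H x s) (H x s') < δ → τ (H x s) (H x s') ∈ S) → ∀ t, L x t ∈ S) ∧
      (∀ x x', H x = H x' → L x = L x') := by
  have hu := CompactSpace.uniformContinuous_of_continuous hH
  obtain ⟨η, hη, hηH⟩ := Metric.uniformContinuous_iff.1 hu δ hδ
  obtain ⟨n, hn⟩ := exists_nat_one_div_lt hη
  set N := n + 1 with hN
  have hd : ∀ (x : X) (t : I) (k : ℕ),
      dist (H x (min t (Set.projIcc 0 1 zero_le_one ((k : ℝ) / N))))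
      (H x (min t (Set.projIcc 0 1 zero_le_one (((k + 1 : ℕ) : ℝ) / N)))) < δ := by
    intro x t k
    apply @hηH (x, _) (x, _)
    rw [Prod.dist_eq, dist_self, max_lt_iff]
    refine ⟨hη, lt_of_le_of_lt (dist_min_projIcc_le t N k (Nat.succ_pos n)) ?_⟩
    rw [hN]; push_cast; exact hn
  have hp0 : Set.projIcc (0 : ℝ) 1 zero_le_one (((0 : ℕ) : ℝ) / N) = 0 := by
    simp [Set.projIcc_left]
  have hp1 : Set.projIcc (0 : ℝ) 1 zero_le_one ((N : ℝ) / N) = 1 := by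
    rw [div_self (by positivity), Set.projIcc_right]; rfl
  have hcont : ∀ k, Continuous fun p : X × I => liftProd τ H N k p.1 p.2 := by
    intro k
    induction k with
    | zero => exact continuous_const
    | succ k ih =>
      refine Continuous.mul ?_ ih
      have hc : ∀ a : I, Continuous fun p : X × I => H p.1 (min p.2 a) := fun a =>
        hH.comp (continuous_fst.prodMk (continuous_snd.min continuous_const))
      exact hτ.comp_continuous ((hc _).prodMk (hc _)) fun p => hd p.1 p.2 k
  refine ⟨liftProd τ H N N, hcont N, ?_, ?_, ?_, ?_⟩
  · intro x
    have : ∀ k, liftProd τ H N k x 0 = 1 := by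
      intro k
      induction k with
      | zero => rfl
      | succ k ih =>
        rw [liftProd, ih, min_eq_left (unitInterval.nonneg' ..), min_eq_left (unitInterval.nonneg' ..), hτ1, mul_one]
    exact this N
  · intro x t
    have : ∀ k, Rel (liftProd τ H N k x t) (H x 0)
        (H x (min t (Set.projIcc 0 1 zero_le_one ((k : ℝ) / N)))) := by
      intro k
      induction k with
      | zero =>
        rw [hp0, min_eq_right (unitInterval.nonneg' ..), liftProd, ← hτ1 (H x 0)]
        exact hrel _ _ (by rwa [dist_self])
      | succ k ih => exact htrans _ _ _ _ _ ih (hrel _ _ (hd x t k))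
    have h := this N
    rwa [hp1, min_eq_left (unitInterval.le_one' ..)] at h
  · intro S x hS t
    have : ∀ k, liftProd τ H N k x t ∈ S := by
      intro k
      induction k with
      | zero => exact S.one_mem
      | succ k ih => exact S.mul_mem (hS _ _ (hd x t k)) ih
    exact this N
  · intro x x' h
    have : ∀ k, liftProd τ H N k x = liftProd τ H N k x' := by
      intro k
      induction k with
      | zero => rfl
      | succ k ih => funext t; rw [liftProd, liftProd, ih, h]
    exact this N

/-- The reflection in the hyperplane orthogonal to a unit vector. -/
def reflMat {n : ℕ} (u : Fin n → ℝ) : Matrix (Fin n) (Fin n) ℝ := 1 - (2 : ℝ) • vecMulVec u u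

lemma reflMat_mulVec {n : ℕ} (u v : Fin n → ℝ) : reflMat u *ᵥ v = v - (2 * (u ⬝ᵥ v)) • u := by
  rw [reflMat, sub_mulVec, one_mulVec, smul_mulVec, vecMulVec_mulVec]
  ext i; simp; ring

lemma reflMat_transpose {n : ℕ} (u : Fin n → ℝ) : (reflMat u)ᵀ = reflMat u := by
  simp [reflMat, transpose_sub, transpose_smul, transpose_vecMulVec]

lemma reflMat_mul_self {n : ℕ} {u : Fin n → ℝ} (hu : u ⬝ᵥ u = 1) : reflMat u * reflMat u = 1 := by
  refine ext_of_mulVec_single fun i => ?_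
  rw [← mulVec_mulVec, reflMat_mulVec, reflMat_mulVec, one_mulVec]
  simp only [dotProduct_sub, dotProduct_smul, hu, smul_eq_mul]
  module

lemma det_reflMat {n : ℕ} {u : Fin n → ℝ} (hu : u ⬝ᵥ u = 1) : (reflMat u).det = -1 := by
  have : reflMat u = 1 + replicateCol Unit ((-2 : ℝ) • u) * replicateRow Unit u := by
    ext i j; simp [reflMat, mul_apply, vecMulVec]; ring
  rw [this, det_one_add_replicateCol_mul_replicateRow, dotProduct_smul, hu]; norm_num

lemma mul_mem_SOSet {n : ℕ} {A B : Matrix (Fin n) (Fin n) ℝ} (hA : A ∈ SOSet n) (hB : B ∈ SOSet n) :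
    A * B ∈ SOSet n := by
  refine ⟨?_, by rw [det_mul, hA.2, hB.2, one_mul]⟩
  rw [transpose_mul, Matrix.mul_assoc, ← Matrix.mul_assoc B, hB.1, Matrix.one_mul, hA.1]

lemma one_mem_SOSet {n : ℕ} : (1 : Matrix (Fin n) (Fin n) ℝ) ∈ SOSet n := by simp [SOSet]

lemma transpose_mul_of_mem_SOSet {n : ℕ} {A : Matrix (Fin n) (Fin n) ℝ} (hA : A ∈ SOSet n) :
    Aᵀ * A = 1 := mul_eq_one_comm.1 hA.1

lemma transpose_mem_SOSet {n : ℕ} {A : Matrix (Fin n) (Fin n) ℝ} (hA : A ∈ SOSet n) :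
    Aᵀ ∈ SOSet n :=
  ⟨by rw [transpose_transpose]; exact transpose_mul_of_mem_SOSet hA, by rw [det_transpose, hA.2]⟩

lemma mulVec_dotProduct_mulVec_of_mem_SOSet {n : ℕ} {A : Matrix (Fin n) (Fin n) ℝ}
    (hA : A ∈ SOSet n) (v w : Fin n → ℝ) : (A *ᵥ v) ⬝ᵥ (A *ᵥ w) = v ⬝ᵥ w := by
  rw [dotProduct_mulVec, ← mulVec_transpose, mulVec_mulVec, transpose_mul_of_mem_SOSet hA, one_mulVec]

lemma reflMat_mul_reflMat_mem_SOSet {n : ℕ} {u v : Fin n → ℝ} (hu : u ⬝ᵥ u = 1) (hv : v ⬝ᵥ v = 1) :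
    reflMat u * reflMat v ∈ SOSet n := by
  refine ⟨?_, by rw [det_mul, det_reflMat hu, det_reflMat hv]; norm_num⟩
  rw [transpose_mul, reflMat_transpose, reflMat_transpose, Matrix.mul_assoc,
    ← Matrix.mul_assoc (reflMat v), reflMat_mul_self hv, Matrix.one_mul, reflMat_mul_self hu]

/-- The unit sphere in `Fin n → ℝ` for the standard scalar product. -/
abbrev Sph (n : ℕ) : Type := {v : Fin n → ℝ // v ⬝ᵥ v = 1}

lemma abs_le_one_of_dotProduct {n : ℕ} {v : Fin n → ℝ} (hv : v ⬝ᵥ v = 1) (i : Fin n) : |v i| ≤ 1 := by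
  have : v i * v i ≤ v ⬝ᵥ v :=
    Finset.single_le_sum (f := fun i => v i * v i) (fun i _ => mul_self_nonneg _) (Finset.mem_univ i)
  rw [hv] at this
  exact abs_le.2 ⟨by nlinarith, by nlinarith⟩

instance (n : ℕ) : CompactSpace (Sph n) := by
  refine isCompact_iff_compactSpace.1 (Metric.isCompact_of_isClosed_isBounded ?_ ?_)
  · exact isClosed_eq (by fun_prop) continuous_const
  · refine (Metric.isBounded_iff_subset_closedBall 0).2 ⟨1, fun v hv => ?_⟩
    rw [mem_closedBall_zero_iff, pi_norm_le_iff_of_nonneg zero_le_one]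
    exact fun i => abs_le_one_of_dotProduct hv i

lemma dotProduct_pos_of_dist_lt {n : ℕ} (u v : Sph n) (h : dist u v < 1 / (n + 1)) :
    0 < u.1 ⬝ᵥ v.1 := by
  have h1 : (u.1 - v.1) ⬝ᵥ (u.1 - v.1) ≤ 1 := by
    have hi : ∀ i, (u.1 - v.1) i * (u.1 - v.1) i ≤ 1 / (n + 1) := by
      intro i
      have h2 : |u.1 i - v.1 i| ≤ 1 / (n + 1) := by
        refine le_trans ?_ h.le
        rw [Subtype.dist_eq, ← Real.dist_eq]
        exact dist_le_pi_dist u.1 v.1 i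
      have h3 : (1 : ℝ) / (n + 1) ≤ 1 := by
        rw [div_le_one (by positivity)]; linarith [(Nat.cast_nonneg n : (0 : ℝ) ≤ n)]
      rw [← abs_mul_abs_self]
      calc _ ≤ 1 / ((n : ℝ) + 1) * 1 :=
            mul_le_mul h2 (h2.trans h3) (abs_nonneg _) (by positivity)
        _ = _ := mul_one _
    calc _ ≤ ∑ i : Fin n, (1 : ℝ) / (n + 1) := Finset.sum_le_sum fun i _ => hi i
      _ = n / (n + 1) := by simp; ring
      _ ≤ 1 := by rw [div_le_one (by positivity)]; linarith
  simp only [sub_dotProduct, dotProduct_sub, u.2, v.2, dotProduct_comm v.1 u.1] at h1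
  linarith

/-- The unit vector halfway between two unit vectors. -/
noncomputable def midVec {n : ℕ} (u v : Fin n → ℝ) : Fin n → ℝ :=
  (√((u + v) ⬝ᵥ (u + v)))⁻¹ • (u + v)

lemma midVec_aux {n : ℕ} {u v : Sph n} (h : 0 < u.1 ⬝ᵥ v.1) : 0 < (u.1 + v.1) ⬝ᵥ (u.1 + v.1) := by
  simp only [add_dotProduct, dotProduct_add, u.2, v.2, dotProduct_comm v.1 u.1]; linarith

lemma midVec_dotProduct_self {n : ℕ} {u v : Sph n} (h : 0 < u.1 ⬝ᵥ v.1) :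
    midVec u.1 v.1 ⬝ᵥ midVec u.1 v.1 = 1 := by
  have h1 := midVec_aux h
  rw [midVec, smul_dotProduct, dotProduct_smul, smul_eq_mul, smul_eq_mul, ← mul_assoc, ← mul_inv,
    Real.mul_self_sqrt h1.le, inv_mul_cancel₀ h1.ne']

lemma midVec_self {n : ℕ} (u : Sph n) : midVec u.1 u.1 = u.1 := by
  have h : (u.1 + u.1) ⬝ᵥ (u.1 + u.1) = 2 ^ 2 := by
    simp only [add_dotProduct, dotProduct_add, u.2]; norm_num
  rw [midVec, h, Real.sqrt_sq (by norm_num), ← two_smul ℝ, smul_smul]; norm_num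

lemma reflMat_midVec {n : ℕ} {u v : Sph n} (h : 0 < u.1 ⬝ᵥ v.1) :
    (reflMat (midVec u.1 v.1) * reflMat u.1) *ᵥ u.1 = v.1 := by
  have h1 := midVec_aux h
  have h2 : (u.1 + v.1) ⬝ᵥ u.1 = (u.1 + v.1) ⬝ᵥ (u.1 + v.1) / 2 := by
    simp only [add_dotProduct, dotProduct_add, u.2, v.2, dotProduct_comm v.1 u.1]; ring
  rw [← mulVec_mulVec, reflMat_mulVec u.1, u.2, reflMat_mulVec]
  have h3 : u.1 - (2 * 1 : ℝ) • u.1 = - u.1 := by module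
  rw [h3, dotProduct_neg, midVec, smul_dotProduct, h2, smul_smul, smul_eq_mul]
  set c := (u.1 + v.1) ⬝ᵥ (u.1 + v.1)
  have h4 : 2 * -((√c)⁻¹ * (c / 2)) * (√c)⁻¹ = -1 := by
    have : (√c)⁻¹ * (√c)⁻¹ = c⁻¹ := by rw [← mul_inv, Real.mul_self_sqrt h1.le]
    calc _ = - (((√c)⁻¹ * (√c)⁻¹) * c) := by ring
      _ = _ := by rw [this, inv_mul_cancel₀ h1.ne']
  rw [h4]; module

section Spin
variable {n : ℕ} {𝒜 : Type*} [Ring 𝒜] [Algebra ℝ 𝒜]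

lemma clifford_mul_reflMat {γ : (Fin n → ℝ) →ₗ[ℝ] 𝒜} {ε : ℝ}
    (hγ : ∀ v, γ v * γ v = (ε * (v ⬝ᵥ v)) • (1 : 𝒜)) {u : Fin n → ℝ} (hu : u ⬝ᵥ u = 1)
    (v : Fin n → ℝ) : γ u * γ v = - (γ (reflMat u *ᵥ v) * γ u) := by
  have h1 : γ u * γ v + γ v * γ u = (2 * ε * (u ⬝ᵥ v)) • (1 : 𝒜) := by
    have h := hγ (u + v)
    rw [map_add, add_mul, mul_add, mul_add, hγ u, hγ v] at h
    simp only [add_dotProduct, dotProduct_add, dotProduct_comm v u] at h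
    have h2 : γ u * γ v + γ v * γ u = (ε * (u ⬝ᵥ u + u ⬝ᵥ v + (u ⬝ᵥ v + v ⬝ᵥ v))) • (1 : 𝒜) -
      (ε * u ⬝ᵥ u) • 1 - (ε * v ⬝ᵥ v) • 1 := by rw [← h]; abel
    rw [h2]; module
  rw [reflMat_mulVec, map_sub, map_smul, sub_mul, smul_mul_assoc, hγ u, hu, eq_sub_of_add_eq h1]
  module

/-- Local spin lift of the rotation taking one unit vector to another. -/
noncomputable def spinStep (γ : (Fin n → ℝ) →ₗ[ℝ] 𝒜) (ε : ℝ) (u v : Fin n → ℝ) : 𝒜 :=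
  ε • (γ (midVec u v) * γ u)

lemma spinStep_mul {γ : (Fin n → ℝ) →ₗ[ℝ] 𝒜} {ε : ℝ}
    (hγ : ∀ v, γ v * γ v = (ε * (v ⬝ᵥ v)) • (1 : 𝒜)) {u v : Sph n} (h : 0 < u.1 ⬝ᵥ v.1)
    (w : Fin n → ℝ) : spinStep γ ε u.1 v.1 * γ w =
      γ ((reflMat (midVec u.1 v.1) * reflMat u.1) *ᵥ w) * spinStep γ ε u.1 v.1 := by
  rw [spinStep, smul_mul_assoc, mul_assoc, clifford_mul_reflMat hγ u.2, mul_neg, ← mul_assoc,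
    clifford_mul_reflMat hγ (midVec_dotProduct_self h), neg_mul, neg_neg, mulVec_mulVec,
    mul_smul_comm, mul_assoc]

variable [TopologicalSpace 𝒜] [IsTopologicalRing 𝒜] [ContinuousSMul ℝ 𝒜]

/-- Homotopies of unit vectors lift to homotopies of rotations and of their spin lifts. -/
theorem exists_rotation_lift {γ : (Fin n → ℝ) →ₗ[ℝ] 𝒜} {ε : ℝ} (hε : ε * ε = 1)
    (hγ : ∀ v, γ v * γ v = (ε * (v ⬝ᵥ v)) • (1 : 𝒜))
    {X : Type*} [PseudoMetricSpace X] [CompactSpace X] (H : X → I → Fin n → ℝ)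
    (hH : Continuous fun p : X × I => H p.1 p.2) (hH1 : ∀ x t, H x t ⬝ᵥ H x t = 1) :
    ∃ (R : X → I → Matrix (Fin n) (Fin n) ℝ) (s : X → I → 𝒜),
      (Continuous fun p : X × I => R p.1 p.2) ∧ (Continuous fun p : X × I => s p.1 p.2) ∧
      (∀ x, R x 0 = 1) ∧ (∀ x, s x 0 = 1) ∧ (∀ x t, R x t ∈ SOSet n) ∧
      (∀ x t, R x t *ᵥ H x 0 = H x t) ∧
      (∀ x v, (∀ t, H x t ⬝ᵥ v = 0) → ∀ t, R x t *ᵥ v = v) ∧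
      (∀ x t v, s x t * γ v = γ (R x t *ᵥ v) * s x t) ∧
      (∀ S : Submonoid 𝒜, (∀ u v : Fin n → ℝ, u ⬝ᵥ u = 1 → v ⬝ᵥ v = 1 → ε • (γ u * γ v) ∈ S) →
        ∀ x t, s x t ∈ S) ∧
      (∀ x x', H x = H x' → R x = R x') := by
  have hγc : Continuous γ := LinearMap.continuous_of_finiteDimensional γ
  let τ : Sph n → Sph n → Matrix (Fin n) (Fin n) ℝ × 𝒜 := fun u v =>
    (reflMat (midVec u.1 v.1) * reflMat u.1, spinStep γ ε u.1 v.1)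
  have hδ : (0 : ℝ) < 1 / (n + 1) := by positivity
  have hτ : ContinuousOn (fun p : Sph n × Sph n => τ p.1 p.2) {p | dist p.1 p.2 < 1 / (n + 1)} := by
    have hm : ContinuousOn (fun p : Sph n × Sph n => midVec p.1.1 p.2.1)
        {p | dist p.1 p.2 < 1 / (n + 1)} := by
      have h1 : Continuous fun p : Sph n × Sph n => p.1.1 + p.2.1 := by fun_prop
      refine ContinuousOn.smul (ContinuousOn.inv₀ (h1.dotProduct h1).sqrt.continuousOn
        fun p hp => ?_) h1.continuousOn
      · exact (Real.sqrt_pos.2 (midVec_aux (dotProduct_pos_of_dist_lt _ _ hp))).ne'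
    have hr : Continuous (reflMat : (Fin n → ℝ) → _) := by
      unfold reflMat; fun_prop
    have h2 : Continuous fun p : Sph n × Sph n => p.1.1 := by fun_prop
    refine ContinuousOn.prodMk ((hr.comp_continuousOn hm).mul (hr.comp h2).continuousOn) ?_
    exact ContinuousOn.const_smul ((hγc.comp_continuousOn hm).mul (hγc.comp h2).continuousOn) ε
  have hτ1 : ∀ u, τ u u = 1 := by
    intro u
    have h : spinStep γ ε u.1 u.1 = 1 := by
      rw [spinStep, midVec_self, hγ, u.2, mul_one, smul_smul, hε, one_smul]
    simp only [τ, midVec_self, reflMat_mul_self u.2, h]; rfl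
  obtain ⟨L, hLc, hL0, hLR, hLS, hLe⟩ := exists_homotopy_lift τ hδ hτ hτ1
    (fun g u v => g.1 ∈ SOSet n ∧ g.1 *ᵥ u.1 = v.1 ∧ ∀ w, g.2 * γ w = γ (g.1 *ᵥ w) * g.2)
    (fun u v h => by
      have h' := dotProduct_pos_of_dist_lt _ _ h
      exact ⟨reflMat_mul_reflMat_mem_SOSet (midVec_dotProduct_self h') u.2, reflMat_midVec h',
        spinStep_mul hγ h'⟩)
    (fun g g' u v w h h' => by
      refine ⟨mul_mem_SOSet h'.1 h.1, ?_, fun z => ?_⟩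
      · rw [Prod.fst_mul, ← mulVec_mulVec, h.2.1, h'.2.1]
      · rw [Prod.snd_mul, Prod.fst_mul, mul_assoc, h.2.2, ← mul_assoc, h'.2.2, mulVec_mulVec,
          mul_assoc])
    (fun x t => (⟨H x t, hH1 x t⟩ : Sph n)) (hH.subtype_mk _)
  refine ⟨fun x t => (L x t).1, fun x t => (L x t).2, hLc.fst, hLc.snd, fun x => by simp [hL0],
    fun x => by simp [hL0], fun x t => (hLR x t).1, fun x t => (hLR x t).2.1, ?_,
    fun x t => (hLR x t).2.2, ?_, ?_⟩
  · intro x v hv t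
    refine hLS ⟨⟨{g | g.1 *ᵥ v = v}, ?_⟩, ?_⟩ x ?_ t
    · intro a b ha hb
      simp only [Set.mem_ofPred_eq, Prod.fst_mul] at *
      rw [← mulVec_mulVec, hb, ha]
    · simp
    · intro s s' _
      change (reflMat _ * reflMat _) *ᵥ v = v
      have h : midVec (H x s) (H x s') ⬝ᵥ v = 0 := by
        rw [midVec, smul_dotProduct, add_dotProduct _ _ v, hv, hv, add_zero, smul_zero]
      rw [← mulVec_mulVec, reflMat_mulVec _ v, hv, mul_zero, zero_smul, sub_zero, reflMat_mulVec, h,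
        mul_zero, zero_smul, sub_zero]
  · intro S hS x t
    refine (hLS (S.comap (MonoidHom.snd _ _)) x ?_ t)
    intro s s' h
    exact hS _ _ (midVec_dotProduct_self (dotProduct_pos_of_dist_lt _ _ h)) (hH1 x s)
  · intro x x' h
    have := hLe x x' (by funext t; exact Subtype.ext (congrFun h t))
    funext t; simp only [this]

/-- Homotopies in the rotation group lift to the spin group. -/
theorem exists_spin_lift {γ : (Fin n → ℝ) →ₗ[ℝ] 𝒜} {ε : ℝ} (hε : ε * ε = 1)
    (hγ : ∀ v, γ v * γ v = (ε * (v ⬝ᵥ v)) • (1 : 𝒜))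
    {X : Type*} [PseudoMetricSpace X] [CompactSpace X] (H : X → I → Matrix (Fin n) (Fin n) ℝ)
    (hH : Continuous fun p : X × I => H p.1 p.2) (hH1 : ∀ x t, H x t ∈ SOSet n) :
    ∃ s : X → I → 𝒜, (Continuous fun p : X × I => s p.1 p.2) ∧ (∀ x, s x 0 = 1) ∧
      (∀ x t v, s x t * γ v = γ ((H x t * (H x 0)ᵀ) *ᵥ v) * s x t) ∧
      (∀ S : Submonoid 𝒜, (∀ u v : Fin n → ℝ, u ⬝ᵥ u = 1 → v ⬝ᵥ v = 1 → ε • (γ u * γ v) ∈ S) →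
        ∀ x t, s x t ∈ S) := by
  have key : ∀ k ≤ n, ∃ (R : X → I → Matrix (Fin n) (Fin n) ℝ) (s : X → I → 𝒜),
      (Continuous fun p : X × I => R p.1 p.2) ∧ (Continuous fun p : X × I => s p.1 p.2) ∧
      (∀ x, R x 0 = 1) ∧ (∀ x, s x 0 = 1) ∧ (∀ x t, R x t ∈ SOSet n) ∧
      (∀ x t v, s x t * γ v = γ (R x t *ᵥ v) * s x t) ∧
      (∀ S : Submonoid 𝒜, (∀ u v : Fin n → ℝ, u ⬝ᵥ u = 1 → v ⬝ᵥ v = 1 → ε • (γ u * γ v) ∈ S) →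
        ∀ x t, s x t ∈ S) ∧
      ∀ x t (j : Fin n), j.1 < k → R x t *ᵥ (H x 0).col j = (H x t).col j := by
    intro k
    induction k with
    | zero =>
      intro _
      exact ⟨fun _ _ => 1, fun _ _ => 1, continuous_const, continuous_const, fun _ => rfl,
        fun _ => rfl, fun _ _ => one_mem_SOSet, by simp, fun S _ _ _ => S.one_mem,
        fun _ _ j hj => absurd hj (Nat.not_lt_zero _)⟩
    | succ k ih =>
      intro hk
      obtain ⟨R, s, hR, hs, hR0, hs0, hRSO, hRs, hS, hcol⟩ := ih (Nat.le_of_succ_le hk)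
      let i : Fin n := ⟨k, hk⟩
      have hdot : ∀ x t (a b : Fin n), (H x t).col a ⬝ᵥ (H x t).col b = if a = b then 1 else 0 := by
        intro x t a b
        have := congrFun (congrFun (transpose_mul_of_mem_SOSet (hH1 x t)) a) b
        rw [one_apply] at this
        rw [← this]; rfl
      have hcancel : ∀ x t v, (R x t)ᵀ *ᵥ R x t *ᵥ v = v := fun x t v => by
        rw [mulVec_mulVec, transpose_mul_of_mem_SOSet (hRSO x t), one_mulVec]
      obtain ⟨R', s', hR', hs', hR0', hs0', hRSO', hRu', hfix', hRs', hS', -⟩ :=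
        exists_rotation_lift hε hγ (fun x t => (R x t)ᵀ *ᵥ (H x t).col i)
          (hR.matrix_transpose.matrix_mulVec
            (continuous_pi fun a => (hH.matrix_elem a i)))
          (fun x t => by
            rw [mulVec_dotProduct_mulVec_of_mem_SOSet (transpose_mem_SOSet (hRSO x t)), hdot,
              if_pos rfl])
      refine ⟨fun x t => R x t * R' x t, fun x t => s x t * s' x t, hR.matrix_mul hR', hs.mul hs',
        by simp [hR0, hR0'], by simp [hs0, hs0'], fun x t => mul_mem_SOSet (hRSO x t) (hRSO' x t),
        ?_, fun S h x t => S.mul_mem (hS S h x t) (hS' S h x t), ?_⟩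
      · intro x t v
        rw [mul_assoc, hRs', ← mul_assoc, hRs, mulVec_mulVec, mul_assoc]
      · intro x t j hj
        rw [← mulVec_mulVec]
        rcases Nat.lt_succ_iff_lt_or_eq.1 hj with hj | hj
        · rw [hfix' x ((H x 0).col j) (fun t' => ?_), hcol x t j hj]
          rw [← hcancel x t' ((H x 0).col j), hcol x t' j hj,
            mulVec_dotProduct_mulVec_of_mem_SOSet (transpose_mem_SOSet (hRSO x t')), hdot,
            if_neg]
          rintro rfl; exact lt_irrefl _ hj
        · have hji : j = i := Fin.ext hj
          have h := hRu' x t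
          rw [hR0, transpose_one, one_mulVec] at h
          rw [hji, h, mulVec_mulVec, (hRSO x t).1, one_mulVec]
  obtain ⟨R, s, -, hs, -, hs0, -, hRs, hS, hcol⟩ := key n le_rfl
  refine ⟨s, hs, hs0, fun x t v => ?_, hS⟩
  have : R x t * H x 0 = H x t := by
    refine ext_of_mulVec_single fun j => ?_
    rw [← mulVec_mulVec, mulVec_single_one, mulVec_single_one]
    exact hcol x t j j.2
  rw [hRs, ← this, Matrix.mul_assoc, (hH1 x 0).1, Matrix.mul_one]

end Spin

lemma exists_polar {n : ℕ} (w : Sph (n + 1)) (hn : Nonempty (Sph n)) :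
    ∃ v : Sph n, w.1 = Fin.cons (Real.cos (Real.arccos (w.1 0)))
      (Real.sin (Real.arccos (w.1 0)) • v.1) := by
  have h1 := abs_le.1 (abs_le_one_of_dotProduct w.2 0)
  have h2 : w.1 0 * w.1 0 + Fin.tail w.1 ⬝ᵥ Fin.tail w.1 = 1 := by
    refine Eq.trans ?_ w.2
    rw [dotProduct, dotProduct, Fin.sum_univ_succ]; rfl
  have h3 : Real.sin (Real.arccos (w.1 0)) = √(Fin.tail w.1 ⬝ᵥ Fin.tail w.1) := by
    rw [Real.sin_arccos]; congr 1; linarith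
  have h0 : 0 ≤ Fin.tail w.1 ⬝ᵥ Fin.tail w.1 :=
    Finset.sum_nonneg fun i _ => mul_self_nonneg (Fin.tail w.1 i)
  rw [Real.cos_arccos h1.1 h1.2, h3]
  by_cases h : Fin.tail w.1 ⬝ᵥ Fin.tail w.1 = 0
  · obtain ⟨v⟩ := hn
    refine ⟨v, ?_⟩
    rw [h, Real.sqrt_zero, zero_smul, ← dotProduct_self_eq_zero.1 h, Fin.cons_self_tail]
  · have hp : 0 < √(Fin.tail w.1 ⬝ᵥ Fin.tail w.1) := Real.sqrt_pos.2 (lt_of_le_of_ne h0 (Ne.symm h))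
    refine ⟨⟨(√(Fin.tail w.1 ⬝ᵥ Fin.tail w.1))⁻¹ • Fin.tail w.1, ?_⟩, ?_⟩
    · rw [smul_dotProduct, dotProduct_smul, smul_eq_mul, smul_eq_mul, ← mul_assoc, ← mul_inv,
        Real.mul_self_sqrt h0, inv_mul_cancel₀ h]
    · rw [smul_smul, mul_inv_cancel₀ hp.ne', one_smul, Fin.cons_self_tail]

lemma cons_dotProduct_cons {n : ℕ} (a b : ℝ) (v w : Fin n → ℝ) :
    (Fin.cons a v : Fin (n + 1) → ℝ) ⬝ᵥ Fin.cons b w = a * b + v ⬝ᵥ w := by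
  simp [dotProduct, Fin.sum_univ_succ]

lemma continuous_finCons {X : Type*} [TopologicalSpace X] {n : ℕ} {f : X → ℝ} {g : X → Fin n → ℝ}
    (hf : Continuous f) (hg : Continuous g) :
    Continuous fun x => (Fin.cons (f x) (g x) : Fin (n + 1) → ℝ) :=
  continuous_pi fun i => by
    refine Fin.cases ?_ (fun j => ?_) i
    · simpa using hf
    · simpa [Function.comp_def] using (continuous_apply j).comp hg

/-- The point of the sphere with given height angle and horizontal direction. -/
noncomputable def susp {n : ℕ} (v : Sph n) (t : I) : Sph (n + 1) :=
  ⟨Fin.cons (Real.cos (Real.pi * t)) (Real.sin (Real.pi * t) • v.1), by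
    rw [cons_dotProduct_cons, smul_dotProduct, dotProduct_smul, v.2, smul_eq_mul, smul_eq_mul,
      mul_one]
    nlinarith [Real.sin_sq_add_cos_sq (Real.pi * t)]⟩

lemma continuous_susp {n : ℕ} : Continuous fun p : Sph n × I => susp p.1 p.2 := by
  have h1 : Continuous fun p : Sph n × I => Real.sin (Real.pi * p.2) • p.1.1 := by fun_prop
  exact Continuous.subtype_mk (continuous_finCons (by fun_prop) h1) _

lemma susp_surjective {n : ℕ} (hn : Nonempty (Sph n)) (w : Sph (n + 1)) :
    ∃ v t, susp v t = w := by
  obtain ⟨v, hv⟩ := exists_polar w hn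
  have hpi : Real.pi * (Real.arccos (w.1 0) / Real.pi) = Real.arccos (w.1 0) :=
    mul_div_cancel₀ _ Real.pi_ne_zero
  refine ⟨v, ⟨Real.arccos (w.1 0) / Real.pi, div_nonneg (Real.arccos_nonneg _) Real.pi_pos.le,
    (div_le_one Real.pi_pos).2 (Real.arccos_le_pi _)⟩, Subtype.ext ?_⟩
  rw [susp]
  simp only [hpi]
  exact hv.symm

lemma susp_eq_susp {n : ℕ} {v v' : Sph n} {t t' : I} (h : susp v t = susp v' t') :
    t = t' ∧ (v = v' ∨ t = 0 ∨ t = 1) := by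
  have h1 : (susp v t).1 = (susp v' t').1 := congrArg _ h
  simp only [susp] at h1
  obtain ⟨hc, hs⟩ := Fin.cons_inj.1 h1
  have hmem : ∀ t : I, Real.pi * (t : ℝ) ∈ Set.Icc 0 Real.pi := fun t =>
    ⟨mul_nonneg Real.pi_pos.le t.2.1, mul_le_of_le_one_right Real.pi_pos.le t.2.2⟩
  have ht : t = t' :=
    Subtype.ext (mul_left_cancel₀ Real.pi_ne_zero (Real.injOn_cos (hmem t) (hmem t') hc))
  refine ⟨ht, ?_⟩
  subst ht
  by_cases h0 : Real.sin (Real.pi * t) = 0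
  · right
    by_contra hcon
    push Not at hcon
    have h01 : 0 < (t : ℝ) := lt_of_le_of_ne t.2.1 fun h => hcon.1 (Subtype.ext h.symm)
    have h11 : (t : ℝ) < 1 := lt_of_le_of_ne t.2.2 fun h => hcon.2 (Subtype.ext h)
    exact (Real.sin_pos_of_pos_of_lt_pi (mul_pos Real.pi_pos h01)
      (by nlinarith [Real.pi_pos])).ne' h0
  · left
    exact Subtype.ext (smul_right_injective _ h0 hs)

/-- Functions on the cylinder constant on both ends descend to the suspension. -/
theorem exists_descent {n : ℕ} (hn : Nonempty (Sph n)) {Z Y : Type*} [TopologicalSpace Z]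
    [CompactSpace Z] [T2Space Z] [TopologicalSpace Y] (Φ : Sph n → I → Z → Y)
    (hΦ : Continuous fun p : Sph n × I × Z => Φ p.1 p.2.1 p.2.2)
    (h0 : ∀ v v', Φ v 0 = Φ v' 0) (h1 : ∀ v v', Φ v 1 = Φ v' 1) :
    ∃ Ψ : Sph (n + 1) → Z → Y, (Continuous fun p : Sph (n + 1) × Z => Ψ p.1 p.2) ∧
      ∀ v t, Ψ (susp v t) = Φ v t := by
  choose V T hVT using fun w => susp_surjective hn w
  have hΨ : ∀ v t, Φ (V (susp v t)) (T (susp v t)) = Φ v t := by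
    intro v t
    obtain ⟨h2, h3⟩ := susp_eq_susp (hVT (susp v t))
    rw [h2] at h3 ⊢
    rcases h3 with h3 | h3 | h3
    · rw [h3]
    · rw [h3]; exact h0 _ _
    · rw [h3]; exact h1 _ _
  refine ⟨fun w => Φ (V w) (T w), ?_, hΨ⟩
  have hq : IsQuotientMap fun p : Sph n × I × Z => (susp p.1 p.2.1, p.2.2) := by
    have hc : Continuous fun p : Sph n × I × Z => (susp p.1 p.2.1, p.2.2) :=
      (continuous_susp.comp (continuous_fst.prodMk continuous_snd.fst)).prodMk continuous_snd.snd
    refine hc.isClosedMap.isQuotientMap hc fun q => ?_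
    obtain ⟨v, t, h⟩ := susp_surjective hn q.1
    exact ⟨(v, t, q.2), Prod.ext h rfl⟩
  rw [hq.continuous_iff]
  refine hΦ.congr fun p => ?_
  exact (congrFun (hΨ p.1 p.2.1) p.2.2).symm

/-- Spherical coordinates. -/
noncomputable def angleMap : (d : ℕ) → (Fin d → ℝ) → Fin (d + 1) → ℝ
  | 0, _ => fun _ => 1
  | d + 1, a => Fin.cons (Real.cos (a 0)) (Real.sin (a 0) • angleMap d (Fin.tail a))

lemma angleMap_dotProduct_self (d : ℕ) (a : Fin d → ℝ) : angleMap d a ⬝ᵥ angleMap d a = 1 := by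
  induction d with
  | zero => simp [angleMap, dotProduct]
  | succ d ih =>
    rw [angleMap, cons_dotProduct_cons, smul_dotProduct, dotProduct_smul, ih, smul_eq_mul,
      smul_eq_mul, mul_one]
    nlinarith [Real.sin_sq_add_cos_sq (a 0)]

lemma contDiff_angleMap (d : ℕ) : ContDiff ℝ 1 (angleMap d) := by
  induction d with
  | zero => exact contDiff_const
  | succ d ih =>
    rw [contDiff_pi]
    intro i
    refine Fin.cases ?_ (fun j => ?_) i
    · simp only [angleMap, Fin.cons_zero]; fun_prop
    · simp only [angleMap, Fin.cons_succ, Pi.smul_apply, smul_eq_mul]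
      have h1 : ContDiff ℝ 1 fun a : Fin (d + 1) → ℝ => angleMap d (Fin.tail a) :=
        ih.comp (contDiff_pi.2 fun k => contDiff_apply ℝ ℝ _)
      exact (Real.contDiff_sin.comp (contDiff_apply ℝ ℝ _)).mul (contDiff_pi.1 h1 j)

instance (n : ℕ) : Nonempty (Sph (n + 1)) := ⟨⟨angleMap n 0, angleMap_dotProduct_self n 0⟩⟩

lemma exists_angleMap_eq_or_neg (d : ℕ) (w : Sph (d + 1)) :
    ∃ a, w.1 = angleMap d a ∨ w.1 = - angleMap d a := by
  induction d with
  | zero =>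
    refine ⟨0, ?_⟩
    have h : w.1 0 * w.1 0 = 1 := by simpa [dotProduct] using w.2
    rcases mul_self_eq_one_iff.1 h with h | h
    · left; ext i; fin_cases i; exact h
    · right; ext i; fin_cases i; exact h
  | succ d ih =>
    obtain ⟨v, hv⟩ := exists_polar w inferInstance
    obtain ⟨a, ha | ha⟩ := ih v
    · exact ⟨Fin.cons (Real.arccos (w.1 0)) a, Or.inl (by
        rw [angleMap, Fin.cons_zero, Fin.tail_cons, ← ha]; exact hv)⟩
    · refine ⟨Fin.cons (- Real.arccos (w.1 0)) a, Or.inl ?_⟩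
      rw [angleMap, Fin.cons_zero, Fin.tail_cons, Real.cos_neg, Real.sin_neg, neg_smul,
        ← smul_neg, ← ha]
      exact hv

lemma angleMap_surjective {d : ℕ} (hd : 0 < d) (w : Sph (d + 1)) : ∃ a, angleMap d a = w.1 := by
  obtain ⟨d, rfl⟩ := Nat.exists_eq_succ_of_ne_zero hd.ne'
  obtain ⟨v, hv⟩ := exists_polar w inferInstance
  obtain ⟨a, ha | ha⟩ := exists_angleMap_eq_or_neg d v
  · refine ⟨Fin.cons (Real.arccos (w.1 0)) a, ?_⟩
    rw [angleMap, Fin.cons_zero, Fin.tail_cons, ← ha]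
    exact hv.symm
  · refine ⟨Fin.cons (- Real.arccos (w.1 0)) a, ?_⟩
    rw [angleMap, Fin.cons_zero, Fin.tail_cons, Real.cos_neg, Real.sin_neg, neg_smul,
        ← smul_neg, ← ha]
    exact hv.symm

lemma preconnectedSpace_sph {d : ℕ} (hd : 0 < d) : PreconnectedSpace (Sph (d + 1)) := by
  have hs : Function.Surjective
      fun a : Fin d → ℝ => (⟨angleMap d a, angleMap_dotProduct_self d a⟩ : Sph (d + 1)) :=
    fun w => (angleMap_surjective hd w).imp fun _ h => Subtype.ext h
  exact hs.denseRange.preconnectedSpace ((contDiff_angleMap d).continuous.subtype_mk _)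

instance (n : ℕ) : PreconnectedSpace (Sph (n + 2)) := preconnectedSpace_sph (Nat.succ_pos n)

lemma exists_smooth_approx_real {n : ℕ} (f : C(Sph n, ℝ)) {ε : ℝ} (hε : 0 < ε) :
    ∃ P : (Fin n → ℝ) → ℝ, ContDiff ℝ 1 P ∧ ∀ x : Sph n, |P x.1 - f x| < ε := by
  let 𝒮 : Subalgebra ℝ C(Sph n, ℝ) :=
    { carrier := {g | ∃ P : (Fin n → ℝ) → ℝ, ContDiff ℝ 1 P ∧ ∀ x : Sph n, P x.1 = g x}
      mul_mem' := fun ⟨P, hP, hp⟩ ⟨Q, hQ, hq⟩ =>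
        ⟨fun x => P x * Q x, hP.mul hQ, fun x => by simp [hp, hq]⟩
      add_mem' := fun ⟨P, hP, hp⟩ ⟨Q, hQ, hq⟩ =>
        ⟨fun x => P x + Q x, hP.add hQ, fun x => by simp [hp, hq]⟩
      algebraMap_mem' := fun r => ⟨fun _ => r, contDiff_const, fun x => rfl⟩ }
  have hsep : 𝒮.SeparatesPoints := by
    intro x y hxy
    obtain ⟨i, hi⟩ := Function.ne_iff.1 fun h => hxy (Subtype.ext h)
    refine ⟨_, ⟨⟨fun x => x.1 i, (continuous_apply i).comp continuous_subtype_val⟩, ⟨fun x => x i, contDiff_apply _ _ _, fun x => rfl⟩,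
      rfl⟩, hi⟩
  obtain ⟨⟨g, P, hP, hp⟩, hg⟩ :=
    ContinuousMap.exists_mem_subalgebra_near_continuousMap_of_separatesPoints 𝒮 hsep f ε hε
  refine ⟨P, hP, fun x => ?_⟩
  rw [hp]
  exact ((g - f).norm_coe_le_norm x).trans_lt hg

lemma exists_smooth_approx {n m : ℕ} (f : C(Sph n, Fin m → ℝ)) {ε : ℝ} (hε : 0 < ε) :
    ∃ P : (Fin n → ℝ) → Fin m → ℝ, ContDiff ℝ 1 P ∧ (∀ x : Sph n, ‖P x.1 - f x‖ < ε) ∧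
      ((∀ x y : Sph n, y.1 = - x.1 → f y = f x) → ∀ x, P (-x) = P x) := by
  have h : ∀ i, ∃ P : (Fin n → ℝ) → ℝ, ContDiff ℝ 1 P ∧ ∀ x : Sph n, |P x.1 - f x i| < ε := fun i =>
    exists_smooth_approx_real ⟨fun x => f x i, by fun_prop⟩ hε
  choose P hP hPf using h
  have hP' : ContDiff ℝ 1 fun x i => P i x := contDiff_pi.2 hP
  have hlt : ∀ x : Sph n, ‖(fun i => P i x.1) - f x‖ < ε := fun x =>
    (pi_norm_lt_iff hε).2 fun i => hPf i x
  by_cases he : ∀ x y : Sph n, y.1 = - x.1 → f y = f x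
  · refine ⟨fun x => (1 / 2 : ℝ) • ((fun i => P i x) + fun i => P i (-x)),
      (hP'.add (hP'.comp contDiff_neg)).const_smul _, fun x => ?_, fun _ x => ?_⟩
    · have h1 := hlt x
      have h2 := hlt ⟨-x.1, by rw [neg_dotProduct_neg, x.2]⟩
      rw [he x ⟨-x.1, by rw [neg_dotProduct_neg, x.2]⟩ rfl] at h2
      have h3 : (1 / 2 : ℝ) • ((fun i => P i x.1) + fun i => P i (-x.1)) - f x =
        (1 / 2 : ℝ) • (((fun i => P i x.1) - f x) + ((fun i => P i (-x.1)) - f x)) := by module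
      rw [h3, norm_smul]
      refine (mul_le_mul_of_nonneg_left (norm_add_le _ _) (norm_nonneg _)).trans_lt ?_
      norm_num; linarith
    · simp only [neg_neg]; rw [add_comm]
  · exact ⟨fun x i => P i x, hP', hlt, fun h => absurd h he⟩

lemma dense_avoid_cone {d m : ℕ} (hd : 0 < d) (hm : d + 1 < m)
    {P : (Fin (d + 1) → ℝ) → Fin m → ℝ} (hP : ContDiff ℝ 1 P) :
    Dense {q : Fin m → ℝ | ∀ (x : Sph (d + 1)) (r : ℝ), r • P x.1 ≠ q} := by
  have hc : ContDiff ℝ 1 fun p : (Fin d → ℝ) × ℝ => p.2 • P (angleMap d p.1) :=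
    contDiff_snd.smul (hP.comp ((contDiff_angleMap d).comp contDiff_fst))
  refine (hc.dense_compl_range_of_finrank_lt_finrank (by simpa using hm)).mono ?_
  intro q hq x r h
  obtain ⟨a, ha⟩ := angleMap_surjective hd x
  exact hq ⟨(a, r), by simp only [ha]; exact h⟩

section Adm
variable {X V : Type*} [TopologicalSpace X] [TopologicalSpace V]

/-- Maps with values in `U` which identify the pairs related by `r`. -/
def Adm (r : X → X → Prop) (U : Set V) (h : C(X, V)) : Prop :=
  (∀ x, h x ∈ U) ∧ ∀ x y, r x y → h x = h y

lemma homotopicWith_of_fun {P : C(X, V) → Prop} {f g : C(X, V)} (H : X → I → V)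
    (hH : Continuous fun p : X × I => H p.1 p.2) (h0 : ∀ x, H x 0 = f x) (h1 : ∀ x, H x 1 = g x)
    (hP : ∀ t, P ⟨fun x => H x t, hH.comp (continuous_id.prodMk continuous_const)⟩) :
    f.HomotopicWith g P :=
  ⟨⟨⟨⟨fun p => H p.2 p.1, hH.comp continuous_swap⟩, h0, h1⟩, hP⟩⟩

lemma exists_fun_of_homotopicWith {r : X → X → Prop} {U : Set V} {f g : C(X, V)}
    (h : f.HomotopicWith g (Adm r U)) :
    ∃ H : X → I → V, (Continuous fun p : X × I => H p.1 p.2) ∧ (∀ x, H x 0 = f x) ∧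
      (∀ x, H x 1 = g x) ∧ (∀ x t, H x t ∈ U) ∧ ∀ x y, r x y → H x = H y := by
  obtain ⟨F⟩ := h
  exact ⟨fun x t => F (t, x), F.continuous.comp continuous_swap, fun x => F.map_zero_left x,
    fun x => F.map_one_left x, fun x t => (F.prop' t).1 x,
    fun x y h => funext fun t => (F.prop' t).2 x y h⟩

lemma homotopicWith_adm_of_fun {r : X → X → Prop} {U : Set V} {f g : C(X, V)} (H : X → I → V)
    (hH : Continuous fun p : X × I => H p.1 p.2) (h0 : ∀ x, H x 0 = f x) (h1 : ∀ x, H x 1 = g x)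
    (hU : ∀ x t, H x t ∈ U) (hr : ∀ x y t, r x y → H x t = H y t) :
    f.HomotopicWith g (Adm r U) :=
  homotopicWith_of_fun H hH h0 h1 fun t => ⟨fun x => hU x t, fun x y h => hr x y t h⟩

lemma homotopicWith_comp {W : Type*} [TopologicalSpace W] {r : X → X → Prop} {U : Set V}
    {f g : C(X, V)} (h : f.HomotopicWith g (Adm r U)) {φ : V → W} (hφ : ContinuousOn φ U)
    {U' : Set W} (hU' : ∀ v ∈ U, φ v ∈ U') {f' g' : C(X, W)} (hf : ∀ x, f' x = φ (f x))
    (hg : ∀ x, g' x = φ (g x)) : f'.HomotopicWith g' (Adm r U') := by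
  obtain ⟨H, hH, h0, h1, hU, hr⟩ := exists_fun_of_homotopicWith h
  refine homotopicWith_adm_of_fun (fun x t => φ (H x t))
    (hφ.comp_continuous hH fun p => hU p.1 p.2) (fun x => ?_) (fun x => ?_) (fun x t => hU' _ (hU x t))
    (fun x y t hxy => by rw [hr x y hxy])
  · rw [h0, hf]
  · rw [h1, hg]

lemma homotopicWith_line [AddCommGroup V] [Module ℝ V] [ContinuousAdd V] [ContinuousSMul ℝ V]
    {r : X → X → Prop} {U : Set V} {f g : C(X, V)} (hf : ∀ x y, r x y → f x = f y)
    (hg : ∀ x y, r x y → g x = g y)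
    (hU : ∀ x (t : ℝ), 0 ≤ t → t ≤ 1 → (1 - t) • f x + t • g x ∈ U) :
    f.HomotopicWith g (Adm r U) := by
  refine homotopicWith_adm_of_fun (fun x t => (1 - (t : ℝ)) • f x + (t : ℝ) • g x)
    (by fun_prop) (by simp) (by simp) (fun x t => hU x t t.2.1 t.2.2) fun x y t h => ?_
  simp only [hf x y h, hg x y h]
end Adm

lemma dotProduct_self_pos_iff {n : ℕ} {v : Fin n → ℝ} : 0 < v ⬝ᵥ v ↔ v ≠ 0 := by
  have h0 : 0 ≤ v ⬝ᵥ v := Finset.sum_nonneg fun i _ => mul_self_nonneg _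
  rw [lt_iff_le_and_ne, ne_comm, Ne, dotProduct_self_eq_zero]; simp [h0]

/-- Normalisation of a nonzero vector. -/
noncomputable def normVec {n : ℕ} (v : Fin n → ℝ) : Fin n → ℝ := (√(v ⬝ᵥ v))⁻¹ • v

lemma normVec_dotProduct_self {n : ℕ} {v : Fin n → ℝ} (hv : v ≠ 0) :
    normVec v ⬝ᵥ normVec v = 1 := by
  have h := dotProduct_self_pos_iff.2 hv
  rw [normVec, smul_dotProduct, dotProduct_smul, smul_eq_mul, smul_eq_mul, ← mul_assoc, ← mul_inv,
    Real.mul_self_sqrt h.le, inv_mul_cancel₀ h.ne']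

lemma normVec_eq_self {n : ℕ} {v : Fin n → ℝ} (hv : v ⬝ᵥ v = 1) : normVec v = v := by
  simp [normVec, hv]

lemma continuousOn_normVec {n : ℕ} : ContinuousOn (normVec : (Fin n → ℝ) → _) {v | v ≠ 0} := by
  refine ContinuousOn.smul (ContinuousOn.inv₀ (Continuous.continuousOn (Continuous.sqrt
    (continuous_id.dotProduct continuous_id))) fun v hv => ?_) continuousOn_id
  exact (Real.sqrt_pos.2 (dotProduct_self_pos_iff.2 hv)).ne'

lemma ne_zero_of_norm_sub_lt {n : ℕ} {f g : Fin n → ℝ} {c : ℝ} (h : ‖g - f‖ < c) (hf : c ≤ ‖f‖) :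
    ∀ t : ℝ, 0 ≤ t → t ≤ 1 → (1 - t) • f + t • g ≠ 0 := by
  intro t h0 h1 h2
  have h3 : f = - (t • (g - f)) := by
    rw [eq_neg_iff_add_eq_zero, ← h2]; module
  have h4 : ‖f‖ ≤ ‖g - f‖ := by
    conv_lhs => rw [h3]
    rw [norm_neg, norm_smul, Real.norm_of_nonneg h0]
    exact mul_le_of_le_one_left (norm_nonneg _) h1
  linarith

lemma one_div_le_norm {n : ℕ} {v : Fin n → ℝ} (hv : v ⬝ᵥ v = 1) : 1 / ((n : ℝ) + 1) ≤ ‖v‖ := by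
  by_contra! h
  have hi : ∀ i, v i * v i ≤ 1 / (n + 1) := by
    intro i
    have h2 : |v i| ≤ 1 / (n + 1) := (norm_le_pi_norm v i).trans h.le
    have h3 := abs_le_one_of_dotProduct hv i
    rw [← abs_mul_abs_self]
    nlinarith [abs_nonneg (v i)]
  have : v ⬝ᵥ v ≤ n / (n + 1) := by
    calc _ ≤ ∑ i : Fin n, (1 : ℝ) / (n + 1) := Finset.sum_le_sum fun i _ => hi i
      _ = n / (n + 1) := by simp; ring
  rw [hv, one_le_div (by positivity)] at this
  linarith

/-- Maps from a sphere to a sphere of larger dimension are null-homotopic, evenly if the map is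
even. -/
theorem homotopicWith_const_of_lt {d m : ℕ} (hd : 0 < d) (hm : d + 1 < m)
    (c : C(Sph (d + 1), Fin m → ℝ)) (hc : ∀ x, c x ⬝ᵥ c x = 1) {e : Fin m → ℝ} (he : e ⬝ᵥ e = 1)
    (r : Sph (d + 1) → Sph (d + 1) → Prop)
    (hr : (∀ x y, ¬ r x y) ∨ ((∀ x y, r x y ↔ y.1 = - x.1) ∧ ∀ x y, r x y → c x = c y)) :
    c.HomotopicWith (ContinuousMap.const _ e) (Adm r {v | v ⬝ᵥ v = 1}) := by
  have hrc : ∀ x y, r x y → c x = c y := by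
    rcases hr with hr | hr
    · exact fun x y h => absurd h (hr x y)
    · exact hr.2
  have hε : (0 : ℝ) < 1 / ((m : ℝ) + 1) := by positivity
  obtain ⟨P, hP, hPc, hPe⟩ := exists_smooth_approx c hε
  obtain ⟨q, hq, hqe⟩ := Metric.dense_iff.1 (dense_avoid_cone hd hm hP) (-e) _ hε
  let c' : C(Sph (d + 1), Fin m → ℝ) := ⟨fun x => P x.1, hP.continuous.comp continuous_subtype_val⟩
  have hrc' : ∀ x y, r x y → c' x = c' y := by
    rcases hr with hr | hr
    · exact fun x y h => absurd h (hr x y)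
    · intro x y h
      have := hPe (fun x y h => (hr.2 x y ((hr.1 x y).2 h)).symm) x.1
      change P x.1 = P y.1
      rw [← this, (hr.1 x y).1 h]
  have h1 : c.HomotopicWith c' (Adm r {v | v ≠ 0}) :=
    homotopicWith_line hrc hrc' fun x t h0 h1 =>
      ne_zero_of_norm_sub_lt (hPc x) (one_div_le_norm (hc x)) t h0 h1
  have h2 : c'.HomotopicWith (ContinuousMap.const _ (-q)) (Adm r {v | v ≠ 0}) := by
    refine homotopicWith_line hrc' (fun _ _ _ => rfl) fun x t h0 h1 h2 => ?_
    change (1 - t) • P x.1 + t • (-q) = 0 at h2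
    have hPx : P x.1 ≠ 0 := fun h => by
      have := hPc x
      rw [h, zero_sub, norm_neg] at this
      exact absurd (one_div_le_norm (hc x)) (not_le.2 this)
    rcases eq_or_lt_of_le h0 with h | h
    · rw [← h] at h2
      simp at h2; exact hPx h2
    · refine hqe x (t⁻¹ * (1 - t)) ?_
      rw [smul_neg, add_neg_eq_zero] at h2
      rw [mul_smul, h2, smul_smul, inv_mul_cancel₀ h.ne', one_smul]
  have h3 : (ContinuousMap.const (Sph (d + 1)) e).HomotopicWith (ContinuousMap.const _ (-q))
      (Adm r {v | v ≠ 0}) := by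
    refine homotopicWith_line (fun _ _ _ => rfl) (fun _ _ _ => rfl) fun x t h0 h1 =>
      ne_zero_of_norm_sub_lt ?_ (one_div_le_norm he) t h0 h1
    rw [mem_ball_iff_norm] at hq
    have h4 : -q - e = - (q - -e) := by abel
    rw [ContinuousMap.const_apply, h4, norm_neg]
    exact hq
  exact homotopicWith_comp ((h1.trans h2).trans h3.symm) continuousOn_normVec
    (fun v hv => normVec_dotProduct_self hv) (fun x => (normVec_eq_self (hc x)).symm)
    (fun x => (normVec_eq_self he).symm)

lemma dimH_range_lt {E F : Type*} [NormedAddCommGroup E] [NormedSpace ℝ E] [FiniteDimensional ℝ E]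
    [NormedAddCommGroup F] [NormedSpace ℝ F] {f : E → F} (hf : ContDiff ℝ 1 f) {n : ℕ}
    (h : Module.finrank ℝ E < n) : dimH (Set.range f) < n :=
  hf.dimH_range_le.trans_lt (by exact_mod_cast h)

lemma contDiff_angleMap_cons {d : ℕ} {E : Type*} [NormedAddCommGroup E] [NormedSpace ℝ E]
    {f : E → ℝ} {g : E → Fin d → ℝ} (hf : ContDiff ℝ 1 f) (hg : ContDiff ℝ 1 g) :
    ContDiff ℝ 1 fun x => angleMap (d + 1) (Fin.cons (f x) (g x)) := by
  refine (contDiff_angleMap _).comp (contDiff_pi.2 fun i => ?_)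
  refine Fin.cases ?_ (fun j => ?_) i
  · simpa using hf
  · simpa using contDiff_pi.1 hg j

lemma susp_eq_angleMap {d : ℕ} {x : Sph (d + 1)} {a : Fin d → ℝ} (ha : angleMap d a = x.1) (t : I) :
    (susp x t).1 = angleMap (d + 1) (Fin.cons (Real.pi * t) a) := by
  rw [angleMap, Fin.cons_zero, Fin.tail_cons, ha]; rfl

/-- The pairs of points on the same end of the cylinder. -/
def sameEnd {X : Type*} (p q : X × I) : Prop := (p.2 = 0 ∧ q.2 = 0) ∨ (p.2 = 1 ∧ q.2 = 1)

lemma susp_eq_of_sameEnd {n : ℕ} {p q : Sph n × I} (h : sameEnd p q) :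
    susp p.1 p.2 = susp q.1 q.2 := by
  refine Subtype.ext ?_
  rcases h with ⟨h1, h2⟩ | ⟨h1, h2⟩ <;> simp [susp, h1, h2]

lemma exists_avoiding_directions {P : (Fin 5 → ℝ) → Fin 4 → ℝ} (hP : ContDiff ℝ 1 P) :
    ∃ α β : Fin 4 → ℝ, 0 < α 0 ∧ β 0 < 0 ∧
      (∀ (x : Sph 4) (t t' : I) (r r' : ℝ), r • P (susp x t).1 = α → r' • P (susp x t').1 ≠ β) ∧
      ∀ (x : Sph 4) (t : I) (r : ℝ), t = 0 ∨ t = 1 → r • P (susp x t).1 ≠ α ∧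
        r • P (susp x t).1 ≠ β := by
  let N : Fin 5 → ℝ := Fin.cons 1 0
  let S : Fin 5 → ℝ := Fin.cons (-1) 0
  let f : (Fin 3 → ℝ) × (ℝ × ℝ) × (ℝ × ℝ) → (Fin 4 → ℝ) × (Fin 4 → ℝ) := fun p =>
    (p.2.2.1 • P (angleMap 4 (Fin.cons p.2.1.1 p.1)), p.2.2.2 • P (angleMap 4 (Fin.cons p.2.1.2 p.1)))
  have hf : ContDiff ℝ 1 f := by
    have h1 : ContDiff ℝ 1 fun p : (Fin 3 → ℝ) × (ℝ × ℝ) × (ℝ × ℝ) =>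
        angleMap 4 (Fin.cons p.2.1.1 p.1) := contDiff_angleMap_cons (by fun_prop) (by fun_prop)
    have h2 : ContDiff ℝ 1 fun p : (Fin 3 → ℝ) × (ℝ × ℝ) × (ℝ × ℝ) =>
        angleMap 4 (Fin.cons p.2.1.2 p.1) := contDiff_angleMap_cons (by fun_prop) (by fun_prop)
    have h3 : ContDiff ℝ 1 fun p : (Fin 3 → ℝ) × (ℝ × ℝ) × (ℝ × ℝ) => p.2.2.1 := by fun_prop
    have h4 : ContDiff ℝ 1 fun p : (Fin 3 → ℝ) × (ℝ × ℝ) × (ℝ × ℝ) => p.2.2.2 := by fun_prop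
    exact (h3.smul (hP.comp h1)).prodMk (h4.smul (hP.comp h2))
  let f₁ : (Fin 5 → ℝ) → ℝ × (Fin 4 → ℝ) → (Fin 4 → ℝ) × (Fin 4 → ℝ) := fun z p =>
    (p.1 • P z, p.2)
  let f₂ : (Fin 5 → ℝ) → ℝ × (Fin 4 → ℝ) → (Fin 4 → ℝ) × (Fin 4 → ℝ) := fun z p =>
    (p.2, p.1 • P z)
  have hf₁ : ∀ z, ContDiff ℝ 1 (f₁ z) := fun z => by unfold f₁; fun_prop
  have hf₂ : ∀ z, ContDiff ℝ 1 (f₂ z) := fun z => by unfold f₂; fun_prop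
  let bad : Set ((Fin 4 → ℝ) × (Fin 4 → ℝ)) := Set.range f ∪ (Set.range (f₁ N) ∪
    (Set.range (f₁ S) ∪ (Set.range (f₂ N) ∪ Set.range (f₂ S))))
  have hbad : dimH bad < Module.finrank ℝ ((Fin 4 → ℝ) × (Fin 4 → ℝ)) := by
    simp only [bad, dimH_union, max_lt_iff]
    refine ⟨dimH_range_lt hf ?_, dimH_range_lt (hf₁ _) ?_, dimH_range_lt (hf₁ _) ?_,
      dimH_range_lt (hf₂ _) ?_, dimH_range_lt (hf₂ _) ?_⟩ <;> simp
  have hdense := dense_compl_of_dimH_lt_finrank hbad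
  obtain ⟨p, ⟨hp0, hp1⟩, hp⟩ := hdense.inter_open_nonempty
    {p | 0 < p.1 0 ∧ p.2 0 < 0}
    ((isOpen_lt continuous_const ((continuous_apply 0).comp continuous_fst)).inter
      (isOpen_lt ((continuous_apply 0).comp continuous_snd) continuous_const))
    ⟨(fun _ => 1, fun _ => -1), by norm_num, by norm_num⟩
  refine ⟨p.1, p.2, hp0, hp1, ?_, ?_⟩
  · intro x t t' r r' h h'
    obtain ⟨a, ha⟩ := angleMap_surjective (by norm_num : 0 < 3) x
    rw [susp_eq_angleMap ha] at h h'
    exact hp (Or.inl ⟨(a, (Real.pi * t, Real.pi * t'), (r, r')), Prod.ext h h'⟩)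
  · intro x t r ht
    rcases ht with rfl | rfl
    · have : (susp x 0).1 = N := by simp [susp, N]
      rw [this]
      exact ⟨fun h => hp (Or.inr (Or.inl ⟨(r, p.2), Prod.ext h rfl⟩)),
        fun h => hp (Or.inr (Or.inr (Or.inr (Or.inl ⟨(r, p.1), Prod.ext rfl h⟩))))⟩
    · have : (susp x 1).1 = S := by simp [susp, S]
      rw [this]
      exact ⟨fun h => hp (Or.inr (Or.inr (Or.inl ⟨(r, p.2), Prod.ext h rfl⟩))),
        fun h => hp (Or.inr (Or.inr (Or.inr (Or.inr ⟨(r, p.1), Prod.ext rfl h⟩))))⟩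

/-- Reparametrisation of the interval fixing the end points. -/
noncomputable def shear (θ : ℝ) (t : I) : I :=
  Set.projIcc 0 1 zero_le_one ((t : ℝ) + max θ 0 * t - max (-θ) 0 * (1 - t))

lemma continuous_shear : Continuous fun p : ℝ × I => shear p.1 p.2 :=
  continuous_projIcc.comp (by fun_prop)

lemma shear_zero_left (t : I) : shear 0 t = t := by
  simp [shear, Set.projIcc_val]

lemma shear_zero (θ : ℝ) : shear θ 0 = 0 :=
  Set.projIcc_of_le_left _ (by simp)

lemma shear_one (θ : ℝ) : shear θ 1 = 1 :=
  Set.projIcc_of_right_le _ (by simp)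

lemma shear_one_left {t : I} (ht : 1 / 2 ≤ (t : ℝ)) : shear 1 t = 1 :=
  Set.projIcc_of_right_le _ (by norm_num; linarith)

lemma shear_neg_one_left {t : I} (ht : (t : ℝ) ≤ 1 / 2) : shear (-1) t = 0 :=
  Set.projIcc_of_le_left _ (by norm_num; linarith)

lemma exists_shear_function {A B : Set (Sph 4 × I)} (hA : IsClosed A) (hB : IsClosed B)
    (hAB : ∀ x t t', (x, t) ∈ A → (x, t') ∉ B)
    (hAe : ∀ x, (x, 1) ∉ A) (hBe : ∀ x, (x, 0) ∉ B) :
    ∃ θ : C(Sph 4, ℝ), (∀ x t, (x, shear (θ x) t) ∈ A → (t : ℝ) < 1 / 2) ∧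
      ∀ x t, (x, shear (θ x) t) ∈ B → 1 / 2 < (t : ℝ) := by
  have hd : Disjoint (Prod.fst '' B) (Prod.fst '' A) := by
    rw [Set.disjoint_left]
    rintro x ⟨⟨_, t⟩, h, rfl⟩ ⟨⟨_, t'⟩, h', h''⟩
    simp only at h''; subst h''
    exact hAB _ _ _ h' h
  obtain ⟨u, hu0, hu1, -⟩ := exists_continuous_zero_one_of_isClosed
    (hB.isCompact.image continuous_fst).isClosed (hA.isCompact.image continuous_fst).isClosed hd
  refine ⟨⟨fun x => 2 * u x - 1, by fun_prop⟩, fun x t h => ?_, fun x t h => ?_⟩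
  · have h1 : u x = 1 := hu1 ⟨_, h, rfl⟩
    have h2 : (2 * u x - 1 : ℝ) = 1 := by rw [h1]; norm_num
    simp only [ContinuousMap.coe_mk, h2] at h
    by_contra! hc
    rw [shear_one_left hc] at h
    exact hAe _ h
  · have h1 : u x = 0 := hu0 ⟨_, h, rfl⟩
    have h2 : (2 * u x - 1 : ℝ) = -1 := by rw [h1]; norm_num
    simp only [ContinuousMap.coe_mk, h2] at h
    by_contra! hc
    rw [shear_neg_one_left hc] at h
    exact hBe _ h

/-- The unreduced suspension of a map of spheres, on the cylinder. -/
noncomputable def suspMap {X : Type*} [TopologicalSpace X] {n : ℕ} (g : C(X, Fin n → ℝ)) :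
    C(X × I, Fin (n + 1) → ℝ) :=
  ⟨fun p => Fin.cons (Real.cos (Real.pi * p.2)) (Real.sin (Real.pi * p.2) • g p.1),
    continuous_finCons (by fun_prop) (by fun_prop)⟩

lemma suspMap_sameEnd {X : Type*} [TopologicalSpace X] {n : ℕ} (g : C(X, Fin n → ℝ)) (p q : X × I)
    (h : sameEnd p q) : suspMap g p = suspMap g q := by
  rcases h with ⟨h1, h2⟩ | ⟨h1, h2⟩ <;> simp [suspMap, h1, h2]

lemma ne_zero_iff_cons {n : ℕ} {w : Fin (n + 1) → ℝ} : w ≠ 0 ↔ (Fin.tail w = 0 → w 0 ≠ 0) := by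
  rw [Ne, not_iff_comm]
  push Not
  constructor
  · rintro ⟨h1, h2⟩
    ext i
    refine Fin.cases h2 (fun j => congrFun h1 j) i
  · rintro rfl
    exact ⟨rfl, rfl⟩

lemma cos_pos_of_lt_half {t : I} (h : (t : ℝ) < 1 / 2) : 0 < Real.cos (Real.pi * t) :=
  Real.cos_pos_of_mem_Ioo ⟨by nlinarith [Real.pi_pos, t.2.1], by nlinarith [Real.pi_pos]⟩

lemma cos_neg_of_half_lt {t : I} (h : 1 / 2 < (t : ℝ)) : Real.cos (Real.pi * t) < 0 :=
  Real.cos_neg_of_pi_div_two_lt_of_lt (by nlinarith [Real.pi_pos])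
    (by nlinarith [Real.pi_pos, t.2.2])

/-- A map of the cylinder into the punctured space whose zeros of the horizontal part are sorted
by height is homotopic to a suspension. -/
lemma homotopicWith_suspMap_of_sorted (Q : C(Sph 4 × I, Fin 4 → ℝ))
    (hQe : ∀ p q, sameEnd p q → Q p = Q q)
    (hA : ∀ p, Fin.tail (Q p) = 0 → (0 < Q p 0 ∧ (p.2 : ℝ) < 1 / 2) ∨
      (Q p 0 < 0 ∧ 1 / 2 < (p.2 : ℝ))) :
    ∃ g : C(Sph 4, Fin 3 → ℝ), (∀ x, g x ⬝ᵥ g x = 1) ∧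
      Q.HomotopicWith (suspMap g) (Adm sameEnd {v | v ≠ 0}) := by
  let h : I := ⟨1 / 2, by norm_num, by norm_num⟩
  have htail : Continuous fun w : Fin 4 → ℝ => (Fin.tail w : Fin 3 → ℝ) :=
    continuous_pi fun i => continuous_apply _
  have hne : ∀ x, Fin.tail (Q (x, h)) ≠ 0 := by
    intro x h0
    rcases hA _ h0 with ⟨_, h1⟩ | ⟨_, h1⟩ <;> exact lt_irrefl _ h1
  let g : C(Sph 4, Fin 3 → ℝ) := ⟨fun x => normVec (Fin.tail (Q (x, h))),
    continuousOn_normVec.comp_continuous (htail.comp (by fun_prop)) hne⟩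
  let Q₁ : C(Sph 4 × I, Fin 4 → ℝ) := ⟨fun p => Fin.cons (Real.cos (Real.pi * p.2)) (Fin.tail (Q p)),
    continuous_finCons (by fun_prop) (htail.comp (by fun_prop))⟩
  have hQ₁e : ∀ p q, sameEnd p q → Q₁ p = Q₁ q := by
    intro p q hpq
    simp only [Q₁, ContinuousMap.coe_mk, hQe p q hpq]
    rcases hpq with ⟨h1, h2⟩ | ⟨h1, h2⟩ <;> rw [h1, h2]
  refine ⟨g, fun x => normVec_dotProduct_self (hne x), ?_⟩
  have h1 : Q.HomotopicWith Q₁ (Adm sameEnd {v | v ≠ 0}) := by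
    refine homotopicWith_line hQe hQ₁e fun p t h0 h1 => ne_zero_iff_cons.2 fun ht => ?_
    have ht' : Fin.tail (Q p) = 0 := by
      rw [← ht]
      ext i
      simp only [Q₁, Fin.tail, ContinuousMap.coe_mk, Pi.add_apply, Pi.smul_apply, Fin.cons_succ,
        smul_eq_mul]
      ring
    simp only [Q₁, ContinuousMap.coe_mk, Pi.add_apply, Pi.smul_apply, Fin.cons_zero, smul_eq_mul]
    rcases hA p ht' with ⟨h2, h3⟩ | ⟨h2, h3⟩
    · have := cos_pos_of_lt_half h3
      rcases eq_or_lt_of_le h0 with rfl | h0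
      · linarith
      · nlinarith [mul_pos h0 this]
    · have := cos_neg_of_half_lt h3
      rcases eq_or_lt_of_le h0 with rfl | h0
      · linarith
      · nlinarith [mul_pos h0 (neg_pos.2 this)]
  refine h1.trans (homotopicWith_line hQ₁e (suspMap_sameEnd g) fun p t h0 h1 => ?_)
  refine ne_zero_iff_cons.2 fun ht => ?_
  have h0' : ((1 - t) • Q₁ p + t • suspMap g p) 0 = Real.cos (Real.pi * p.2) := by
    simp only [Q₁, suspMap, ContinuousMap.coe_mk, Pi.add_apply, Pi.smul_apply, Fin.cons_zero,
      smul_eq_mul]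
    ring
  rw [h0']
  rcases lt_trichotomy (p.2 : ℝ) (1 / 2) with h2 | h2 | h2
  · exact (cos_pos_of_lt_half h2).ne'
  · exfalso
    have hp : p = (p.1, h) := Prod.ext rfl (Subtype.ext h2)
    have ht2 : Fin.tail ((1 - t) • Q₁ p + t • suspMap g p) =
        ((1 - t) + t * (√(Fin.tail (Q p) ⬝ᵥ Fin.tail (Q p)))⁻¹) • Fin.tail (Q p) := by
      have hs : Real.sin (Real.pi * p.2) = 1 := by
        rw [h2, mul_one_div, Real.sin_pi_div_two]
      ext i
      simp only [Q₁, suspMap, ContinuousMap.coe_mk, Pi.add_apply, Pi.smul_apply, Fin.tail,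
        Fin.cons_succ, smul_eq_mul, hs, g, normVec, ← hp]
      ring
    rw [ht2, smul_eq_zero] at ht
    rw [hp] at ht
    rcases ht with ht | ht
    · have h3 : 0 < (√(Fin.tail (Q (p.1, h)) ⬝ᵥ Fin.tail (Q (p.1, h))))⁻¹ :=
        inv_pos.2 (Real.sqrt_pos.2 (dotProduct_self_pos_iff.2 (hne p.1)))
      rcases eq_or_lt_of_le h0 with rfl | h0
      · linarith
      · nlinarith [mul_pos h0 h3]
    · exact hne _ ht
  · exact (cos_neg_of_half_lt h2).ne

/-- Every map `S⁴ → S³` is homotopic to a suspension. -/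
theorem exists_homotopicWith_suspMap (F : C(Sph 5, Fin 4 → ℝ)) (hF : ∀ x, F x ⬝ᵥ F x = 1) :
    ∃ g : C(Sph 4, Fin 3 → ℝ), (∀ x, g x ⬝ᵥ g x = 1) ∧
      (F.comp ⟨fun p : Sph 4 × I => susp p.1 p.2, continuous_susp⟩).HomotopicWith (suspMap g)
        (Adm sameEnd {v | v ≠ 0}) := by
  have hε : (0 : ℝ) < 1 / ((4 : ℕ) + 1) := by positivity
  obtain ⟨P, hP, hPF, -⟩ := exists_smooth_approx F hε
  have hP0 : ∀ x : Sph 5, P x.1 ≠ 0 := fun x h => by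
    have := hPF x
    rw [h, zero_sub, norm_neg] at this
    exact absurd (one_div_le_norm (hF x)) (not_le.2 this)
  obtain ⟨α, β, hα, hβ, hαβ, hpole⟩ := exists_avoiding_directions hP
  let P₁ : C(Sph 4 × I, Fin 4 → ℝ) := ⟨fun p => P (susp p.1 p.2).1,
    hP.continuous.comp (continuous_subtype_val.comp continuous_susp)⟩
  have hP₁e : ∀ p q, sameEnd p q → P₁ p = P₁ q := fun p q h => by
    simp only [P₁, ContinuousMap.coe_mk, susp_eq_of_sameEnd h]
  have h1 : (F.comp ⟨fun p : Sph 4 × I => susp p.1 p.2, continuous_susp⟩).HomotopicWith P₁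
      (Adm sameEnd {v | v ≠ 0}) := by
    refine homotopicWith_line (fun p q h => ?_) hP₁e fun p t h0 h1 =>
      ne_zero_of_norm_sub_lt (hPF _) (one_div_le_norm (hF _)) t h0 h1
    simp only [ContinuousMap.comp_apply, ContinuousMap.coe_mk, susp_eq_of_sameEnd h]
  let e : Fin 4 → ℝ := Pi.single 0 1
  let ω : (Fin 4 → ℝ) → Fin 4 → ℝ := fun w =>
    w - max (w 0) 0 • ((α 0)⁻¹ • α - e) - max (- w 0) 0 • ((- β 0)⁻¹ • β + e)
  have hω : Continuous ω := by fun_prop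
  have hω0 : ∀ w, ω w 0 = w 0 := by
    intro w
    have h1 : (α 0)⁻¹ * α 0 = 1 := inv_mul_cancel₀ hα.ne'
    have h2 : (- β 0)⁻¹ * β 0 = -1 := by field_simp [hβ.ne]
    simp only [ω, e, Pi.sub_apply, Pi.add_apply, Pi.smul_apply, smul_eq_mul, Pi.single_eq_same, h1, h2]
    ring
  have hωα : ∀ w, Fin.tail (ω w) = 0 → 0 < w 0 → (α 0 * (w 0)⁻¹) • w = α := by
    intro w hw h0
    have h1 : w = (w 0 * (α 0)⁻¹) • α := by
      ext i
      refine Fin.cases ?_ (fun j => ?_) i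
      · simp [hα.ne']
      · have := congrFun hw j
        simp only [Fin.tail, ω, max_eq_left h0.le, max_eq_right (neg_nonpos.2 h0.le),
          sub_zero, Pi.sub_apply, Pi.smul_apply, smul_eq_mul, e, Pi.single_eq_of_ne (Fin.succ_ne_zero j),
          Pi.zero_apply] at this
        simp only [Pi.smul_apply, smul_eq_mul]
        linarith
    conv_lhs => rw [h1]
    rw [smul_smul]
    have : α 0 * (w 0)⁻¹ * (w 0 * (α 0)⁻¹) = 1 := by field_simp
    simp only [Pi.smul_apply, smul_eq_mul, inv_mul_cancel₀ hα.ne', mul_assoc, mul_one]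
    rw [← mul_assoc, ← mul_assoc, mul_assoc (α 0 * _), this, one_smul]
  have hωβ : ∀ w, Fin.tail (ω w) = 0 → w 0 < 0 → (β 0 * (w 0)⁻¹) • w = β := by
    intro w hw h0
    have h1 : w = (w 0 * (β 0)⁻¹) • β := by
      ext i
      refine Fin.cases ?_ (fun j => ?_) i
      · simp [hβ.ne]
      · have := congrFun hw j
        simp only [Fin.tail, ω, max_eq_right h0.le, max_eq_left (neg_nonneg.2 h0.le), zero_smul,
          sub_zero, Pi.sub_apply, Pi.smul_apply, smul_eq_mul, e, Pi.single_eq_of_ne (Fin.succ_ne_zero j),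
          Pi.zero_apply, Pi.add_apply, inv_neg] at this
        simp only [Pi.smul_apply, smul_eq_mul]
        linarith
    conv_lhs => rw [h1]
    rw [smul_smul]
    have : β 0 * (w 0)⁻¹ * (w 0 * (β 0)⁻¹) = 1 := by field_simp [h0.ne, hβ.ne]
    simp only [Pi.smul_apply, smul_eq_mul, inv_mul_cancel₀ hβ.ne, mul_assoc, mul_one]
    rw [← mul_assoc, ← mul_assoc, mul_assoc (β 0 * _), this, one_smul]
  have hω1 : ∀ w : Fin 4 → ℝ, w 0 = 0 → ω w = w := by
    intro w hw; simp [ω, hw]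
  let P₂ : C(Sph 4 × I, Fin 4 → ℝ) := ⟨fun p => ω (P₁ p), hω.comp P₁.continuous⟩
  have hP₂e : ∀ p q, sameEnd p q → P₂ p = P₂ q := fun p q h => by
    simp only [P₂, ContinuousMap.coe_mk, hP₁e p q h]
  have h2 : P₁.HomotopicWith P₂ (Adm sameEnd {v | v ≠ 0}) := by
    refine homotopicWith_line hP₁e hP₂e fun p t h0 h1 h => ?_
    have h3 : P₁ p 0 = 0 := by
      have := congrFun h 0
      simp only [P₂, ContinuousMap.coe_mk, Pi.add_apply, Pi.smul_apply, smul_eq_mul, hω0,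
        Pi.zero_apply] at this
      linarith
    have h4 : P₂ p = P₁ p := hω1 _ h3
    rw [h4, ← add_smul, sub_add_cancel, one_smul] at h
    exact hP0 _ h
  have hP₂ne : ∀ p, P₂ p ≠ 0 := by
    intro p h
    have h3 : P₁ p 0 = 0 := (hω0 (P₁ p)).symm.trans (congrFun h 0)
    rw [show P₂ p = P₁ p from hω1 _ h3] at h
    exact hP0 _ h
  let A : Set (Sph 4 × I) := {p | Fin.tail (P₂ p) = 0 ∧ 0 ≤ P₂ p 0}
  let B : Set (Sph 4 × I) := {p | Fin.tail (P₂ p) = 0 ∧ P₂ p 0 ≤ 0}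
  have htail : Continuous fun p => (Fin.tail (P₂ p) : Fin 3 → ℝ) :=
    continuous_pi fun i => (continuous_apply (Fin.succ i)).comp P₂.continuous
  have hc0 : Continuous fun p => P₂ p 0 := (continuous_apply 0).comp P₂.continuous
  have hA : ∀ p ∈ A, ∃ r : ℝ, r • P (susp p.1 p.2).1 = α := by
    intro p hp
    refine ⟨_, hωα _ hp.1 ?_⟩
    have h5 := ne_zero_iff_cons.1 (hP₂ne p) hp.1
    have h6 := lt_of_le_of_ne hp.2 h5.symm
    rwa [show P₂ p 0 = _ from hω0 _] at h6
  have hB : ∀ p ∈ B, ∃ r : ℝ, r • P (susp p.1 p.2).1 = β := by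
    intro p hp
    refine ⟨_, hωβ _ hp.1 ?_⟩
    have h5 := ne_zero_iff_cons.1 (hP₂ne p) hp.1
    have h6 := lt_of_le_of_ne hp.2 h5
    rwa [show P₂ p 0 = _ from hω0 _] at h6
  obtain ⟨θ, hθA, hθB⟩ := exists_shear_function (A := A) (B := B)
    ((isClosed_eq htail continuous_const).inter (isClosed_le continuous_const hc0))
    ((isClosed_eq htail continuous_const).inter (isClosed_le hc0 continuous_const))
    (fun x t t' h h' => by
      obtain ⟨r, hr⟩ := hA _ h
      obtain ⟨r', hr'⟩ := hB _ h'
      exact hαβ x t t' r r' hr hr')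
    (fun x h => by
      obtain ⟨r, hr⟩ := hA _ h
      exact (hpole x 1 r (Or.inr rfl)).1 hr)
    (fun x h => by
      obtain ⟨r, hr⟩ := hB _ h
      exact (hpole x 0 r (Or.inl rfl)).2 hr)
  have hθc : Continuous fun p : Sph 4 × I => (θ p.1, p.2) := by fun_prop
  let P₃ : C(Sph 4 × I, Fin 4 → ℝ) := ⟨fun p => P₂ (p.1, shear (θ p.1) p.2),
    P₂.continuous.comp (continuous_fst.prodMk (continuous_shear.comp hθc))⟩
  have hshe : ∀ (p q : Sph 4 × I) (a b : ℝ), sameEnd p q →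
      sameEnd (p.1, shear a p.2) (q.1, shear b q.2) := by
    rintro p q a b (⟨h1, h2⟩ | ⟨h1, h2⟩)
    · left; simp [h1, h2, shear_zero]
    · right; simp [h1, h2, shear_one]
  have h3 : P₂.HomotopicWith P₃ (Adm sameEnd {v | v ≠ 0}) := by
    refine homotopicWith_adm_of_fun (fun p s => P₂ (p.1, shear (s * θ p.1) p.2)) ?_ (fun p => ?_)
      (fun p => ?_) (fun p s => hP₂ne _) (fun p q s h => hP₂e _ _ (hshe _ _ _ _ h))
    · have h4 : Continuous fun q : (Sph 4 × I) × I => ((q.2 : ℝ) * θ q.1.1, q.1.2) := by fun_prop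
      exact P₂.continuous.comp (continuous_fst.fst.prodMk (continuous_shear.comp h4))
    · simp [shear_zero_left]
    · simp [P₃]
  obtain ⟨g, hg, hgh⟩ := homotopicWith_suspMap_of_sorted P₃ (fun p q h => hP₂e _ _ (hshe _ _ _ _ h))
    (fun p hp => by
      have h5 := ne_zero_iff_cons.1 (hP₂ne (p.1, shear (θ p.1) p.2)) hp
      rcases lt_or_gt_of_ne h5 with h6 | h6
      · exact Or.inr ⟨h6, hθB p.1 p.2 ⟨hp, h6.le⟩⟩
      · exact Or.inl ⟨h6, hθA p.1 p.2 ⟨hp, h6.le⟩⟩)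
  exact ⟨g, hg, ((h1.trans h2).trans h3).trans hgh⟩

/-- The quaternion with the given components. -/
noncomputable def mkQuat (a b c d : ℝ) : Quaternion ℝ := ⟨a, b, c, d⟩

@[simp] lemma mkQuat_re (a b c d : ℝ) : (mkQuat a b c d).re = a := rfl
@[simp] lemma mkQuat_imI (a b c d : ℝ) : (mkQuat a b c d).imI = b := rfl
@[simp] lemma mkQuat_imJ (a b c d : ℝ) : (mkQuat a b c d).imJ = c := rfl
@[simp] lemma mkQuat_imK (a b c d : ℝ) : (mkQuat a b c d).imK = d := rfl

/-- Vectors of `ℝ³` as purely imaginary quaternions. -/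
noncomputable def imQuat : (Fin 3 → ℝ) →ₗ[ℝ] Quaternion ℝ where
  toFun v := mkQuat 0 (v 0) (v 1) (v 2)
  map_add' v w := by ext <;> simp
  map_smul' r v := by ext <;> simp

lemma imQuat_apply (v : Fin 3 → ℝ) : imQuat v = mkQuat 0 (v 0) (v 1) (v 2) := rfl

/-- Vectors of `ℝ⁴` as quaternions. -/
noncomputable def vecQuat : (Fin 4 → ℝ) →ₗ[ℝ] Quaternion ℝ where
  toFun v := mkQuat (v 0) (v 1) (v 2) (v 3)
  map_add' v w := by ext <;> simp
  map_smul' r v := by ext <;> simp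

lemma vecQuat_apply (v : Fin 4 → ℝ) : vecQuat v = mkQuat (v 0) (v 1) (v 2) (v 3) := rfl

/-- The vector of components of a quaternion. -/
noncomputable def quatVec (q : Quaternion ℝ) : Fin 4 → ℝ := ![q.re, q.imI, q.imJ, q.imK]

lemma vecQuat_quatVec (q : Quaternion ℝ) : vecQuat (quatVec q) = q := by
  ext <;> simp [vecQuat_apply, quatVec]

lemma continuous_vecQuat : Continuous vecQuat := LinearMap.continuous_of_finiteDimensional _

lemma continuous_quatVec : Continuous quatVec := by
  unfold quatVec
  refine continuous_pi fun i => ?_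
  fin_cases i
  · exact Quaternion.continuous_re
  · exact Quaternion.continuous_imI
  · exact Quaternion.continuous_imJ
  · exact Quaternion.continuous_imK

lemma normSq_vecQuat (v : Fin 4 → ℝ) : Quaternion.normSq (vecQuat v) = v ⬝ᵥ v := by
  simp [Quaternion.normSq_def', vecQuat_apply, dotProduct, Fin.sum_univ_four, sq]

lemma quatVec_dotProduct_self (q : Quaternion ℝ) :
    quatVec q ⬝ᵥ quatVec q = Quaternion.normSq q := by
  rw [← normSq_vecQuat, vecQuat_quatVec]

lemma vecQuat_ne_zero {v : Fin 4 → ℝ} (hv : v ≠ 0) : vecQuat v ≠ 0 := by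
  rw [← Quaternion.normSq_ne_zero, normSq_vecQuat]
  exact fun h => hv (dotProduct_self_eq_zero.1 h)

lemma normSq_imQuat (v : Fin 3 → ℝ) : Quaternion.normSq (imQuat v) = v ⬝ᵥ v := by
  simp [Quaternion.normSq_def', imQuat_apply, dotProduct, Fin.sum_univ_three, sq]

lemma imQuat_injective : Function.Injective imQuat := fun v w h => by
  have h1 : imQuat (v - w) = 0 := by rw [map_sub, h, sub_self]
  have h2 := normSq_imQuat (v - w)
  rw [h1, map_zero] at h2
  exact sub_eq_zero.1 (dotProduct_self_eq_zero.1 h2.symm)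

lemma imQuat_mul_self (v : Fin 3 → ℝ) :
    imQuat v * imQuat v = ((-1 : ℝ) * (v ⬝ᵥ v)) • (1 : Quaternion ℝ) := by
  rw [show (1 : Quaternion ℝ) = mkQuat 1 0 0 0 from rfl]
  ext <;> simp [imQuat_apply, dotProduct, Fin.sum_univ_three] <;> ring

/-- The rotation of `ℝ³` given by conjugation with a nonzero quaternion. -/
noncomputable def adMat (q : Quaternion ℝ) : Matrix (Fin 3) (Fin 3) ℝ :=
  (Quaternion.normSq q)⁻¹ •
  !![q.re ^ 2 + q.imI ^ 2 - q.imJ ^ 2 - q.imK ^ 2, 2 * (q.imI * q.imJ - q.re * q.imK),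
      2 * (q.imI * q.imK + q.re * q.imJ);
    2 * (q.imI * q.imJ + q.re * q.imK), q.re ^ 2 - q.imI ^ 2 + q.imJ ^ 2 - q.imK ^ 2,
      2 * (q.imJ * q.imK - q.re * q.imI);
    2 * (q.imI * q.imK - q.re * q.imJ), 2 * (q.imJ * q.imK + q.re * q.imI),
      q.re ^ 2 - q.imI ^ 2 - q.imJ ^ 2 + q.imK ^ 2]

lemma imQuat_adMat_mul {q : Quaternion ℝ} (hq : q ≠ 0) (v : Fin 3 → ℝ) :
    imQuat (adMat q *ᵥ v) * q = q * imQuat v := by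
  have h : Quaternion.normSq q ≠ 0 := Quaternion.normSq_ne_zero.2 hq
  rw [adMat, smul_mulVec, map_smul, smul_mul_assoc, inv_smul_eq_iff₀ h, Quaternion.normSq_def']
  ext <;> simp [imQuat_apply, dotProduct, Fin.sum_univ_three] <;> ring

lemma adMat_mulVec_eq {q : Quaternion ℝ} (hq : q ≠ 0) {v w : Fin 3 → ℝ}
    (h : q * imQuat v = imQuat w * q) : adMat q *ᵥ v = w := by
  have h1 := imQuat_adMat_mul hq v
  rw [h] at h1
  exact imQuat_injective (mul_right_cancel₀ hq h1)

lemma adMat_eq {q : Quaternion ℝ} (hq : q ≠ 0) {A : Matrix (Fin 3) (Fin 3) ℝ}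
    (h : ∀ v, q * imQuat v = imQuat (A *ᵥ v) * q) : adMat q = A :=
  Matrix.mulVec_injective (funext fun v => adMat_mulVec_eq hq (h v))

lemma adMat_mul {p q : Quaternion ℝ} (hp : p ≠ 0) (hq : q ≠ 0) :
    adMat (p * q) = adMat p * adMat q :=
  adMat_eq (mul_ne_zero hp hq) fun v => by
    rw [mul_assoc, ← imQuat_adMat_mul hq, ← mul_assoc, ← imQuat_adMat_mul hp, mul_assoc,
      mulVec_mulVec]

lemma adMat_mem_SOSet {q : Quaternion ℝ} (hq : q ≠ 0) : adMat q ∈ SOSet 3 := by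
  have h : Quaternion.normSq q ≠ 0 := Quaternion.normSq_ne_zero.2 hq
  rw [Quaternion.normSq_def'] at h
  constructor
  · rw [adMat, transpose_smul, smul_mul_smul_comm, Quaternion.normSq_def']
    ext i j
    rw [Matrix.smul_apply, mul_apply, Fin.sum_univ_three]
    fin_cases i <;> fin_cases j <;> simp <;> field_simp <;>
      first | ring1 | (right; ring1)
  · rw [adMat, det_smul, det_fin_three, Quaternion.normSq_def']
    simp
    field_simp
    ring

lemma continuousOn_adMat : ContinuousOn adMat {q | q ≠ 0} := by
  unfold adMat
  refine ContinuousOn.smul (Quaternion.continuous_normSq.continuousOn.inv₀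
    fun q hq => Quaternion.normSq_ne_zero.2 hq) (Continuous.continuousOn ?_)
  have h0 := Quaternion.continuous_re
  have h1 := Quaternion.continuous_imI
  have h2 := Quaternion.continuous_imJ
  have h3 := Quaternion.continuous_imK
  refine continuous_matrix fun i j => ?_
  fin_cases i <;> fin_cases j <;> simp <;> fun_prop

lemma adMat_coe {r : ℝ} (hr : r ≠ 0) : adMat (r : Quaternion ℝ) = 1 :=
  adMat_eq (fun h => hr (Quaternion.coe_injective (h.trans Quaternion.coe_zero.symm))) fun v => by
    rw [one_mulVec, Quaternion.coe_commutes]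

lemma imag_eq_zero_of_commute {q : Quaternion ℝ} (h : ∀ v, q * imQuat v = imQuat v * q) :
    q = (q.re : Quaternion ℝ) := by
  have h1 := h ![1, 0, 0]
  have h2 := h ![0, 1, 0]
  have h3 := congrArg (·.imK) h1
  have h4 := congrArg (·.imJ) h1
  have h5 := congrArg (·.imK) h2
  simp [imQuat_apply] at h3 h4 h5
  ext <;> simp <;> linarith

lemma constant_of_integer_valued {X : Type*} [TopologicalSpace X] [PreconnectedSpace X]
    {f : X → ℝ} (hf : Continuous f) (h : ∀ x, ∃ n : ℤ, f x = n) (x y : X) : f x = f y := by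
  choose n hn using h
  have h1 : Continuous n := by
    rw [Int.isClosedEmbedding_coe_real.isInducing.continuous_iff]
    exact hf.congr hn
  rw [hn, hn, PreconnectedSpace.constant ‹_› h1]

lemma star_mul_self_of_normSq {q : Quaternion ℝ} (h : Quaternion.normSq q = 1) :
    star q * q = 1 := by rw [Quaternion.star_mul_self, h]; rfl

lemma mul_star_self_of_normSq {q : Quaternion ℝ} (h : Quaternion.normSq q = 1) :
    q * star q = 1 := by rw [Quaternion.self_mul_star, h]; rfl

lemma ne_zero_of_normSq {q : Quaternion ℝ} (h : Quaternion.normSq q = 1) : q ≠ 0 := by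
  rintro rfl; simp at h

/-- Unit quaternions. -/
noncomputable def unitQuat : Submonoid (Quaternion ℝ) where
  carrier := {q | Quaternion.normSq q = 1}
  one_mem' := map_one _
  mul_mem' {a b} ha hb := by
    rw [Set.mem_ofPred_eq] at *; rw [map_mul, ha, hb, one_mul]

lemma mem_unitQuat {q : Quaternion ℝ} : q ∈ unitQuat ↔ Quaternion.normSq q = 1 := Iff.rfl

lemma imQuat_mul_mem_unitQuat (u v : Fin 3 → ℝ) (hu : u ⬝ᵥ u = 1) (hv : v ⬝ᵥ v = 1) :
    (-1 : ℝ) • (imQuat u * imQuat v) ∈ unitQuat := by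
  rw [mem_unitQuat, Quaternion.normSq_smul, map_mul, normSq_imQuat, normSq_imQuat, hu, hv]
  norm_num

/-- The north pole. -/
noncomputable def north (n : ℕ) : Sph (n + 1) := ⟨Fin.cons 1 0, by
  rw [cons_dotProduct_cons]; simp⟩

lemma susp_zero {n : ℕ} (v : Sph n) : susp v 0 = north n := by
  apply Subtype.ext; simp [susp, north]

lemma susp_one {n : ℕ} (v w : Sph n) : susp v 1 = susp w 1 := by
  apply Subtype.ext; simp [susp]

/-- Maps from the four-sphere into the rotation group lift to the unit quaternions. -/
theorem exists_quaternion_lift (f : Sph 5 → Matrix (Fin 3) (Fin 3) ℝ) (hf : Continuous f)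
    (hSO : ∀ x, f x ∈ SOSet 3) :
    ∃ (F : Sph 5 → Quaternion ℝ) (A : Matrix (Fin 3) (Fin 3) ℝ), Continuous F ∧ A ∈ SOSet 3 ∧
      (∀ x, Quaternion.normSq (F x) = 1) ∧ ∀ x, f x = adMat (F x) * A := by
  obtain ⟨s, hs, hs0, hsγ, hS⟩ := exists_spin_lift (γ := imQuat) (ε := -1) (by norm_num)
    imQuat_mul_self (fun x t => f (susp x t)) (hf.comp continuous_susp) fun x t => hSO _
  have hU : ∀ x t, Quaternion.normSq (s x t) = 1 := fun x t =>
    hS unitQuat imQuat_mul_mem_unitQuat x t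
  have had : ∀ x t, f (susp x t) = adMat (s x t) * f (north 4) := by
    intro x t
    rw [adMat_eq (ne_zero_of_normSq (hU x t)) (hsγ x t), susp_zero, Matrix.mul_assoc,
      transpose_mul_of_mem_SOSet (hSO _), Matrix.mul_one]
  have h1 : ∀ x y, s x 1 = s y 1 := by
    intro x y
    have hreal : ∀ z, star (s y 1) * s z 1
        = ((star (s y 1) * s z 1).re : Quaternion ℝ) := by
      intro z
      refine imag_eq_zero_of_commute fun v => ?_
      have e : ∀ z, f (susp z 1) = f (susp y 1) := fun z => by rw [susp_one z y]
      have h2 := hsγ z 1 v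
      have h3 := hsγ y 1 v
      rw [susp_zero, e z] at h2
      rw [susp_zero] at h3
      apply mul_left_cancel₀ (ne_zero_of_normSq (hU y 1))
      rw [← mul_assoc, ← mul_assoc, mul_star_self_of_normSq (hU y 1), one_mul, h2, ← mul_assoc,
        h3, mul_assoc _ (s y 1), ← mul_assoc (s y 1), mul_star_self_of_normSq (hU y 1), one_mul]
    have hc : Continuous fun z => (star (s y 1) * s z 1).re := by
      have : Continuous fun z => s z 1 := hs.comp (Continuous.prodMk_left 1)
      exact Quaternion.continuous_re.comp (continuous_const.mul this)
    have h4 := constant_of_integer_valued hc (fun z => by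
      have h5 : Quaternion.normSq (star (s y 1) * s z 1) = 1 := by
        rw [map_mul, Quaternion.normSq_star, hU, hU, one_mul]
      rw [hreal z, Quaternion.normSq_coe] at h5
      rw [sq] at h5
      rcases mul_self_eq_one_iff.1 h5 with h6 | h6
      · exact ⟨1, by simpa using h6⟩
      · exact ⟨-1, by simpa using h6⟩) x y
    have h6 := hreal x
    rw [h4, ← hreal y] at h6
    exact mul_left_cancel₀ (by simpa using ne_zero_of_normSq (hU y 1)) h6
  obtain ⟨Ψ, hΨ, hΨs⟩ := exists_descent (Z := Unit) inferInstance (fun x t _ => s x t)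
    (hs.comp (continuous_fst.prodMk continuous_snd.fst)) (by simp [hs0])
    (fun x y => by rw [h1 x y])
  refine ⟨fun w => Ψ w (), f (north 4), hΨ.comp (Continuous.prodMk_left ()), hSO _, ?_, ?_⟩
  · intro w
    obtain ⟨v, t, rfl⟩ := susp_surjective inferInstance w
    simp only [hΨs, hU]
  · intro w
    obtain ⟨v, t, rfl⟩ := susp_surjective inferInstance w
    simp only [hΨs]; exact had v t

/-- A continuous map from the two-sphere to the circle has a continuous logarithm. -/
theorem exists_continuous_log (c : Sph 3 → ℂ) (hc : Continuous c) (h1 : ∀ v, ‖c v‖ = 1) :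
    ∃ φ : Sph 3 → ℝ, Continuous φ ∧
      ∀ v, c v = Complex.exp (φ v * Complex.I) * c (north 2) := by
  have hinv : ∀ z : Metric.sphere (0 : ℂ) 1, (z : ℂ) ≠ 0 := fun z h => by
    have := z.2; rw [h] at this; simp at this
  let H : Sph 2 → I → Metric.sphere (0 : ℂ) 1 := fun x t => ⟨c (susp x t), by simp [h1]⟩
  have hH : Continuous fun p : Sph 2 × I => H p.1 p.2 :=
    Continuous.subtype_mk (hc.comp continuous_susp) _
  obtain ⟨L, hL, hL0, hLrel, -, -⟩ := exists_homotopy_lift (G := Multiplicative ℝ)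
    (M := Metric.sphere (0 : ℂ) 1) (δ := 1)
    (fun z w => Multiplicative.ofAdd (Complex.arg (w.1 / z.1))) one_pos
    (by
      refine continuous_ofAdd.comp_continuousOn (ContinuousOn.congr (f := fun p => _) ?_
        fun _ _ => rfl)
      intro p hp
      refine ContinuousAt.continuousWithinAt (ContinuousAt.comp' (Complex.continuousAt_arg ?_) ?_)
      · left
        have h2 : ‖p.2.1 / p.1.1 - 1‖ < 1 := by
          have h3 : p.2.1 / p.1.1 - 1 = (p.2.1 - p.1.1) / p.1.1 := by
            rw [sub_div, div_self (hinv _)]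
          have h4 : ‖p.1.1‖ = 1 := by simp
          rw [h3, norm_div, h4, div_one, ← dist_eq_norm, dist_comm]
          exact hp
        have h5 := (Complex.abs_re_le_norm (p.2.1 / p.1.1 - 1)).trans_lt h2
        rw [abs_lt, Complex.sub_re, Complex.one_re] at h5
        linarith
      · exact ContinuousAt.div (continuous_subtype_val.comp continuous_snd).continuousAt
          (continuous_subtype_val.comp continuous_fst).continuousAt (hinv _))
    (fun z => by rw [div_self (hinv z), Complex.arg_one]; rfl)
    (fun g z w => w.1 = Complex.exp ((Multiplicative.toAdd g : ℝ) * Complex.I) * z.1)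
    (fun z w _ => by
      have h2 : ‖w.1 / z.1‖ = 1 := by
        have h3 : ‖w.1‖ = 1 := by simp
        have h4 : ‖z.1‖ = 1 := by simp
        rw [norm_div, h3, h4, div_one]
      have h3 := Complex.norm_mul_exp_arg_mul_I (w.1 / z.1)
      rw [h2, Complex.ofReal_one, one_mul] at h3
      rw [toAdd_ofAdd, h3, div_mul_cancel₀ _ (hinv z)])
    (fun g g' z w y h h' => by
      rw [h', h, toAdd_mul, Complex.ofReal_add, add_mul, Complex.exp_add, mul_assoc])
    H hH
  let φ : Sph 2 → I → ℝ := fun x t => Multiplicative.toAdd (L x t)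
  have hφ : Continuous fun p : Sph 2 × I => φ p.1 p.2 := continuous_toAdd.comp hL
  have hφc : ∀ x t, c (susp x t) = Complex.exp (φ x t * Complex.I) * c (north 2) := by
    intro x t
    rw [← susp_zero x]
    exact hLrel x t
  have hne : c (north 2) ≠ 0 := fun h => by have := h1 (north 2); rw [h] at this; simp at this
  have hend : ∀ x y, φ x 1 = φ y 1 := by
    intro x y
    have h2 : ∀ z, ∃ n : ℤ, (φ z 1 - φ y 1) / (2 * Real.pi) = n := by
      intro z
      have h3 := hφc z 1
      rw [susp_one z y, hφc y 1] at h3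
      obtain ⟨n, hn⟩ := Complex.exp_eq_exp_iff_exists_int.1 (mul_right_cancel₀ hne h3.symm)
      refine ⟨n, ?_⟩
      have h4 : (φ z 1 : ℂ) = φ y 1 + n * (2 * Real.pi) :=
        mul_right_cancel₀ Complex.I_ne_zero (by rw [hn]; ring)
      have h5 : φ z 1 = φ y 1 + n * (2 * Real.pi) := by exact_mod_cast h4
      rw [h5, add_sub_cancel_left, mul_div_cancel_right₀ _ (by positivity)]
    have hc' : Continuous fun z => (φ z 1 - φ y 1) / (2 * Real.pi) := by
      have : Continuous fun z => φ z 1 := hφ.comp (Continuous.prodMk_left 1)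
      fun_prop
    have h6 := constant_of_integer_valued hc' h2 x y
    have h7 : (2 * Real.pi) ≠ 0 := by positivity
    rw [div_left_inj' h7] at h6
    linarith
  obtain ⟨Ψ, hΨ, hΨs⟩ := exists_descent (Z := Unit) inferInstance (fun x t _ => φ x t)
    (hφ.comp (continuous_fst.prodMk continuous_snd.fst)) (by simp [φ, hL0])
    (fun x y => by rw [hend x y])
  refine ⟨fun w => Ψ w (), hΨ.comp (Continuous.prodMk_left ()), fun w => ?_⟩
  obtain ⟨v, t, rfl⟩ := susp_surjective inferInstance w
  simp only [hΨs]
  exact hφc v t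

/-- The unit quaternion at angle `a` in the direction of the unit vector `u`. -/
noncomputable def expQuat (u : Fin 3 → ℝ) (a : ℝ) : Quaternion ℝ :=
  (Real.cos a : Quaternion ℝ) + Real.sin a • imQuat u

lemma continuous_expQuat (u : Fin 3 → ℝ) : Continuous (expQuat u) := by
  unfold expQuat
  have : Continuous fun a : ℝ => ((Real.cos a : ℝ) : Quaternion ℝ) :=
    Quaternion.continuous_coe.comp Real.continuous_cos
  fun_prop

lemma expQuat_add {u : Fin 3 → ℝ} (hu : u ⬝ᵥ u = 1) (a b : ℝ) :
    expQuat u (a + b) = expQuat u a * expQuat u b := by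
  have h := imQuat_mul_self u
  rw [hu, mul_one, neg_smul, one_smul] at h
  have h2 : ∀ r : ℝ, (r : Quaternion ℝ) = r • 1 := fun r => by
    rw [← Quaternion.coe_mul_eq_smul, mul_one]
  simp only [expQuat, mul_add, add_mul, smul_mul_smul_comm, h, Real.cos_add, Real.sin_add, h2,
    mul_one, one_mul]
  module

lemma expQuat_zero (u : Fin 3 → ℝ) : expQuat u 0 = 1 := by simp [expQuat]

lemma expQuat_pi (u : Fin 3 → ℝ) : expQuat u Real.pi = -1 := by simp [expQuat]

lemma normSq_expQuat {u : Fin 3 → ℝ} (hu : u ⬝ᵥ u = 1) (a : ℝ) :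
    Quaternion.normSq (expQuat u a) = 1 := by
  simp only [dotProduct, Fin.sum_univ_three] at hu
  simp [expQuat, Quaternion.normSq_def', imQuat_apply]
  linear_combination (Real.sin a ^ 2) * hu + Real.sin_sq_add_cos_sq a

lemma expQuat_mul_imQuat (u : Fin 3 → ℝ) (a : ℝ) :
    expQuat u a * imQuat u = imQuat u * expQuat u a := by
  rw [expQuat, add_mul, mul_add, Quaternion.coe_commutes, smul_mul_assoc, mul_smul_comm]

lemma eq_add_smul_of_commute {u : Fin 3 → ℝ} (hu : u ⬝ᵥ u = 1) {q : Quaternion ℝ}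
    (h : q * imQuat u = imQuat u * q) :
    q = (q.re : Quaternion ℝ) + (u 0 * q.imI + u 1 * q.imJ + u 2 * q.imK) • imQuat u := by
  simp only [dotProduct, Fin.sum_univ_three] at hu
  have h1 := congrArg (·.imI) h
  have h2 := congrArg (·.imJ) h
  have h3 := congrArg (·.imK) h
  simp [imQuat_apply] at h1 h2 h3
  ext <;> simp [imQuat_apply]
  · linear_combination -q.imI * hu + (1 / 2) * u 1 * h3 - (1 / 2) * u 2 * h2
  · linear_combination -q.imJ * hu + (1 / 2) * u 2 * h1 - (1 / 2) * u 0 * h3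
  · linear_combination -q.imK * hu + (1 / 2) * u 0 * h2 - (1 / 2) * u 1 * h1

/-- Maps from the three-sphere to the two-sphere factor through the Hopf map. -/
theorem exists_hopf_lift (g : Sph 4 → Fin 3 → ℝ) (hg : Continuous g)
    (hg1 : ∀ x, g x ⬝ᵥ g x = 1) :
    ∃ h : Sph 4 → Quaternion ℝ, Continuous h ∧ (∀ x, Quaternion.normSq (h x) = 1) ∧
      ∀ x, h x * imQuat (g (north 3)) = imQuat (g x) * h x := by
  obtain ⟨R, s, -, hs, -, hs0, -, hR, -, hsγ, hS, -⟩ := exists_rotation_lift (γ := imQuat) (ε := -1)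
    (by norm_num) imQuat_mul_self (fun (x : Sph 3) t => g (susp x t)) (hg.comp continuous_susp)
    fun x t => hg1 _
  set u := g (north 3) with hu
  have hu1 : u ⬝ᵥ u = 1 := hg1 _
  have hU : ∀ x t, Quaternion.normSq (s x t) = 1 := fun x t =>
    hS unitQuat imQuat_mul_mem_unitQuat x t
  have hsg : ∀ x t, s x t * imQuat u = imQuat (g (susp x t)) * s x t := by
    intro x t
    rw [hsγ, hu, ← susp_zero x, hR]
  obtain ⟨y⟩ : Nonempty (Sph 3) := inferInstance
  let k : Sph 3 → Quaternion ℝ := fun x => star (s y 1) * s x 1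
  have hk1 : ∀ x, Quaternion.normSq (k x) = 1 := fun x => by
    simp only [k]; rw [map_mul, Quaternion.normSq_star, hU, hU, one_mul]
  have hsk : ∀ x, s x 1 = s y 1 * k x := fun x => by
    simp only [k]; rw [← mul_assoc, mul_star_self_of_normSq (hU y 1), one_mul]
  have hkc : ∀ x, k x * imQuat u = imQuat u * k x := by
    intro x
    have h2 := hsg x 1
    rw [susp_one x y, hsk, ← mul_assoc (imQuat _), ← hsg y 1, mul_assoc, mul_assoc (s y 1)] at h2
    exact mul_left_cancel₀ (ne_zero_of_normSq (hU y 1)) h2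
  have hkcont : Continuous k :=
    continuous_const.mul (hs.comp (Continuous.prodMk_left 1))
  let c : Sph 3 → ℂ := fun x => ⟨(k x).re, u 0 * (k x).imI + u 1 * (k x).imJ + u 2 * (k x).imK⟩
  have hkeq : ∀ x, k x = ((c x).re : Quaternion ℝ) + (c x).im • imQuat u := fun x =>
    eq_add_smul_of_commute hu1 (hkc x)
  have hcc : Continuous c := by
    have h1 := Quaternion.continuous_re.comp hkcont
    have h2 := Quaternion.continuous_imI.comp hkcont
    have h3 := Quaternion.continuous_imJ.comp hkcont
    have h4 := Quaternion.continuous_imK.comp hkcont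
    have h5 : Continuous fun x => ((k x).re,
      u 0 * (k x).imI + u 1 * (k x).imJ + u 2 * (k x).imK) := by
      simp only [Function.comp_def] at h1 h2 h3 h4
      fun_prop
    exact Complex.equivRealProdCLM.symm.continuous.comp h5
  have hcn : ∀ x, ‖c x‖ = 1 := by
    intro x
    have h2 := hk1 x
    rw [hkeq x] at h2
    rw [← sq_eq_sq₀ (norm_nonneg _) zero_le_one, Complex.sq_norm, Complex.normSq_apply, one_pow,
      ← h2]
    simp only [dotProduct, Fin.sum_univ_three] at hu1
    simp [Quaternion.normSq_def', imQuat_apply]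
    linear_combination -((c x).im ^ 2) * hu1
  obtain ⟨φ, hφ, hφc⟩ := exists_continuous_log c hcc hcn
  have hkφ : ∀ x, k x = k (north 2) * expQuat u (φ x) := by
    intro x
    have h2 := hφc x
    have h3 := congrArg Complex.re h2
    have h4 := congrArg Complex.im h2
    simp [Complex.exp_re, Complex.exp_im] at h3 h4
    have h := imQuat_mul_self u
    rw [hu1, mul_one, neg_smul, one_smul] at h
    have h6 : ∀ r : ℝ, (r : Quaternion ℝ) = r • 1 := fun r => by
      rw [← Quaternion.coe_mul_eq_smul, mul_one]
    rw [hkeq x, hkeq (north 2), h3, h4]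
    simp only [expQuat, mul_add, add_mul, smul_mul_smul_comm, h, h6, mul_one, one_mul]
    module
  have hcont : Continuous fun p : Sph 3 × I × Unit =>
      s p.1 p.2.1 * expQuat u (-(p.2.1 * φ p.1)) := by
    have h2 : Continuous fun p : Sph 3 × I × Unit => -((p.2.1 : ℝ) * φ p.1) := by fun_prop
    exact (hs.comp (continuous_fst.prodMk continuous_snd.fst)).mul
      ((continuous_expQuat u).comp h2)
  obtain ⟨Ψ, hΨ, hΨs⟩ := exists_descent (Z := Unit) inferInstance
    (fun x (t : I) _ => s x t * expQuat u (-(t * φ x))) hcont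
    (by simp [hs0, expQuat_zero])
    (fun x z => by
      have h2 : ∀ x, s x 1 * expQuat u (-((1 : I) * φ x)) = s y 1 * k (north 2) := by
        intro x
        rw [hsk x, hkφ x, mul_assoc, mul_assoc, ← expQuat_add hu1]
        simp [expQuat_zero]
      rw [h2, h2])
  refine ⟨fun w => Ψ w (), hΨ.comp (Continuous.prodMk_left ()), fun w => ?_, fun w => ?_⟩
  · obtain ⟨v, t, rfl⟩ := susp_surjective inferInstance w
    simp only [hΨs]
    rw [map_mul, hU, normSq_expQuat hu1, one_mul]
  · obtain ⟨v, t, rfl⟩ := susp_surjective inferInstance w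
    simp only [hΨs]
    rw [mul_assoc, expQuat_mul_imQuat, ← mul_assoc, hsg, mul_assoc]

/-- The Clifford module structure of `ℝ⁵` on `ℂ⁴`. -/
noncomputable def gamma5 : (Fin 5 → ℝ) →ₗ[ℝ] Matrix (Fin 4) (Fin 4) ℂ where
  toFun x := !![(x 0 : ℂ), 0, x 1 + x 2 * Complex.I, -(x 3 - x 4 * Complex.I);
    0, (x 0 : ℂ), x 3 + x 4 * Complex.I, x 1 - x 2 * Complex.I;
    x 1 - x 2 * Complex.I, x 3 - x 4 * Complex.I, -(x 0 : ℂ), 0;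
    -(x 3 + x 4 * Complex.I), x 1 + x 2 * Complex.I, 0, -(x 0 : ℂ)]
  map_add' x y := by
    ext i j
    fin_cases i <;> fin_cases j <;> simp <;> ring
  map_smul' r x := by
    ext i j
    fin_cases i <;> fin_cases j <;> simp <;> ring

lemma gamma5_apply (x : Fin 5 → ℝ) :
    gamma5 x = !![(x 0 : ℂ), 0, x 1 + x 2 * Complex.I, -(x 3 - x 4 * Complex.I);
    0, (x 0 : ℂ), x 3 + x 4 * Complex.I, x 1 - x 2 * Complex.I;
    x 1 - x 2 * Complex.I, x 3 - x 4 * Complex.I, -(x 0 : ℂ), 0;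
    -(x 3 + x 4 * Complex.I), x 1 + x 2 * Complex.I, 0, -(x 0 : ℂ)] := rfl

lemma gamma5_mul_self (x : Fin 5 → ℝ) :
    gamma5 x * gamma5 x = ((1 : ℝ) * (x ⬝ᵥ x)) • (1 : Matrix (Fin 4) (Fin 4) ℂ) := by
  have hI : Complex.I ^ 2 = -1 := Complex.I_sq
  rw [gamma5_apply]
  ext i j
  rw [mul_apply, Fin.sum_univ_four, Matrix.smul_apply, dotProduct, Fin.sum_univ_five]
  fin_cases i <;> fin_cases j <;> simp <;> ring_nf <;> (try rw [hI]) <;> ring_nf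

lemma mulVec_single_eq {n : ℕ} (A : Matrix (Fin n) (Fin n) ℝ) (i j : Fin n) :
    (A *ᵥ Pi.single j 1) i = A i j := by simp

lemma transpose_mulVec_of_fix {n : ℕ} {A : Matrix (Fin n) (Fin n) ℝ} (hA : A ∈ SOSet n)
    {v : Fin n → ℝ} (h : A *ᵥ v = v) : Aᵀ *ᵥ v = v := by
  conv_lhs => rw [← h]
  rw [mulVec_mulVec, transpose_mul_of_mem_SOSet hA, one_mulVec]

lemma single_dotProduct_self {n : ℕ} (j : Fin n) :
    (Pi.single j 1 : Fin n → ℝ) ⬝ᵥ Pi.single j 1 = 1 := by simp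

/-- Based loops of rotations. -/
def BasedLoop (h : C(Sph 2, Matrix (Fin 5) (Fin 5) ℝ)) : Prop :=
  (∀ v, h v ∈ SOSet 5) ∧ h (north 1) = 1

lemma exists_fix_step (k : Fin 5) (hk : 2 ≤ k.1) (L : C(Sph 2, Matrix (Fin 5) (Fin 5) ℝ))
    (hL : BasedLoop L) (hfix : ∀ v j, k < j → L v *ᵥ Pi.single j 1 = Pi.single j 1) :
    ∃ L' : C(Sph 2, Matrix (Fin 5) (Fin 5) ℝ), L.HomotopicWith L' BasedLoop ∧ BasedLoop L' ∧
      ∀ v j, k ≤ j → L' v *ᵥ Pi.single j 1 = Pi.single j 1 := by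
  have hzero : ∀ v i, k < i → L v i k = 0 := by
    intro v i hi
    have h := congrFun (transpose_mulVec_of_fix (hL.1 v) (hfix v i hi)) k
    rw [mulVec_single_eq, transpose_apply] at h
    rw [h, Pi.single_eq_of_ne hi.ne]
  let ext0 : (Fin (k.1 + 1) → ℝ) → Fin 5 → ℝ := fun y i =>
    if h : i.1 < k.1 + 1 then y ⟨i.1, h⟩ else 0
  have hext : Continuous ext0 := continuous_pi fun i => by
    by_cases h : i.1 < k.1 + 1
    · simp only [ext0, dif_pos h]; fun_prop
    · simp only [ext0, dif_neg h]; fun_prop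
  have hdot : ∀ y, ext0 y ⬝ᵥ ext0 y = y ⬝ᵥ y := by
    intro y
    rw [dotProduct, dotProduct, ← Finset.sum_subset (Finset.subset_univ
      (Finset.univ.map (Fin.castLEEmb (Nat.succ_le_of_lt k.2))))]
    · rw [Finset.sum_map]
      refine Finset.sum_congr rfl fun i _ => ?_
      have h : ext0 y (Fin.castLEEmb (Nat.succ_le_of_lt k.2) i) = y i := dif_pos i.2
      rw [h]
    · intro i _ hi
      have h : ¬ i.1 < k.1 + 1 := fun h => hi (by
        simp only [Finset.mem_map, Finset.mem_univ, true_and]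
        exact ⟨⟨i.1, h⟩, rfl⟩)
      have h' : ext0 y i = 0 := dif_neg h
      rw [h', zero_mul]
  let c : C(Sph 2, Fin (k.1 + 1) → ℝ) :=
    ⟨fun v i => L v (Fin.castLE (Nat.succ_le_of_lt k.2) i) k,
      continuous_pi fun i => L.continuous.matrix_elem _ _⟩
  have hcext : ∀ v, ext0 (c v) = L v *ᵥ Pi.single k 1 := by
    intro v
    ext i
    rw [mulVec_single_eq]
    by_cases h : i.1 < k.1 + 1
    · simp only [ext0, dif_pos h]; rfl
    · simp only [ext0, dif_neg h]
      rw [hzero v i (Fin.lt_def.2 (by omega))]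
  have hc1 : ∀ v, c v ⬝ᵥ c v = 1 := fun v => by
    rw [← hdot, hcext, mulVec_dotProduct_mulVec_of_mem_SOSet (hL.1 v), single_dotProduct_self]
  let e : Fin (k.1 + 1) → ℝ := Pi.single (Fin.last _) 1
  have heext : ext0 e = Pi.single k 1 := by
    ext i
    by_cases h : i.1 < k.1 + 1
    · simp only [ext0, dif_pos h, e, Pi.single_apply, Fin.ext_iff, Fin.val_last]
    · simp only [ext0, dif_neg h]
      rw [Pi.single_eq_of_ne (Fin.ne_of_val_ne (by omega))]
  obtain ⟨H, hH, hH0, hH1, hHU, -⟩ := exists_fun_of_homotopicWith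
    (homotopicWith_const_of_lt one_pos (by omega) c hc1 (e := e) (single_dotProduct_self _)
      (fun _ _ => False) (Or.inl fun _ _ h => h))
  obtain ⟨R, -, hR, -, hR0, -, hRSO, hRH, hRfix, -⟩ := exists_rotation_lift (γ := gamma5) (ε := 1)
    (by norm_num) gamma5_mul_self (fun v s => ext0 (H v s)) (hext.comp hH)
    (fun v s => (hdot _).trans (hHU v s))
  have hRk : ∀ v, R v 1 *ᵥ (L v *ᵥ Pi.single k 1) = Pi.single k 1 := by
    intro v
    have h := hRH v 1
    rwa [hH0, hH1, hcext, ContinuousMap.const_apply, heext] at h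
  have hRj : ∀ v s j, k < j → R v s *ᵥ Pi.single j 1 = Pi.single j 1 := by
    intro v s j hj
    refine hRfix v _ (fun t => ?_) s
    have h : ¬ j.1 < k.1 + 1 := by rw [Fin.lt_def] at hj; omega
    have h' : ext0 (H v t) j = 0 := dif_neg h
    rw [dotProduct_single, h', zero_mul]
  have hK : Continuous fun p : Sph 2 × I => (R (north 1) p.2)ᵀ * R p.1 p.2 * L p.1 := by
    have h1 : Continuous fun p : Sph 2 × I => R (north 1) p.2 :=
      hR.comp (continuous_const.prodMk continuous_snd)
    exact (h1.matrix_transpose.matrix_mul hR).matrix_mul (L.continuous.comp continuous_fst)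
  have hb : ∀ t, BasedLoop ⟨fun v => (R (north 1) t)ᵀ * R v t * L v,
      hK.comp (continuous_id.prodMk continuous_const)⟩ := fun t =>
    ⟨fun v => mul_mem_SOSet (mul_mem_SOSet (transpose_mem_SOSet (hRSO _ _)) (hRSO _ _)) (hL.1 v),
      by
        change (R (north 1) t)ᵀ * R (north 1) t * L (north 1) = 1
        rw [transpose_mul_of_mem_SOSet (hRSO _ _), hL.2, Matrix.one_mul]⟩
  refine ⟨_, homotopicWith_of_fun (fun v s => (R (north 1) s)ᵀ * R v s * L v) hK
    (fun v => by simp [hR0]) (fun v => rfl) hb, hb 1, fun v j hj => ?_⟩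
  change ((R (north 1) 1)ᵀ * R v 1 * L v) *ᵥ _ = _
  rw [← mulVec_mulVec, ← mulVec_mulVec]
  rcases hj.eq_or_lt with rfl | hj
  · rw [hRk]
    refine transpose_mulVec_of_fix (hRSO _ _) ?_
    have h := hRk (north 1)
    rwa [hL.2, one_mulVec] at h
  · rw [hfix v j hj, hRj v 1 j hj]
    exact transpose_mulVec_of_fix (hRSO _ _) (hRj _ _ _ hj)

/-- Based loops of rotations of `ℝ⁵` can be deformed into the rotations of a plane. -/
theorem exists_planar_loop (L : C(Sph 2, Matrix (Fin 5) (Fin 5) ℝ)) (hL : BasedLoop L) :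
    ∃ L' : C(Sph 2, Matrix (Fin 5) (Fin 5) ℝ), L.HomotopicWith L' BasedLoop ∧ BasedLoop L' ∧
      ∀ v (j : Fin 5), 2 ≤ j → L' v *ᵥ Pi.single j 1 = Pi.single j 1 := by
  obtain ⟨L₁, h₁, hb₁, hf₁⟩ := exists_fix_step 4 (by simp) L hL
    (fun v j hj => absurd hj (not_lt.2 (Fin.le_last j)))
  obtain ⟨L₂, h₂, hb₂, hf₂⟩ := exists_fix_step 3 (by simp) L₁ hb₁
    (fun v j hj => hf₁ v j (by revert hj; revert j; decide))
  obtain ⟨L₃, h₃, hb₃, hf₃⟩ := exists_fix_step 2 (by simp) L₂ hb₂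
    (fun v j hj => hf₂ v j (by revert hj; revert j; decide))
  exact ⟨L₃, (h₁.trans h₂).trans h₃, hb₃, hf₃⟩

/-- The rotation with cosine `c` and sine `s` in the plane of `u` and `w`. -/
noncomputable def planeRot {n : ℕ} (c s : ℝ) (u w : Fin n → ℝ) : Matrix (Fin n) (Fin n) ℝ :=
  1 + (c - 1) • (vecMulVec u u + vecMulVec w w) + s • (vecMulVec w u - vecMulVec u w)

lemma planeRot_mulVec {n : ℕ} (c s : ℝ) (u w v : Fin n → ℝ) : planeRot c s u w *ᵥ v =
    v + (c - 1) • ((u ⬝ᵥ v) • u + (w ⬝ᵥ v) • w) + s • ((u ⬝ᵥ v) • w - (w ⬝ᵥ v) • u) := by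
  rw [planeRot, add_mulVec, add_mulVec, one_mulVec, smul_mulVec, smul_mulVec, add_mulVec,
    sub_mulVec, vecMulVec_mulVec, vecMulVec_mulVec, vecMulVec_mulVec, vecMulVec_mulVec]
  simp only [op_smul_eq_smul]

lemma planeRot_mem_SOSet {n : ℕ} {c s : ℝ} {u w : Fin n → ℝ} (hcs : c ^ 2 + s ^ 2 = 1)
    (hu : u ⬝ᵥ u = 1) (hw : w ⬝ᵥ w = 1) (huw : u ⬝ᵥ w = 0) : planeRot c s u w ∈ SOSet n := by
  obtain ⟨z, hz⟩ := IsAlgClosed.exists_pow_nat_eq (⟨c, s⟩ : ℂ) (n := 2) two_pos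
  obtain ⟨a, b⟩ := z
  have h1 := congrArg Complex.re hz
  have h2 := congrArg Complex.im hz
  simp [sq] at h1 h2
  have h3 : a ^ 2 + b ^ 2 = 1 := by
    have h4 : (a ^ 2 + b ^ 2) ^ 2 = 1 := by rw [← hcs, ← h1, ← h2]; ring
    nlinarith [sq_nonneg a, sq_nonneg b]
  have h4 : planeRot c s u w = reflMat (a • u + b • w) * reflMat u := by
    refine ext_of_mulVec_single fun i => ?_
    rw [← mulVec_mulVec, reflMat_mulVec, reflMat_mulVec, planeRot_mulVec, ← h1, ← h2]
    set v : Fin n → ℝ := Pi.single i 1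
    have h5 : w ⬝ᵥ u = 0 := by rw [dotProduct_comm, huw]
    simp only [dotProduct_sub, dotProduct_smul, add_dotProduct, smul_dotProduct, hu, h5,
      smul_eq_mul]
    ext j
    simp only [Pi.add_apply, Pi.sub_apply, Pi.smul_apply, smul_eq_mul]
    linear_combination ((w ⬝ᵥ v) * w j - (u ⬝ᵥ v) * u j) * h3
  rw [h4]
  refine reflMat_mul_reflMat_mem_SOSet ?_ hu
  have h5 : w ⬝ᵥ u = 0 := by rw [dotProduct_comm, huw]
  simp only [dotProduct_add, dotProduct_smul, add_dotProduct, smul_dotProduct, hu, h5, hw, huw,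
      smul_eq_mul]
  linarith

lemma conj_planeRot {n : ℕ} {A : Matrix (Fin n) (Fin n) ℝ} (hA : A ∈ SOSet n) (c s : ℝ)
    (u w : Fin n → ℝ) : A * planeRot c s u w * Aᵀ = planeRot c s (A *ᵥ u) (A *ᵥ w) := by
  refine ext_of_mulVec_single fun i => ?_
  have h : ∀ u v : Fin n → ℝ, (A *ᵥ u) ⬝ᵥ v = u ⬝ᵥ (Aᵀ *ᵥ v) := fun u v => by
    rw [dotProduct_mulVec, vecMul_transpose]
  rw [← mulVec_mulVec, ← mulVec_mulVec, planeRot_mulVec, planeRot_mulVec, h, h]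
  simp only [mulVec_add, mulVec_sub, mulVec_smul, mulVec_mulVec, hA.1, one_mulVec]

lemma exists_eq_planeRot {A : Matrix (Fin 5) (Fin 5) ℝ} (hA : A ∈ SOSet 5)
    (hfix : ∀ j : Fin 5, 2 ≤ j → A *ᵥ Pi.single j 1 = Pi.single j 1) :
    A = planeRot (A 0 0) (A 1 0) (Pi.single 0 1) (Pi.single 1 1) ∧ A 0 0 ^ 2 + A 1 0 ^ 2 = 1 := by
  have hcol : ∀ i j : Fin 5, 2 ≤ j → A i j = (Pi.single j 1 : Fin 5 → ℝ) i := fun i j hj => by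
    exact (mulVec_single_eq A i j).symm.trans (congrFun (hfix j hj) i)
  have hrow : ∀ i j : Fin 5, 2 ≤ j → A j i = (Pi.single j 1 : Fin 5 → ℝ) i := fun i j hj => by
    exact (mulVec_single_eq Aᵀ i j).symm.trans
      (congrFun (transpose_mulVec_of_fix hA (hfix j hj)) i)
  have h : A = !![A 0 0, A 0 1, 0, 0, 0; A 1 0, A 1 1, 0, 0, 0; 0, 0, 1, 0, 0; 0, 0, 0, 1, 0;
      0, 0, 0, 0, 1] := by
    ext i j
    fin_cases j
    · fin_cases i
      · rfl
      · rfl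
      · exact hrow 0 2 (by decide)
      · exact hrow 0 3 (by decide)
      · exact hrow 0 4 (by decide)
    · fin_cases i
      · rfl
      · rfl
      · exact hrow 1 2 (by decide)
      · exact hrow 1 3 (by decide)
      · exact hrow 1 4 (by decide)
    · refine (hcol i 2 (by decide)).trans ?_
      fin_cases i <;> simp
    · refine (hcol i 3 (by decide)).trans ?_
      fin_cases i <;> simp
    · refine (hcol i 4 (by decide)).trans ?_
      fin_cases i <;> simp
  have hdet := hA.2
  have htr := transpose_mul_of_mem_SOSet hA
  have h00 := congrFun (congrFun htr 0) 0
  have h01 := congrFun (congrFun htr 0) 1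
  have h11 := congrFun (congrFun htr 1) 1
  rw [h] at hdet h00 h01 h11
  simp [Matrix.det_succ_row_zero, Fin.sum_univ_succ, Fin.succAbove] at hdet
  simp [mul_apply, Fin.sum_univ_succ] at h00 h01 h11
  have h3 : (A 0 0 - A 1 1) ^ 2 + (A 1 0 + A 0 1) ^ 2 = 0 := by
    linear_combination h00 + h11 - 2 * hdet
  have h1 : A 1 1 = A 0 0 := by nlinarith [sq_nonneg (A 1 0 + A 0 1), sq_nonneg (A 0 0 - A 1 1)]
  have h2 : A 0 1 = - A 1 0 := by nlinarith [sq_nonneg (A 1 0 + A 0 1), sq_nonneg (A 0 0 - A 1 1)]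
  refine ⟨?_, by nlinarith⟩
  rw [h1, h2] at h
  conv_lhs => rw [h]
  ext i j
  fin_cases i <;> fin_cases j <;> simp [planeRot, vecMulVec_apply]

/-- The vector of `ℝ⁵ = ℍ ⊕ ℝ` with the given components. -/
def vec5 (q : Quaternion ℝ) (r : ℝ) : Fin 5 → ℝ := ![q.re, q.imI, q.imJ, q.imK, r]

lemma vec5_dotProduct (q q' : Quaternion ℝ) (r r' : ℝ) :
    vec5 q r ⬝ᵥ vec5 q' r' = (q * star q').re + r * r' := by
  simp [vec5, dotProduct, Fin.sum_univ_five, Quaternion.re_mul]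

lemma vec5_inj_dot (p q : Quaternion ℝ) (hp : Quaternion.normSq p = 1) (q' : Quaternion ℝ) :
    (p * q * star (p * q')).re = (q * star q').re := by
  have h : p * q * star (p * q') = p * (q * star q') * star p := by
    rw [star_mul]; simp only [mul_assoc]
  have hc : ∀ a b : Quaternion ℝ, (a * b).re = (b * a).re := fun a b => by
    rw [Quaternion.re_mul, Quaternion.re_mul]; ring
  rw [h, hc, ← mul_assoc, star_mul_self_of_normSq hp, one_mul]

lemma continuous_vec5 {X : Type*} [TopologicalSpace X] {q : X → Quaternion ℝ} {r : X → ℝ}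
    (hq : Continuous q) (hr : Continuous r) : Continuous fun x => vec5 (q x) (r x) := by
  refine continuous_pi fun i => ?_
  fin_cases i
  · exact Quaternion.continuous_re.comp hq
  · exact Quaternion.continuous_imI.comp hq
  · exact Quaternion.continuous_imJ.comp hq
  · exact Quaternion.continuous_imK.comp hq
  · exact hr

/-- Orthonormal pairs. -/
def OrthPair : Set ((Fin 5 → ℝ) × (Fin 5 → ℝ)) :=
  {p | p.1 ⬝ᵥ p.1 = 1 ∧ p.2 ⬝ᵥ p.2 = 1 ∧ p.1 ⬝ᵥ p.2 = 0}

/-- Null-homotopic families of orthonormal pairs parametrized by `S³`. -/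
def FrameNull (u w : Sph 4 → Fin 5 → ℝ) : Prop :=
  ∃ K : Sph 4 → I → (Fin 5 → ℝ) × (Fin 5 → ℝ), (Continuous fun p : Sph 4 × I => K p.1 p.2) ∧
    (∀ x t, K x t ∈ OrthPair) ∧ (∀ x, K x 0 = (u x, w x)) ∧ ∀ x y, K x 1 = K y 1

lemma continuous_glue {X Y : Type*} [TopologicalSpace X] [TopologicalSpace Y] {K L : X → I → Y}
    (hK : Continuous fun p : X × I => K p.1 p.2) (hL : Continuous fun p : X × I => L p.1 p.2)
    (h : ∀ x, K x 1 = L x 0) : ∃ M : X → I → Y, (Continuous fun p : X × I => M p.1 p.2) ∧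
      (∀ x, M x 0 = K x 0) ∧ (∀ x, M x 1 = L x 1) ∧
      ∀ x t, (∃ s, M x t = K x s) ∨ ∃ s, M x t = L x s := by
  classical
  refine ⟨fun x t => if (t : ℝ) ≤ 1 / 2 then K x (Set.projIcc 0 1 zero_le_one (2 * t))
    else L x (Set.projIcc 0 1 zero_le_one (2 * t - 1)), ?_, fun x => ?_, fun x => ?_,
    fun x t => ?_⟩
  · refine Continuous.if_le ?_ ?_ (by fun_prop) (by fun_prop) ?_
    · have h1 : Continuous fun p : X × I => (p.1, Set.projIcc (0 : ℝ) 1 zero_le_one (2 * p.2)) :=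
        continuous_fst.prodMk (continuous_projIcc.comp (by fun_prop))
      exact hK.comp h1
    · have h1 : Continuous fun p : X × I =>
          (p.1, Set.projIcc (0 : ℝ) 1 zero_le_one (2 * p.2 - 1)) :=
        continuous_fst.prodMk (continuous_projIcc.comp (by fun_prop))
      exact hL.comp h1
    · rintro ⟨x, t⟩ ht
      simp only at ht ⊢
      rw [ht]
      norm_num
      exact h x
  · simp
  · norm_num
  · by_cases h : (t : ℝ) ≤ 1 / 2
    · exact Or.inl ⟨_, if_pos h⟩
    · exact Or.inr ⟨_, if_neg h⟩

lemma FrameNull.of_homotopy {u w u' w' : Sph 4 → Fin 5 → ℝ} (h : FrameNull u' w')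
    (K : Sph 4 → I → (Fin 5 → ℝ) × (Fin 5 → ℝ)) (hK : Continuous fun p : Sph 4 × I => K p.1 p.2)
    (hO : ∀ x t, K x t ∈ OrthPair) (h0 : ∀ x, K x 0 = (u x, w x))
    (h1 : ∀ x, K x 1 = (u' x, w' x)) : FrameNull u w := by
  obtain ⟨L, hL, hLO, hL0, hL1⟩ := h
  obtain ⟨M, hM, hM0, hM1, hMM⟩ := continuous_glue hK hL (fun x => (h1 x).trans (hL0 x).symm)
  refine ⟨M, hM, fun x t => ?_, fun x => (hM0 x).trans (h0 x), fun x y => ?_⟩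
  · obtain ⟨s, h⟩ | ⟨s, h⟩ := hMM x t <;> rw [h]
    · exact hO x s
    · exact hLO x s
  · rw [hM1, hM1, hL1 x y]

/-- The antipode. -/
def antipode {n : ℕ} (x : Sph n) : Sph n := ⟨-x.1, by rw [neg_dotProduct_neg]; exact x.2⟩

lemma continuous_antipode {n : ℕ} : Continuous (antipode : Sph n → Sph n) := by
  unfold antipode; fun_prop

lemma vec5_orthPair {q q' : Quaternion ℝ} {r r' : ℝ} (h1 : (q * star q).re + r * r = 1)
    (h2 : (q' * star q').re + r' * r' = 1) (h3 : (q * star q').re + r * r' = 0) :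
    (vec5 q r, vec5 q' r') ∈ OrthPair :=
  ⟨(vec5_dotProduct ..).trans h1, (vec5_dotProduct ..).trans h2, (vec5_dotProduct ..).trans h3⟩

lemma vec5_orthPair_of_normSq {q : Quaternion ℝ} (h1 : Quaternion.normSq q = 1) :
    (vec5 q 0, vec5 0 1) ∈ OrthPair := by
  have h0 : (0 : Quaternion ℝ).re = 0 := rfl
  refine vec5_orthPair ?_ (by simp [h0]) (by simp [h0])
  rw [Quaternion.self_mul_star, h1, mul_zero, add_zero]; rfl

lemma frameNull_mul_conj (p : Quaternion ℝ) (hp : Quaternion.normSq p = 1)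
    (β : Sph 4 → Quaternion ℝ) (hβ : Continuous β) (hβ1 : ∀ x, Quaternion.normSq (β x) = 1) :
    FrameNull (fun x => vec5 (p * (β x * star (β (antipode x)))) 0) (fun _ => vec5 0 1) := by
  let e : Fin 3 → ℝ := ![1, 0, 0]
  have he : e ⬝ᵥ e = 1 := by simp [e, dotProduct, Fin.sum_univ_three]
  let a : Sph 4 → I → Sph 4 := fun x t =>
    ⟨quatVec (vecQuat x.1 * expQuat e (Real.pi * (1 - t))), by
      rw [quatVec_dotProduct_self, map_mul, normSq_vecQuat, x.2, normSq_expQuat he, one_mul]⟩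
  have ha : Continuous fun q : Sph 4 × I => a q.1 q.2 := by
    refine Continuous.subtype_mk (continuous_quatVec.comp (Continuous.mul ?_ ?_)) _
    · exact continuous_vecQuat.comp (by fun_prop)
    · exact (continuous_expQuat e).comp (by fun_prop)
  refine ⟨fun x t => (vec5 (p * (β x * star (β (a x t)))) 0, vec5 0 1), ?_, fun x t => ?_,
    fun x => ?_, fun x y => ?_⟩
  · refine Continuous.prodMk (continuous_vec5 ?_ continuous_const) continuous_const
    exact continuous_const.mul ((hβ.comp continuous_fst).mul (continuous_star.comp (hβ.comp ha)))
  · refine vec5_orthPair_of_normSq ?_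
    rw [map_mul, map_mul, Quaternion.normSq_star, hp, hβ1, hβ1]; norm_num
  · have h : a x 0 = antipode x := by
      refine Subtype.ext ?_
      simp only [a, antipode, Set.Icc.coe_zero, sub_zero, mul_one, expQuat_pi, mul_neg]
      ext i; fin_cases i <;> simp [quatVec, vecQuat_apply]
    simp only [h]
  · have h : ∀ x, a x 1 = x := fun x => by
      refine Subtype.ext ?_
      simp only [a, Set.Icc.coe_one, sub_self, mul_zero, expQuat_zero, mul_one]
      ext i; fin_cases i <;> simp [quatVec, vecQuat_apply]
    simp only [h, Quaternion.self_mul_star (β _), hβ1]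

lemma continuous_mkQuat {X : Type*} [TopologicalSpace X] {a b c d : X → ℝ} (ha : Continuous a)
    (hb : Continuous b) (hc : Continuous c) (hd : Continuous d) :
    Continuous fun x => mkQuat (a x) (b x) (c x) (d x) := by
  have h : Continuous fun x => vecQuat ![a x, b x, c x, d x] :=
    continuous_vecQuat.comp (continuous_pi fun i => by fin_cases i <;> assumption)
  exact h

/-- A rotating frame that starts at `(y, e)` and ends at `(star y, e)`. -/
noncomputable def swingFst (y : Quaternion ℝ) (c s : ℝ) : Quaternion ℝ :=
  mkQuat (y.re * c ^ 2 + s ^ 2) (c * y.imI) (c * y.imJ) (c * y.imK)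

/-- The second vector of the rotating frame. -/
noncomputable def swingSnd (y : Quaternion ℝ) (c s : ℝ) : Quaternion ℝ :=
  mkQuat (y.re * s * c - s * c) (s * y.imI) (s * y.imJ) (s * y.imK)

lemma swing_orthonormal {y : Quaternion ℝ} (hy : Quaternion.normSq y = 1) {c s : ℝ}
    (hcs : c ^ 2 + s ^ 2 = 1) :
    (swingFst y c s * star (swingFst y c s)).re + (y.re * c * s - s * c) * (y.re * c * s - s * c) = 1
    ∧ (swingSnd y c s * star (swingSnd y c s)).re
      + (y.re * s ^ 2 + c ^ 2) * (y.re * s ^ 2 + c ^ 2) = 1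
    ∧ (swingFst y c s * star (swingSnd y c s)).re
      + (y.re * c * s - s * c) * (y.re * s ^ 2 + c ^ 2) = 0 := by
  rw [Quaternion.normSq_def'] at hy
  simp only [Quaternion.re_mul, swingFst, swingSnd]
  simp
  refine ⟨?_, ?_, ?_⟩
  · linear_combination c ^ 2 * hy + (y.re ^ 2 * c ^ 2 + s ^ 2 + 1) * hcs
  · linear_combination s ^ 2 * hy + (y.re ^ 2 * s ^ 2 + c ^ 2 + 1) * hcs
  · linear_combination s * c * hy + (y.re ^ 2 * s * c - s * c) * hcs

lemma frameNull_mul_mul (p : Quaternion ℝ) (hp : Quaternion.normSq p = 1)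
    (β : Sph 4 → Quaternion ℝ) (hβ : Continuous β) (hβ1 : ∀ x, Quaternion.normSq (β x) = 1) :
    FrameNull (fun x => vec5 (p * (β x * β (antipode x))) 0) (fun _ => vec5 0 1) := by
  let y : Sph 4 → Quaternion ℝ := fun x => β (antipode x)
  have hy : Continuous y := hβ.comp continuous_antipode
  have hre := (Quaternion.continuous_re.comp hy).comp (continuous_fst (X := Sph 4) (Y := I))
  have hI := (Quaternion.continuous_imI.comp hy).comp (continuous_fst (X := Sph 4) (Y := I))
  have hJ := (Quaternion.continuous_imJ.comp hy).comp (continuous_fst (X := Sph 4) (Y := I))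
  have hK := (Quaternion.continuous_imK.comp hy).comp (continuous_fst (X := Sph 4) (Y := I))
  simp only [Function.comp_def] at hre hI hJ hK
  have hc : Continuous fun q : Sph 4 × I => Real.cos (Real.pi * q.2) := by fun_prop
  have hs : Continuous fun q : Sph 4 × I => Real.sin (Real.pi * q.2) := by fun_prop
  have h1 : Continuous fun q : Sph 4 × I => p * β q.1 :=
    continuous_const.mul (hβ.comp continuous_fst)
  refine (frameNull_mul_conj p hp β hβ hβ1).of_homotopy (fun x t =>
    (vec5 (p * β x * swingFst (y x) (Real.cos (Real.pi * t)) (Real.sin (Real.pi * t)))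
      ((y x).re * Real.cos (Real.pi * t) * Real.sin (Real.pi * t)
        - Real.sin (Real.pi * t) * Real.cos (Real.pi * t)),
      vec5 (p * β x * swingSnd (y x) (Real.cos (Real.pi * t)) (Real.sin (Real.pi * t)))
      ((y x).re * Real.sin (Real.pi * t) ^ 2 + Real.cos (Real.pi * t) ^ 2)))
    ?_ (fun x t => ?_) (fun x => ?_) (fun x => ?_)
  · refine Continuous.prodMk (continuous_vec5 (h1.mul ?_) ?_) (continuous_vec5 (h1.mul ?_) ?_)
    · exact continuous_mkQuat ((hre.mul (hc.pow 2)).add (hs.pow 2)) (hc.mul hI) (hc.mul hJ)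
        (hc.mul hK)
    · exact ((hre.mul hc).mul hs).sub (hs.mul hc)
    · exact continuous_mkQuat (((hre.mul hs).mul hc).sub (hs.mul hc)) (hs.mul hI) (hs.mul hJ)
        (hs.mul hK)
    · exact (hre.mul (hs.pow 2)).add (hc.pow 2)
  · have hn : Quaternion.normSq (p * β x) = 1 := by rw [map_mul, hp, hβ1, one_mul]
    obtain ⟨h1, h2, h3⟩ := swing_orthonormal (y := y x) (hβ1 _)
      (Real.cos_sq_add_sin_sq (Real.pi * t))
    refine vec5_orthPair ?_ ?_ ?_ <;> rw [vec5_inj_dot _ _ hn] <;> assumption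
  · have h1 : swingFst (y x) 1 0 = y x := by ext <;> simp [swingFst]
    have h2 : swingSnd (y x) 1 0 = 0 := by ext <;> simp [swingSnd] <;> rfl
    simp only [Set.Icc.coe_zero, mul_zero, Real.cos_zero, Real.sin_zero, h1, h2, mul_assoc]
    norm_num
    rfl
  · have h1 : swingFst (y x) (-1) 0 = star (y x) := by ext <;> simp [swingFst]
    have h2 : swingSnd (y x) (-1) 0 = 0 := by ext <;> simp [swingSnd] <;> rfl
    simp only [Set.Icc.coe_one, mul_one, Real.cos_pi, Real.sin_pi, h1, h2, mul_assoc]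
    norm_num
    rfl

/-- The unit quaternion in the direction of `q`. -/
noncomputable def unitQ (q : Quaternion ℝ) : Quaternion ℝ := ‖q‖⁻¹ • q

lemma normSq_unitQ {q : Quaternion ℝ} (hq : q ≠ 0) : Quaternion.normSq (unitQ q) = 1 := by
  have h : ‖q‖ ≠ 0 := norm_ne_zero_iff.2 hq
  rw [unitQ, Quaternion.normSq_smul, Quaternion.normSq_eq_norm_mul_self]
  field_simp

lemma unitQ_eq_self {q : Quaternion ℝ} (hq : Quaternion.normSq q = 1) : unitQ q = q := by
  have h : ‖q‖ = 1 := by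
    rw [Quaternion.normSq_eq_norm_mul_self] at hq
    nlinarith [norm_nonneg q]
  rw [unitQ, h, inv_one, one_smul]

lemma Continuous.unitQ {X : Type*} [TopologicalSpace X] {q : X → Quaternion ℝ}
    (hq : Continuous q) (h0 : ∀ x, q x ≠ 0) : Continuous fun x => unitQ (q x) :=
  (hq.norm.inv₀ fun x => norm_ne_zero_iff.2 (h0 x)).smul hq

lemma FrameNull.of_ne_zero (Q : Sph 4 → I → Quaternion ℝ)
    (hQ : Continuous fun p : Sph 4 × I => Q p.1 p.2) (h0 : ∀ x t, Q x t ≠ 0)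
    (h : FrameNull (fun x => vec5 (unitQ (Q x 1)) 0) (fun _ => vec5 0 1)) :
    FrameNull (fun x => vec5 (unitQ (Q x 0)) 0) (fun _ => vec5 0 1) :=
  h.of_homotopy (fun x t => (vec5 (unitQ (Q x t)) 0, vec5 0 1))
    ((continuous_vec5 (hQ.unitQ fun p => h0 p.1 p.2) continuous_const).prodMk continuous_const)
    (fun x t => vec5_orthPair_of_normSq (normSq_unitQ (h0 x t))) (fun _ => rfl) (fun _ => rfl)

lemma frameNull_of_eq_on_equator {p : Quaternion ℝ} (hp : p ≠ 0) {b : Sph 4 → Quaternion ℝ}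
    (hb : Continuous b) (hb0 : ∀ x, b x ≠ 0) (he : ∀ x, b (antipode x) = b x)
    (hbp : ∀ x, x.1 0 = 0 → b x = p) :
    FrameNull (fun x => vec5 (unitQ (b x)) 0) (fun _ => vec5 0 1) := by
  classical
  have hp1 := normSq_unitQ hp
  let D : Sph 4 → Quaternion ℝ := fun x => star (unitQ p) * unitQ (b x)
  have hD : Continuous D := continuous_const.mul (hb.unitQ hb0)
  have hD0 : ∀ x, x.1 0 = 0 → D x = 1 := fun x hx => by
    simp only [D, hbp x hx, star_mul_self_of_normSq hp1]
  let β : Sph 4 → Quaternion ℝ := fun x => if 0 ≤ x.1 0 then D x else 1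
  have hβ : Continuous β := Continuous.if_le hD continuous_const continuous_const
    ((continuous_apply 0).comp continuous_subtype_val) fun x hx => hD0 x hx.symm
  have hβ1 : ∀ x, Quaternion.normSq (β x) = 1 := by
    intro x
    by_cases h : 0 ≤ x.1 0
    · simp only [β, if_pos h, D]
      rw [map_mul, Quaternion.normSq_star, hp1, normSq_unitQ (hb0 x), one_mul]
    · simp only [β, if_neg h, map_one]
  have hββ : ∀ x, β x * β (antipode x) = D x := by
    intro x
    have hn : (antipode x).1 0 = - x.1 0 := rfl
    rcases lt_trichotomy (x.1 0) 0 with h | h | h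
    · have h' : 0 ≤ (antipode x).1 0 := by rw [hn]; linarith
      simp only [β, if_neg (not_le.2 h), if_pos h', one_mul, D, he]
    · have h' : (antipode x).1 0 = 0 := by rw [hn, h, neg_zero]
      simp only [β, h, h', le_refl, if_true, hD0, mul_one]
    · have h' : ¬ 0 ≤ (antipode x).1 0 := by rw [hn]; linarith
      simp only [β, if_pos h.le, if_neg h', mul_one]
  convert frameNull_mul_mul (unitQ p) hp1 β hβ hβ1 using 3 with x
  rw [hββ, ← mul_assoc, mul_star_self_of_normSq hp1, one_mul]

lemma frameNull_of_smooth {P : (Fin 4 → ℝ) → Fin 4 → ℝ} (hP : ContDiff ℝ 1 P)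
    (hP0 : ∀ x : Sph 4, P x.1 ≠ 0) (hPe : ∀ x, P (-x) = P x) :
    FrameNull (fun x => vec5 (unitQ (vecQuat (P x.1))) 0) (fun _ => vec5 0 1) := by
  have hP' : ContDiff ℝ 1 fun y : Fin 3 → ℝ => P (Fin.cons 0 y) := by
    refine hP.comp (contDiff_pi.2 fun i => ?_)
    refine Fin.cases ?_ (fun i => ?_) i
    · exact contDiff_const
    · exact contDiff_apply ℝ ℝ i
  obtain ⟨q₀, hq₀⟩ := (dense_avoid_cone (d := 2) two_pos (by norm_num) hP').nonempty
  let p : Quaternion ℝ := vecQuat (-q₀)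
  have hp : p ≠ 0 := vecQuat_ne_zero fun h => by
    have := hq₀ (north 2) 0
    rw [zero_smul] at this
    exact this (neg_eq_zero.1 h).symm
  let c : Sph 4 → Quaternion ℝ := fun x => vecQuat (P x.1)
  have hc : Continuous c := continuous_vecQuat.comp (hP.continuous.comp continuous_subtype_val)
  have hc0 : ∀ x, c x ≠ 0 := fun x => vecQuat_ne_zero (hP0 x)
  let m : Sph 4 → ℝ := fun x => ‖c x‖ * ‖p‖ + inner ℝ (c x) p
  have hm : Continuous m := by fun_prop
  have hm0 : ∀ x, 0 ≤ m x := fun x => by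
    have := (abs_le.1 (abs_real_inner_le_norm (c x) p)).1
    simp only [m]; linarith
  have hme : ∀ x, x.1 0 = 0 → 0 < m x := by
    intro x hx
    refine (hm0 x).lt_of_ne fun h => ?_
    have h1 : inner ℝ (-c x) p = ‖-c x‖ * ‖p‖ := by
      rw [inner_neg_left, norm_neg]; simp only [m] at h; linarith
    rw [inner_eq_norm_mul_iff_real, norm_neg] at h1
    obtain ⟨y, hy⟩ : ∃ y : Sph 3, x.1 = Fin.cons 0 y.1 := by
      refine ⟨⟨Fin.tail x.1, ?_⟩, ?_⟩
      · have := x.2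
        rw [← Fin.cons_self_tail x.1, cons_dotProduct_cons, hx] at this
        simpa using this
      · simp only [← hx, Fin.cons_self_tail]
    refine hq₀ y (‖p‖ / ‖c x‖) ?_
    have hcn : ‖c x‖ ≠ 0 := norm_ne_zero_iff.2 (hc0 x)
    have h2 : vecQuat ((‖p‖ / ‖c x‖) • P (Fin.cons 0 y.1)) = vecQuat q₀ := by
      rw [map_smul, ← hy]
      change (‖p‖ / ‖c x‖) • c x = _
      rw [div_eq_inv_mul, mul_smul, inv_smul_eq_iff₀ hcn]
      have h3 : p = - vecQuat q₀ := map_neg _ _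
      rw [smul_neg, h3, smul_neg, neg_inj, norm_neg] at h1
      rw [h3, norm_neg, h1]
    have h3 := congrArg quatVec h2
    have h4 : ∀ v, quatVec (vecQuat v) = v := fun v => by
      ext i; fin_cases i <;> simp [quatVec, vecQuat_apply]
    rwa [h4, h4] at h3
  have hden : ∀ x : Sph 4, 0 < m x + x.1 0 ^ 2 := by
    intro x
    by_cases h : x.1 0 = 0
    · have := hme x h; positivity
    · have := hm0 x; positivity
  let θ : Sph 4 → ℝ := fun x => m x / (m x + x.1 0 ^ 2)
  have hx0 : Continuous fun x : Sph 4 => x.1 0 := (continuous_apply 0).comp continuous_subtype_val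
  have hθ : Continuous θ := hm.div (hm.add (hx0.pow 2)) fun x => (hden x).ne'
  have hθ0 : ∀ x, 0 ≤ θ x := fun x => div_nonneg (hm0 x) (hden x).le
  have hθ1 : ∀ x, θ x ≤ 1 := fun x => (div_le_one (hden x)).2 (by nlinarith [sq_nonneg (x.1 0)])
  let Q : Sph 4 → I → Quaternion ℝ := fun x t => (1 - t * θ x : ℝ) • c x + (t * θ x : ℝ) • p
  have hQ : Continuous fun q : Sph 4 × I => Q q.1 q.2 := by
    have h1 : Continuous fun q : Sph 4 × I => θ q.1 := hθ.comp continuous_fst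
    have h2 : Continuous fun q : Sph 4 × I => c q.1 := hc.comp continuous_fst
    fun_prop
  have hQ0 : ∀ x t, Q x t ≠ 0 := by
    intro x t h
    set τ : ℝ := t * θ x with hτ
    have hτ0 : 0 ≤ τ := mul_nonneg t.2.1 (hθ0 x)
    have hτ1 : τ ≤ 1 := mul_le_one₀ t.2.2 (hθ0 x) (hθ1 x)
    have hQx : (1 - τ) • c x + τ • p = 0 := h
    have hτne : τ ≠ 0 := fun h' => hc0 x (by simpa [h'] using hQx)
    have h1 : p = (-((1 - τ) / τ)) • c x := by
      rw [neg_smul, div_eq_inv_mul, mul_smul, ← smul_neg, eq_inv_smul_iff₀ hτne]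
      exact eq_neg_of_add_eq_zero_right hQx
    have h2 : 0 ≤ (1 - τ) / τ := div_nonneg (by linarith) hτ0
    have h3 : m x = 0 := by
      simp only [m]
      rw [h1, norm_smul, inner_smul_right, real_inner_self_eq_norm_sq, norm_neg, Real.norm_eq_abs,
        abs_of_nonneg h2]
      ring
    have h4 : θ x = 0 := by simp only [θ, h3, zero_div]
    exact hτne (by rw [hτ, h4, mul_zero])
  have he : ∀ x, c (antipode x) = c x := fun x => congrArg vecQuat (hPe x.1)
  have hmE : ∀ x, m (antipode x) = m x := fun x => by simp only [m, he]
  have h := FrameNull.of_ne_zero Q hQ hQ0 (frameNull_of_eq_on_equator (p := p) hp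
    (hQ.comp (continuous_id.prodMk continuous_const)) (fun x => hQ0 x 1) (fun x => ?_)
      (fun x hx => ?_))
  · convert h using 4 with x
    simp [Q, c]
  · have h1 : (antipode x).1 0 = - x.1 0 := rfl
    simp only [Q, θ, hmE, he, h1, neg_sq]
  · have h1 : θ x = 1 := by
      simp only [θ, hx]
      have := hme x hx
      field_simp
      ring
    simp [Q, h1]

lemma frameNull_of_even {b : Sph 4 → Quaternion ℝ} (hb : Continuous b)
    (hb1 : ∀ x, Quaternion.normSq (b x) = 1) (he : ∀ x, b (antipode x) = b x) :
    FrameNull (fun x => vec5 (b x) 0) (fun _ => vec5 0 1) := by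
  let f : C(Sph 4, Fin 4 → ℝ) := ⟨fun x => quatVec (b x), continuous_quatVec.comp hb⟩
  have hf1 : ∀ x, f x ⬝ᵥ f x = 1 := fun x => (quatVec_dotProduct_self _).trans (hb1 x)
  obtain ⟨P, hP, hPf, hPe⟩ := exists_smooth_approx f (ε := (4 + 1 : ℝ)⁻¹) (by norm_num)
  have hPe' := hPe fun x y h => by
    have : y = antipode x := Subtype.ext h
    rw [this]; exact congrArg quatVec (he x)
  let L : Sph 4 → I → Fin 4 → ℝ := fun x t => (1 - t : ℝ) • f x + (t : ℝ) • P x.1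
  have hL : Continuous fun q : Sph 4 × I => L q.1 q.2 := by
    have h1 := hP.continuous
    have h2 := f.continuous
    fun_prop
  have hL0 : ∀ x t, L x t ≠ 0 := by
    intro x t
    exact ne_zero_of_norm_sub_lt (hPf x) (by simpa using one_div_le_norm (hf1 x)) t t.2.1 t.2.2
  have h := FrameNull.of_ne_zero (fun x t => vecQuat (L x t)) (continuous_vecQuat.comp hL)
    (fun x t => vecQuat_ne_zero (hL0 x t)) ?_
  · convert h using 3 with x
    simp [L, f, vecQuat_quatVec, unitQ_eq_self (hb1 x)]
  · simp only [L, Set.Icc.coe_one, sub_self, zero_smul, one_smul, zero_add]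
    refine frameNull_of_smooth hP (fun x => ?_) hPe'
    simpa [L] using hL0 x 1

/-- Even families of orthonormal pairs in `ℝ⁵` parametrized by `S³` are null-homotopic. -/
theorem frameNull_of_orthonormal {u w : Sph 4 → Fin 5 → ℝ} (hu : Continuous u) (hw : Continuous w)
    (hO : ∀ x, (u x, w x) ∈ OrthPair) (hue : ∀ x, u (antipode x) = u x)
    (hwe : ∀ x, w (antipode x) = w x) : FrameNull u w := by
  have h51 : vec5 0 1 = Pi.single (Fin.last 4) 1 := by
    ext i; fin_cases i <;> simp [vec5] <;> rfl
  obtain ⟨H, hH, hH0, hH1, hHU, hHe⟩ := exists_fun_of_homotopicWith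
    (homotopicWith_const_of_lt (d := 3) (by norm_num) (by norm_num) ⟨w, hw⟩ (fun x => (hO x).2.1)
      (e := vec5 0 1) (by rw [h51]; exact single_dotProduct_self _)
      (fun x y => y = antipode x) (Or.inr ⟨fun x y => Subtype.ext_iff, fun x y h => by
        rw [h]; exact (hwe x).symm⟩))
  obtain ⟨R, -, hR, -, hR0, -, hRSO, hRH, -, -, -, hRe⟩ := exists_rotation_lift (γ := gamma5)
    (ε := 1) (by norm_num) gamma5_mul_self H hH hHU
  have hRdot := fun x t => mulVec_dotProduct_mulVec_of_mem_SOSet (hRSO x t)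
  have h1 : ∀ x, R x 1 *ᵥ w x = vec5 0 1 := fun x => by
    have h := hRH x 1
    rw [hH0, hH1] at h; exact h
  let b : Sph 4 → Quaternion ℝ := fun x => vecQuat (fun i => (R x 1 *ᵥ u x) (Fin.castSucc i))
  have hRu : Continuous fun x => R x 1 *ᵥ u x :=
    (hR.comp (continuous_id.prodMk continuous_const)).matrix_mulVec hu
  have hub : ∀ x, R x 1 *ᵥ u x = vec5 (b x) 0 := by
    intro x
    have h2 : (R x 1 *ᵥ u x) 4 = 0 := by
      have h3 := (hRdot x 1 (u x) (w x)).trans (hO x).2.2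
      rw [h1, h51, dotProduct_single, mul_one] at h3
      exact h3
    ext i
    fin_cases i
    all_goals first | rfl | exact h2
  refine (frameNull_of_even (b := b) ?_ (fun x => ?_) fun x => ?_).of_homotopy
    (fun x t => (R x t *ᵥ u x, R x t *ᵥ w x)) ?_ (fun x t => ?_) (fun x => ?_) (fun x => ?_)
  · exact continuous_vecQuat.comp (continuous_pi fun i => (continuous_apply _).comp hRu)
  · have h2 := (hRdot x 1 (u x) (u x)).trans (hO x).1
    rw [hub, vec5_dotProduct, Quaternion.self_mul_star, mul_zero, add_zero] at h2
    exact h2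
  · have h2 : R (antipode x) = R x := (hRe _ _ (hHe _ _ rfl)).symm
    simp only [b, h2, hue]
  · exact (hR.matrix_mulVec (hu.comp continuous_fst)).prodMk
      (hR.matrix_mulVec (hw.comp continuous_fst))
  · exact ⟨(hRdot ..).trans (hO x).1, (hRdot ..).trans (hO x).2.1, (hRdot ..).trans (hO x).2.2⟩
  · rw [hR0, one_mulVec, one_mulVec]
  · rw [h1, hub]

/-- The standard parametrization of the circle. -/
noncomputable def circ (t : I) : Sph 2 :=
  ⟨![Real.cos (2 * Real.pi * t), Real.sin (2 * Real.pi * t)], by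
    have := Real.cos_sq_add_sin_sq (2 * Real.pi * t)
    simp only [dotProduct, Fin.sum_univ_two, cons_val_zero, cons_val_one]
    linarith⟩

lemma continuous_circ : Continuous circ := by
  refine Continuous.subtype_mk (continuous_pi fun i => ?_) _
  fin_cases i
  · exact Real.continuous_cos.comp (by fun_prop)
  · exact Real.continuous_sin.comp (by fun_prop)

lemma circ_zero : circ 0 = north 1 := by
  refine Subtype.ext (funext fun i => ?_)
  fin_cases i <;> simp [circ, north]

lemma circ_one : circ 1 = north 1 := by
  refine Subtype.ext (funext fun i => ?_)
  fin_cases i <;> simp [circ, north]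

lemma exists_circle_descent {Y : Type*} [TopologicalSpace Y] {f : I → Y} (hf : Continuous f)
    (h01 : f 0 = f 1) : ∃ l : C(Sph 2, Y), (∀ t, l (circ t) = f t) ∧ ∀ v, ∃ t, l v = f t := by
  let p : ℝ → I := Set.projIcc 0 1 zero_le_one
  have hp : Continuous p := continuous_projIcc
  have hS : ∀ v : Sph 1, v.1 0 = 1 ∨ v.1 0 = -1 := fun v => by
    have h := v.2
    simp only [dotProduct, Fin.sum_univ_one] at h
    exact mul_self_eq_one_iff.1 h
  have hv0 : Continuous fun v : Sph 1 => v.1 0 := (continuous_apply 0).comp continuous_subtype_val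
  have hfc : Continuous fun q : Sph 1 × I × Unit =>
      f (p (1 / 2 - q.1.1 0 * (1 / 2 - q.2.1 / 2))) := by
    have := hv0.comp (continuous_fst (X := Sph 1) (Y := I × Unit))
    simp only [Function.comp_def] at this
    exact hf.comp (hp.comp (by fun_prop))
  have h2 : ∀ v : Sph 1, f (p (1 / 2 - v.1 0 * (1 / 2 - ((0 : I) : ℝ) / 2))) = f 0 := by
    intro v
    rcases hS v with h | h
    · rw [h]; simp [p]
    · rw [h, h01]; norm_num [p]
  obtain ⟨Ψ, hΨ, hΨs⟩ := exists_descent (n := 1) inferInstance (Z := Unit)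
    (fun v t _ => f (p (1 / 2 - v.1 0 * (1 / 2 - t / 2)))) hfc (fun v v' => funext fun _ => (h2 v).trans (h2 v').symm) (fun v v' => by simp)
  · refine ⟨⟨fun w => Ψ w (), hΨ.comp (by fun_prop : Continuous fun w : Sph 2 => (w, ()))⟩,
      fun t => ?_, fun v => ?_⟩
    swap
    · obtain ⟨v, t, rfl⟩ := susp_surjective inferInstance v
      exact ⟨_, congrFun (hΨs v t) ()⟩
    change Ψ (circ t) () = _
    rcases le_total (t : ℝ) (1 / 2) with h | h
    · have h1 : circ t = susp ⟨![1], by simp [dotProduct]⟩ ⟨2 * t, by linarith [t.2.1], by linarith⟩ := by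
        refine Subtype.ext (funext fun i => ?_)
        fin_cases i <;> simp [circ, susp] <;> ring_nf
      rw [h1, hΨs]
      refine congrArg f ?_
      simp only [cons_val_fin_one]
      rw [show (1 / 2 - 1 * (1 / 2 - 2 * (t : ℝ) / 2)) = t by ring]
      exact Set.projIcc_val zero_le_one t
    · have h1 : circ t = susp ⟨![-1], by simp [dotProduct]⟩
          ⟨2 - 2 * t, by linarith [t.2.2], by linarith⟩ := by
        refine Subtype.ext (funext fun i => ?_)
        fin_cases i
        · simp [circ, susp]
          rw [← Real.cos_two_pi_sub]; ring_nf
        · simp [circ, susp]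
          rw [← neg_inj, neg_neg, ← Real.sin_two_pi_sub]; ring_nf
      rw [h1, hΨs]
      refine congrArg f ?_
      simp only [cons_val_fin_one]
      rw [show (1 / 2 - -1 * (1 / 2 - (2 - 2 * (t : ℝ)) / 2)) = t by ring]
      exact Set.projIcc_val zero_le_one t

/-- `τ` behaves like a representation of the rotation group, precomposed with the double cover. -/
structure QuatRep (τ : Quaternion ℝ → Matrix (Fin 5) (Fin 5) ℝ) : Prop where
  cont : ContinuousOn τ {q | q ≠ 0}
  mul : ∀ p q, p ≠ 0 → q ≠ 0 → τ (p * q) = τ p * τ q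
  mem : ∀ q, q ≠ 0 → τ q ∈ SOSet 5
  real : ∀ r : ℝ, r ≠ 0 → τ r = 1

lemma QuatRep.continuous_comp {τ : Quaternion ℝ → Matrix (Fin 5) (Fin 5) ℝ} (hτ : QuatRep τ)
    {X : Type*} [TopologicalSpace X] {q : X → Quaternion ℝ} (hq : Continuous q)
    (h0 : ∀ x, q x ≠ 0) : Continuous fun x => τ (q x) :=
  hτ.cont.comp_continuous hq h0

lemma QuatRep.neg {τ : Quaternion ℝ → Matrix (Fin 5) (Fin 5) ℝ} (hτ : QuatRep τ)
    {q : Quaternion ℝ} (hq : q ≠ 0) : τ (-q) = τ q := by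
  have h : -q = ((-1 : ℝ) : Quaternion ℝ) * q := by
    rw [Quaternion.coe_mul_eq_smul, neg_one_smul]
  rw [h, hτ.mul _ _ (by simp) hq, hτ.real _ (by norm_num), Matrix.one_mul]

lemma QuatRep.star_eq {τ : Quaternion ℝ → Matrix (Fin 5) (Fin 5) ℝ} (hτ : QuatRep τ)
    {q : Quaternion ℝ} (hq : Quaternion.normSq q = 1) : τ (star q) = (τ q)ᵀ := by
  have hq0 := ne_zero_of_normSq hq
  have h := hτ.mul q (star q) hq0 (star_ne_zero.2 hq0)
  rw [mul_star_self_of_normSq hq] at h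
  have h1 := hτ.real 1 one_ne_zero
  rw [Quaternion.coe_one, h] at h1
  calc τ (star q) = (τ q)ᵀ * (τ q * τ (star q)) := by
        rw [← Matrix.mul_assoc, transpose_mul_of_mem_SOSet (hτ.mem q hq0), Matrix.one_mul]
    _ = (τ q)ᵀ := by rw [h1, Matrix.mul_one]

lemma QuatRep.loop_homotopic {τ : Quaternion ℝ → Matrix (Fin 5) (Fin 5) ℝ} (hτ : QuatRep τ)
    {h : Sph 4 → Quaternion ℝ} (hh : Continuous h) (hh1 : ∀ x, Quaternion.normSq (h x) = 1)
    {u : Fin 3 → ℝ} (hu : u ⬝ᵥ u = 1) (k : C(Sph 4 × I, Matrix (Fin 5) (Fin 5) ℝ))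
    (hk : ∀ p, k p = τ (h p.1 * expQuat u (Real.pi * p.2) * star (h p.1))) :
    k.HomotopicWith (ContinuousMap.const _ 1) (Adm sameEnd (SOSet 5)) := by
  have hh0 := fun x => ne_zero_of_normSq (hh1 x)
  have he0 := fun a => ne_zero_of_normSq (normSq_expQuat hu a)
  have h1 : τ 1 = 1 := by simpa using hτ.real 1 one_ne_zero
  have hτh : Continuous fun x => τ (h x) := hτ.continuous_comp hh hh0
  have hτ1 : Continuous fun p : Sph 4 × I => τ (h p.1) := hτh.comp continuous_fst
  have hconj : ∀ {A : Matrix (Fin 5) (Fin 5) ℝ} (x), A ∈ SOSet 5 →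
      τ (h x) * A * (τ (h x))ᵀ ∈ SOSet 5 := fun x hA =>
    mul_mem_SOSet (mul_mem_SOSet (hτ.mem _ (hh0 x)) hA) (transpose_mem_SOSet (hτ.mem _ (hh0 x)))
  obtain ⟨l, hl, hlr⟩ := exists_circle_descent (f := fun t : I => τ (expQuat u (Real.pi * t)))
    (hτ.continuous_comp ((continuous_expQuat u).comp (by fun_prop)) fun t => he0 _) (by
      simp only [Set.Icc.coe_zero, mul_zero, expQuat_zero, Set.Icc.coe_one, mul_one, expQuat_pi]
      rw [hτ.neg one_ne_zero])
  have hlb : BasedLoop l := by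
    refine ⟨fun v => ?_, ?_⟩
    · obtain ⟨t, ht⟩ := hlr v
      rw [ht]
      exact hτ.mem _ (he0 _)
    · rw [← circ_zero, hl]
      simp only [Set.Icc.coe_zero, mul_zero, expQuat_zero, h1]
  obtain ⟨l', ⟨M⟩, hlb', hfix⟩ := exists_planar_loop l hlb
  have hMb : ∀ s v, M (s, v) ∈ SOSet 5 := fun s v => (M.prop' s).1 v
  have hMn : ∀ s, M (s, north 1) = 1 := fun s => (M.prop' s).2
  let e₀ : Fin 5 → ℝ := Pi.single 0 1
  let e₁ : Fin 5 → ℝ := Pi.single 1 1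
  let c : I → ℝ := fun t => l' (circ t) 0 0
  let s : I → ℝ := fun t => l' (circ t) 1 0
  have hl'c : Continuous fun t => l' (circ t) := l'.continuous.comp continuous_circ
  have hc : Continuous c := hl'c.matrix_elem 0 0
  have hs : Continuous s := hl'c.matrix_elem 1 0
  have hplane := fun v => exists_eq_planeRot (hlb'.1 v) (hfix v)
  have hcs : ∀ t, c t ^ 2 + s t ^ 2 = 1 := fun t => (hplane (circ t)).2
  have hend : ∀ t : I, t = 0 ∨ t = 1 → circ t = north 1 := by
    rintro t (rfl | rfl)
    · exact circ_zero
    · exact circ_one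
  have hce : ∀ t : I, t = 0 ∨ t = 1 → c t = 1 ∧ s t = 0 := fun t ht => by
    simp only [c, s, hend t ht, hlb'.2]
    simp
  have hends : ∀ {p q : Sph 4 × I}, sameEnd p q → (p.2 = 0 ∨ p.2 = 1) ∧ (q.2 = 0 ∨ q.2 = 1) := by
    rintro p q (⟨h, h'⟩ | ⟨h, h'⟩)
    · exact ⟨Or.inl h, Or.inl h'⟩
    · exact ⟨Or.inr h, Or.inr h'⟩
  let y : Sph 4 → Sph 4 := fun x => ⟨quatVec (h x), (quatVec_dotProduct_self _).trans (hh1 x)⟩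
  have hy : Continuous y := (continuous_quatVec.comp hh).subtype_mk _
  have hvq : ∀ x : Sph 4, vecQuat x.1 ≠ 0 := fun x => vecQuat_ne_zero fun h => by
    have := x.2
    rw [h] at this
    simp at this
  have hτv : Continuous fun x : Sph 4 => τ (vecQuat x.1) :=
    hτ.continuous_comp (continuous_vecQuat.comp continuous_subtype_val) hvq
  have hτe : ∀ x : Sph 4, τ (vecQuat (antipode x).1) = τ (vecQuat x.1) := fun x => by
    rw [← hτ.neg (hvq x), ← map_neg]; rfl
  have hdot := fun x => mulVec_dotProduct_mulVec_of_mem_SOSet (hτ.mem _ (hvq x))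
  obtain ⟨K, hK, hKO, hK0, hK1⟩ := frameNull_of_orthonormal (u := fun x => τ (vecQuat x.1) *ᵥ e₀)
    (w := fun x => τ (vecQuat x.1) *ᵥ e₁) (hτv.matrix_mulVec continuous_const)
    (hτv.matrix_mulVec continuous_const)
    (fun x => ⟨(hdot ..).trans (by simp [e₀]), (hdot ..).trans (by simp [e₁]),
      (hdot ..).trans (by simp [e₀, e₁])⟩) (fun x => by rw [hτe]) (fun x => by rw [hτe])
  have hrot : ∀ {X : Type} [TopologicalSpace X] {a b : X → ℝ} {f : X → (Fin 5 → ℝ) × (Fin 5 → ℝ)},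
      Continuous a → Continuous b → Continuous f →
      Continuous fun x => planeRot (a x) (b x) (f x).1 (f x).2 := by
    intro X _ a b f ha hb hf
    unfold planeRot
    have h1 := hf.fst
    have h2 := hf.snd
    exact (continuous_const.add ((ha.sub continuous_const).smul
      ((h1.matrix_vecMulVec h1).add (h2.matrix_vecMulVec h2)))).add
      (hb.smul ((h2.matrix_vecMulVec h1).sub (h1.matrix_vecMulVec h2)))
  have hpm : ∀ (t : I) {f : (Fin 5 → ℝ) × (Fin 5 → ℝ)}, f ∈ OrthPair →
      planeRot (c t) (s t) f.1 f.2 ∈ SOSet 5 := fun t f hf =>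
    planeRot_mem_SOSet (hcs t) hf.1 hf.2.1 hf.2.2
  have hpe : ∀ f : (Fin 5 → ℝ) × (Fin 5 → ℝ), planeRot 1 0 f.1 f.2 = 1 := fun f => by
    simp [planeRot]
  let k₁ : C(Sph 4 × I, Matrix (Fin 5) (Fin 5) ℝ) :=
    ⟨fun p => planeRot (c p.2) (s p.2) (K (y p.1) 0).1 (K (y p.1) 0).2,
      hrot (hc.comp continuous_snd) (hs.comp continuous_snd)
        (hK.comp ((hy.comp continuous_fst).prodMk continuous_const))⟩
  let k₂ : C(Sph 4 × I, Matrix (Fin 5) (Fin 5) ℝ) :=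
    ⟨fun p => planeRot (c p.2) (s p.2) (K (y p.1) 1).1 (K (y p.1) 1).2,
      hrot (hc.comp continuous_snd) (hs.comp continuous_snd)
        (hK.comp ((hy.comp continuous_fst).prodMk continuous_const))⟩
  have H₁ : k.HomotopicWith k₁ (Adm sameEnd (SOSet 5)) := by
    refine homotopicWith_adm_of_fun
      (fun p r => τ (h p.1) * M (r, circ p.2) * (τ (h p.1))ᵀ) ?_ (fun p => ?_) (fun p => ?_)
      (fun p r => hconj _ (hMb _ _)) (fun p q r hpq => ?_)
    · have h1 : Continuous fun z : (Sph 4 × I) × I => τ (h z.1.1) := hτ1.comp continuous_fst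
      have h2 : Continuous fun z : (Sph 4 × I) × I => M (z.2, circ z.1.2) :=
        M.continuous.comp (continuous_snd.prodMk
          (continuous_circ.comp (continuous_snd.comp continuous_fst)))
      exact (h1.matrix_mul h2).matrix_mul h1.matrix_transpose
    · rw [M.apply_zero, hl, hk, hτ.mul _ _ (mul_ne_zero (hh0 _) (he0 _)) (star_ne_zero.2 (hh0 _)),
        hτ.mul _ _ (hh0 _) (he0 _), hτ.star_eq (hh1 _)]
    · rw [M.apply_one, (hplane _).1, conj_planeRot (hτ.mem _ (hh0 _))]
      simp only [k₁, ContinuousMap.coe_mk, hK0, y, vecQuat_quatVec]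
      rfl
    · obtain ⟨hp, hq⟩ := hends hpq
      rw [hend _ hp, hend _ hq, hMn, Matrix.mul_one, Matrix.mul_one,
        (hτ.mem _ (hh0 _)).1, (hτ.mem _ (hh0 _)).1]
  have H₂ : k₁.HomotopicWith k₂ (Adm sameEnd (SOSet 5)) := by
    refine homotopicWith_adm_of_fun
      (fun p r => planeRot (c p.2) (s p.2) (K (y p.1) r).1 (K (y p.1) r).2) ?_ (fun p => rfl)
      (fun p => rfl) (fun p r => hpm _ (hKO _ _)) (fun p q r hpq => ?_)
    · exact hrot (hc.comp (continuous_snd.comp continuous_fst))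
        (hs.comp (continuous_snd.comp continuous_fst))
        (hK.comp ((hy.comp (continuous_fst.comp continuous_fst)).prodMk continuous_snd))
    · obtain ⟨hp, hq⟩ := hends hpq
      rw [(hce _ hp).1, (hce _ hp).2, (hce _ hq).1, (hce _ hq).2, hpe, hpe]
  have H₃ : k₂.HomotopicWith (ContinuousMap.const _ 1) (Adm sameEnd (SOSet 5)) := by
    refine homotopicWith_adm_of_fun
      (fun p r => planeRot (c (p.2 * unitInterval.symm r)) (s (p.2 * unitInterval.symm r))
        (K (y p.1) 1).1 (K (y p.1) 1).2) ?_ (fun p => ?_)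
      (fun p => ?_) (fun p r => hpm _ (hKO _ _)) (fun p q r hpq => ?_)
    · have h1 : Continuous fun z : (Sph 4 × I) × I => z.1.2 * unitInterval.symm z.2 :=
        (continuous_snd.comp continuous_fst).mul (unitInterval.continuous_symm.comp continuous_snd)
      exact hrot (hc.comp h1) (hs.comp h1)
        (hK.comp ((hy.comp (continuous_fst.comp continuous_fst)).prodMk continuous_const))
    · rw [unitInterval.symm_zero, mul_one]; rfl
    · rw [unitInterval.symm_one, mul_zero, (hce 0 (Or.inl rfl)).1, (hce 0 (Or.inl rfl)).2, hpe]; rfl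
    · have h2 : p.2 = q.2 := by rcases hpq with ⟨h, h'⟩ | ⟨h, h'⟩ <;> rw [h, h']
      rw [h2, hK1 (y p.1) (y q.1)]
  exact (H₁.trans H₂).trans H₃

/-- A map from `S⁴` to the rotations of `ℝ⁵` which lifts to the unit quaternions is
null-homotopic. -/
theorem QuatRep.null_homotopic {τ : Quaternion ℝ → Matrix (Fin 5) (Fin 5) ℝ} (hτ : QuatRep τ)
    {F : Sph 5 → Quaternion ℝ} (hF : Continuous F) (hF1 : ∀ x, Quaternion.normSq (F x) = 1) :
    ∃ K : Sph 5 → I → Matrix (Fin 5) (Fin 5) ℝ, (Continuous fun p : Sph 5 × I => K p.1 p.2) ∧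
      (∀ x t, K x t ∈ SOSet 5) ∧ (∀ x, K x 0 = τ (F x)) ∧ ∀ x, K x 1 = 1 := by
  obtain ⟨g, hg1, hg⟩ := exists_homotopicWith_suspMap
    ⟨fun x => quatVec (F x), continuous_quatVec.comp hF⟩
    (fun x => (quatVec_dotProduct_self _).trans (hF1 x))
  obtain ⟨h, hh, hh1, hhg⟩ := exists_hopf_lift g g.continuous hg1
  have hexp : ∀ p : Sph 4 × I, vecQuat (suspMap g p) =
      h p.1 * expQuat (g (north 3)) (Real.pi * p.2) * star (h p.1) := by
    intro p
    have h1 : vecQuat (suspMap g p) = expQuat (g p.1) (Real.pi * p.2) := by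
      ext <;> simp [vecQuat_apply, suspMap, expQuat, imQuat_apply]
      all_goals rfl
    have h2 : expQuat (g p.1) (Real.pi * p.2) * h p.1
        = h p.1 * expQuat (g (north 3)) (Real.pi * p.2) := by
      rw [expQuat, expQuat, add_mul, mul_add, smul_mul_assoc, mul_smul_comm, hhg,
        Quaternion.coe_commutes]
    rw [h1, ← h2, mul_assoc, mul_star_self_of_normSq (hh1 _), mul_one]
  have hcont : ContinuousOn (fun v => τ (vecQuat v)) {v | v ≠ 0} :=
    hτ.cont.comp continuous_vecQuat.continuousOn fun v hv => vecQuat_ne_zero hv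
  have hne : ∀ p, suspMap g p ≠ 0 := fun p h0 => by
    have h1 := hexp p
    rw [h0, map_zero] at h1
    refine mul_ne_zero (mul_ne_zero (ne_zero_of_normSq (hh1 p.1))
      (ne_zero_of_normSq (normSq_expQuat (hg1 _) _)))
      (star_ne_zero.2 (ne_zero_of_normSq (hh1 p.1))) h1.symm
  let k : C(Sph 4 × I, Matrix (Fin 5) (Fin 5) ℝ) := ⟨fun p => τ (vecQuat (suspMap g p)),
    hcont.comp_continuous (suspMap g).continuous hne⟩
  let f : C(Sph 4 × I, Matrix (Fin 5) (Fin 5) ℝ) := ⟨fun p => τ (F (susp p.1 p.2)),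
    hτ.continuous_comp (hF.comp continuous_susp) fun _ => ne_zero_of_normSq (hF1 _)⟩
  have hfk : f.HomotopicWith k (Adm sameEnd (SOSet 5)) := homotopicWith_comp hg hcont
    (fun v hv => hτ.mem _ (vecQuat_ne_zero hv)) (fun p => by simp [f, vecQuat_quatVec])
    (fun p => rfl)
  obtain ⟨H, hH, hH0, hH1, hHS, hHe⟩ := exists_fun_of_homotopicWith (hfk.trans
    (hτ.loop_homotopic hh hh1 (hg1 (north 3)) k fun p => congrArg τ (hexp p)))
  have hHc : Continuous fun p : Sph 4 × I × I => H (p.1, p.2.1) p.2.2 :=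
    hH.comp (by fun_prop : Continuous fun p : Sph 4 × I × I => ((p.1, p.2.1), p.2.2))
  obtain ⟨Ψ, hΨ, hΨs⟩ := exists_descent (n := 4) inferInstance (Z := I)
    (fun v t z => H (v, t) z) hHc (fun v v' => hHe _ _ (Or.inl ⟨rfl, rfl⟩))
    (fun v v' => hHe _ _ (Or.inr ⟨rfl, rfl⟩))
  · refine ⟨Ψ, hΨ, fun x t => ?_, fun x => ?_, fun x => ?_⟩ <;>
      obtain ⟨v, t, rfl⟩ := susp_surjective inferInstance x <;> rw [hΨs]
    · exact hHS _ _
    · exact hH0 _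
    · exact hH1 _

lemma exists_expQuat {q : Quaternion ℝ} (hq : Quaternion.normSq q = 1) :
    ∃ (u : Fin 3 → ℝ) (a : ℝ), u ⬝ᵥ u = 1 ∧ q = expQuat u a := by
  obtain ⟨v, hv⟩ := exists_polar (n := 3) ⟨quatVec q, (quatVec_dotProduct_self q).trans hq⟩
    inferInstance
  refine ⟨v.1, Real.arccos (quatVec q 0), v.2, ?_⟩
  simp only at hv
  refine (vecQuat_quatVec q).symm.trans ?_
  generalize Real.arccos (quatVec q 0) = t at hv
  rw [hv]
  ext <;> simp [vecQuat_apply, expQuat, imQuat_apply, Fin.cons]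
  all_goals rfl

lemma imQuat_mul_anticomm {v w : Fin 3 → ℝ} (h : v ⬝ᵥ w = 0) :
    imQuat v * imQuat w = -(imQuat w * imQuat v) := by
  have h1 := imQuat_mul_self (v + w)
  rw [dotProduct_add, add_dotProduct, add_dotProduct, h, dotProduct_comm w v, h, map_add, add_mul,
    mul_add, mul_add, imQuat_mul_self, imQuat_mul_self] at h1
  rw [eq_neg_iff_add_eq_zero]
  have h2 : imQuat v * imQuat w + imQuat w * imQuat v =
      ((-1 : ℝ) * (v ⬝ᵥ v + 0 + (0 + w ⬝ᵥ w))) • (1 : Quaternion ℝ) - ((-1 : ℝ) * v ⬝ᵥ v) • 1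
        - ((-1 : ℝ) * w ⬝ᵥ w) • 1 := by
    rw [← h1]; abel
  rw [h2, ← sub_smul, ← sub_smul]
  ring_nf
  rw [zero_smul]

lemma exists_orthogonal_vec (u v : Fin 3 → ℝ) :
    ∃ w : Fin 3 → ℝ, w ⬝ᵥ w = 1 ∧ w ⬝ᵥ u = 0 ∧ w ⬝ᵥ v = 0 := by
  have h := LinearMap.ker_ne_bot_of_finrank_lt (f := Matrix.mulVecLin !![u 0, u 1, u 2; v 0, v 1, v 2])
    (by simp)
  obtain ⟨w, hw, hw0⟩ := (Submodule.ne_bot_iff _).1 h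
  have hpos : 0 < w ⬝ᵥ w := dotProduct_self_pos_iff.2 hw0
  have hs := Real.mul_self_sqrt hpos.le
  have hs0 : √(w ⬝ᵥ w) ≠ 0 := (Real.sqrt_pos.2 hpos).ne'
  rw [LinearMap.mem_ker, mulVecLin_apply] at hw
  have h0 := congrFun hw 0
  have h1 := congrFun hw 1
  simp [mulVec, dotProduct, Fin.sum_univ_three] at h0 h1
  refine ⟨(√(w ⬝ᵥ w))⁻¹ • w, ?_, ?_, ?_⟩
  · rw [smul_dotProduct, dotProduct_smul, smul_eq_mul, smul_eq_mul]
    field_simp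
    rw [sq, hs]
  · rw [smul_dotProduct]
    simp only [dotProduct, Fin.sum_univ_three, smul_eq_mul]
    rw [mul_eq_zero]; right; linarith
  · rw [smul_dotProduct]
    simp only [dotProduct, Fin.sum_univ_three, smul_eq_mul]
    rw [mul_eq_zero]; right; linarith

lemma exists_quat_conj {u v w : Fin 3 → ℝ} (h : u ⬝ᵥ u = v ⬝ᵥ v) (hw : w ⬝ᵥ w = 1)
    (hu : w ⬝ᵥ u = 0) (hv : w ⬝ᵥ v = 0) :
    ∃ p : Quaternion ℝ, p ≠ 0 ∧ p * imQuat u = imQuat v * p ∧ p * imQuat w = imQuat w * p := by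
  by_cases huv : v = -u
  · refine ⟨imQuat w, ne_zero_of_normSq ((normSq_imQuat w).trans hw), ?_, rfl⟩
    rw [imQuat_mul_anticomm hu, huv, map_neg, neg_mul]
  have hu0 : u ⬝ᵥ u ≠ 0 := by
    intro h0
    rw [h0] at h
    rw [dotProduct_self_eq_zero.1 h0, dotProduct_self_eq_zero.1 h.symm] at huv
    simp at huv
  have h1 : (imQuat v * imQuat u) * imQuat u = -((u ⬝ᵥ u) • imQuat v) := by
    rw [mul_assoc, imQuat_mul_self, mul_smul_comm, mul_one, neg_one_mul, neg_smul]
  have h2 : imQuat v * (imQuat v * imQuat u) = -((u ⬝ᵥ u) • imQuat u) := by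
    rw [← mul_assoc, imQuat_mul_self, smul_mul_assoc, one_mul, neg_one_mul, neg_smul, h]
  refine ⟨(u ⬝ᵥ u) • 1 - imQuat v * imQuat u, fun h0 => huv ?_, ?_, ?_⟩
  · have h3 := congrArg (· * imQuat u) h0
    simp only [sub_mul, h1, zero_mul, smul_mul_assoc, one_mul, sub_neg_eq_add, ← smul_add] at h3
    rw [smul_eq_zero, or_iff_right hu0, ← map_add] at h3
    rw [eq_neg_iff_add_eq_zero, add_comm]
    exact imQuat_injective (h3.trans (map_zero _).symm)
  · rw [sub_mul, mul_sub, h1, h2, smul_mul_assoc, mul_smul_comm, one_mul, mul_one]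
    abel
  · rw [sub_mul, mul_sub, smul_mul_assoc, mul_smul_comm, one_mul, mul_one, mul_assoc,
      ← neg_eq_iff_eq_neg.2 (imQuat_mul_anticomm hu), mul_neg, ← mul_assoc,
      ← neg_eq_iff_eq_neg.2 (imQuat_mul_anticomm hv), neg_mul, neg_neg, mul_assoc]

lemma eq_one_of_mulVec_single {A : Matrix (Fin 3) (Fin 3) ℝ} (hA : A ∈ SOSet 3)
    (h0 : A *ᵥ Pi.single 0 1 = Pi.single 0 1) (h1 : A *ᵥ Pi.single 1 1 = Pi.single 1 1) : A = 1 := by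
  have h2 := transpose_mul_of_mem_SOSet hA
  have h3 := hA.2
  have a0 : ∀ i, A i 0 = (Pi.single 0 1 : Fin 3 → ℝ) i := fun i => by rw [← h0]; simp
  have a1 : ∀ i, A i 1 = (Pi.single 1 1 : Fin 3 → ℝ) i := fun i => by rw [← h1]; simp
  have b0 := congrFun (congrFun h2 0) 2
  have b1 := congrFun (congrFun h2 1) 2
  simp [Matrix.mul_apply, Fin.sum_univ_three, a0, a1] at b0 b1
  rw [det_fin_three] at h3
  simp [a0, a1, b0, b1] at h3
  ext i j
  fin_cases i <;> fin_cases j <;> simp [a0, a1, b0, b1, h3]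

lemma exists_adMat_eq {A : Matrix (Fin 3) (Fin 3) ℝ} (hA : A ∈ SOSet 3) :
    ∃ q : Quaternion ℝ, q ≠ 0 ∧ adMat q = A := by
  have hdot := fun {B} (hB : B ∈ SOSet 3) => mulVec_dotProduct_mulVec_of_mem_SOSet hB
  let e₀ : Fin 3 → ℝ := Pi.single 0 1
  let e₁ : Fin 3 → ℝ := Pi.single 1 1
  obtain ⟨w, hw, hw0, hw1⟩ := exists_orthogonal_vec e₀ (A *ᵥ e₀)
  obtain ⟨p, hp0, hp, -⟩ := exists_quat_conj (hdot hA e₀ e₀).symm hw hw0 hw1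
  have hpO := adMat_mem_SOSet hp0
  have hB : (adMat p)ᵀ * A ∈ SOSet 3 := mul_mem_SOSet (transpose_mem_SOSet hpO) hA
  have hB0 : ((adMat p)ᵀ * A) *ᵥ e₀ = e₀ := by
    rw [← mulVec_mulVec, ← adMat_mulVec_eq hp0 hp, mulVec_mulVec, transpose_mul_of_mem_SOSet hpO,
      one_mulVec]
  obtain ⟨q, hq0, hq, hqe⟩ := exists_quat_conj (u := e₁) (w := e₀) (hdot hB e₁ e₁).symm
    (by simp [e₀]) (by simp [e₀, e₁]) (by
      have := hdot hB e₀ e₁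
      rw [hB0] at this
      rw [this]; simp [e₀, e₁])
  have hqO := adMat_mem_SOSet hq0
  have hC : (adMat q)ᵀ * ((adMat p)ᵀ * A) = 1 := by
    refine eq_one_of_mulVec_single (mul_mem_SOSet (transpose_mem_SOSet hqO) hB) ?_ ?_
    · rw [← mulVec_mulVec]
      refine (congrArg _ (hB0.trans (adMat_mulVec_eq hq0 hqe).symm)).trans ?_
      rw [mulVec_mulVec, transpose_mul_of_mem_SOSet hqO, one_mulVec]
    · rw [← mulVec_mulVec]
      refine (congrArg _ (adMat_mulVec_eq hq0 hq).symm).trans ?_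
      rw [mulVec_mulVec, transpose_mul_of_mem_SOSet hqO, one_mulVec]
  refine ⟨p * q, mul_ne_zero hp0 hq0, ?_⟩
  rw [adMat_mul hp0 hq0]
  calc adMat p * adMat q = adMat p * (adMat q * ((adMat q)ᵀ * ((adMat p)ᵀ * A))) := by
        rw [hC, Matrix.mul_one]
    _ = A := by
        rw [← Matrix.mul_assoc (adMat q), hqO.1, Matrix.one_mul, ← Matrix.mul_assoc, hpO.1,
          Matrix.one_mul]

lemma exists_smul_unitQuat {q : Quaternion ℝ} (hq : q ≠ 0) :
    ∃ (r : ℝ) (p : Quaternion ℝ), r ≠ 0 ∧ Quaternion.normSq p = 1 ∧ q = (r : Quaternion ℝ) * p := by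
  have hpos : 0 < Quaternion.normSq q := by
    rw [Quaternion.normSq_eq_norm_mul_self]
    exact mul_self_pos.2 (norm_ne_zero_iff.2 hq)
  have h0 : √(Quaternion.normSq q) ≠ 0 := (Real.sqrt_pos.2 hpos).ne'
  refine ⟨√(Quaternion.normSq q), (√(Quaternion.normSq q))⁻¹ • q, h0, ?_, ?_⟩
  · rw [Quaternion.normSq_smul, inv_pow, Real.sq_sqrt hpos.le, inv_mul_cancel₀ hpos.ne']
  · rw [Quaternion.coe_mul_eq_smul, smul_smul, mul_inv_cancel₀ h0, one_smul]

lemma QuatRep.eq_one_of_conj {τ : Quaternion ℝ → Matrix (Fin 5) (Fin 5) ℝ} (hτ : QuatRep τ)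
    {p q q' : Quaternion ℝ} (hp : p ≠ 0) (hq : q ≠ 0) (hq' : q' ≠ 0) (h : p * q = q' * p)
    (h1 : τ q = 1) : τ q' = 1 := by
  have h2 := congrArg τ h
  rw [hτ.mul _ _ hp hq, hτ.mul _ _ hq' hp, h1, Matrix.mul_one] at h2
  have h3 := (hτ.mem p hp).1
  calc τ q' = τ q' * τ p * (τ p)ᵀ := by rw [Matrix.mul_assoc, h3, Matrix.mul_one]
    _ = 1 := by rw [← h2, h3]

/-- A representation whose kernel contains a non-real quaternion is trivial. -/
theorem QuatRep.trivial {τ : Quaternion ℝ → Matrix (Fin 5) (Fin 5) ℝ} (hτ : QuatRep τ)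
    {c : ℝ} {m : Fin 3 → ℝ} (hm : m ≠ 0) (hcm : c ^ 2 + m ⬝ᵥ m = 1)
    (h1 : τ (c + imQuat m) = 1) {q : Quaternion ℝ} (hq : q ≠ 0) : τ q = 1 := by
  have hr : 0 < m ⬝ᵥ m := dotProduct_self_pos_iff.2 hm
  have hNS : ∀ (c : ℝ) (m : Fin 3 → ℝ), Quaternion.normSq ((c : Quaternion ℝ) + imQuat m)
      = c ^ 2 + m ⬝ᵥ m := fun c m => by
    simp [Quaternion.normSq_def', imQuat_apply, dotProduct, Fin.sum_univ_three]; ring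
  have hnorm : ∀ (c : ℝ) (m : Fin 3 → ℝ), c ^ 2 + m ⬝ᵥ m = 1 →
      (c : Quaternion ℝ) + imQuat m ≠ 0 :=
    fun c m h => ne_zero_of_normSq ((hNS c m).trans h)
  have hconj : ∀ (c : ℝ) (m m' : Fin 3 → ℝ), c ^ 2 + m ⬝ᵥ m = 1 → m ⬝ᵥ m = m' ⬝ᵥ m' →
      τ (c + imQuat m) = 1 → τ (c + imQuat m') = 1 := by
    intro c m m' hc hmm h
    obtain ⟨w, hw, hw0, hw1⟩ := exists_orthogonal_vec m m'
    obtain ⟨p, hp0, hp, -⟩ := exists_quat_conj hmm hw hw0 hw1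
    refine hτ.eq_one_of_conj hp0 (hnorm c m hc) (hnorm c m' (hmm ▸ hc)) ?_ h
    rw [mul_add, add_mul, hp, Quaternion.coe_commutes]
  have hcos : ∀ (u : Fin 3 → ℝ) (b : ℝ), u ⬝ᵥ u = 1 → 1 - 2 * (m ⬝ᵥ m) ≤ Real.cos b →
      τ (expQuat u b) = 1 := by
    intro u b hu hb
    obtain ⟨w, hw, hwm, -⟩ := exists_orthogonal_vec m m
    set k := (Real.cos b - c ^ 2) / (m ⬝ᵥ m) with hk
    have hk1 : k ≤ 1 := by rw [hk, div_le_one hr]; linarith [Real.cos_le_one b]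
    have hk2 : -1 ≤ k := by rw [hk, le_div_iff₀ hr]; linarith
    have hkr : k * (m ⬝ᵥ m) = Real.cos b - c ^ 2 := div_mul_cancel₀ _ hr.ne'
    have hk3 : 0 ≤ (1 - k ^ 2) * (m ⬝ᵥ m) := mul_nonneg (by nlinarith) hr.le
    set l := √((1 - k ^ 2) * (m ⬝ᵥ m)) with hl
    have hll : l ^ 2 = (1 - k ^ 2) * (m ⬝ᵥ m) := Real.sq_sqrt hk3
    set m' := k • m + l • w with hm'
    have hmw : m ⬝ᵥ w = 0 := by rw [dotProduct_comm]; exact hwm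
    have hmm' : m ⬝ᵥ m = m' ⬝ᵥ m' := by
      simp only [hm', dotProduct_add, add_dotProduct, dotProduct_smul, smul_dotProduct, smul_eq_mul,
        hw, hwm, hmw]
      linear_combination -hll
    have hdot : m' ⬝ᵥ m = Real.cos b - c ^ 2 := by
      simp only [hm', add_dotProduct, smul_dotProduct, smul_eq_mul, hwm]
      linear_combination hkr
    have h2 := hconj c m (-m') hcm (by rw [neg_dotProduct, dotProduct_neg, neg_neg, hmm']) h1
    have hc' : c ^ 2 + (-m') ⬝ᵥ (-m') = 1 := by
      rw [neg_dotProduct, dotProduct_neg, neg_neg, ← hmm', hcm]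
    have h3 := hτ.mul _ _ (hnorm c m hcm) (hnorm c _ hc')
    rw [h1, h2, Matrix.one_mul] at h3
    obtain ⟨n, hn⟩ : ∃ n : Fin 3 → ℝ, ((c : Quaternion ℝ) + imQuat m) * (c + imQuat (-m'))
        = (Real.cos b : ℝ) + imQuat n := by
      refine ⟨fun i => quatVec (((c : Quaternion ℝ) + imQuat m) * (c + imQuat (-m'))) i.succ, ?_⟩
      rw [dotProduct_comm] at hdot
      simp only [dotProduct, Fin.sum_univ_three] at hdot
      ext
      · simp [imQuat_apply]; linear_combination hdot
      · simp [imQuat_apply, quatVec]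
      · simp [imQuat_apply, quatVec]
      · simp [imQuat_apply, quatVec]
    have h4 := congrArg Quaternion.normSq hn
    rw [map_mul, hNS, hNS, hNS, hcm, hc', mul_one] at h4
    rw [hn] at h3
    have h5 := hconj _ n (Real.sin b • u) h4.symm (by
      simp only [smul_dotProduct, dotProduct_smul, hu, smul_eq_mul]
      linear_combination h4.symm - Real.sin_sq_add_cos_sq b) h3
    rw [map_smul] at h5
    exact h5
  have hunit : ∀ p, Quaternion.normSq p = 1 → τ p = 1 := by
    intro p hp
    obtain ⟨u, a, hu, rfl⟩ := exists_expQuat hp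
    obtain ⟨n, hn⟩ := exists_nat_gt (a ^ 2 / (4 * (m ⬝ᵥ m)))
    have hn0 : (0 : ℝ) < n := lt_of_le_of_lt (by positivity) hn
    have hn1 : (1 : ℝ) ≤ n := by exact_mod_cast hn0
    rw [div_lt_iff₀ (by positivity)] at hn
    have h2 : τ (expQuat u (a / n)) = 1 := by
      refine hcos u _ hu (le_trans ?_ (Real.one_sub_sq_div_two_le_cos (x := a / n)))
      have : (a / n) ^ 2 ≤ 4 * (m ⬝ᵥ m) := by
        rw [div_pow, div_le_iff₀ (by positivity)]
        nlinarith
      linarith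
    have h3 : ∀ k : ℕ, τ (expQuat u (k * (a / n))) = 1 := by
      intro k
      induction k with
      | zero => simpa [expQuat_zero] using hτ.real 1 one_ne_zero
      | succ k ih =>
        rw [Nat.cast_succ, add_mul, one_mul, expQuat_add hu, hτ.mul _ _
          (ne_zero_of_normSq (normSq_expQuat hu _)) (ne_zero_of_normSq (normSq_expQuat hu _)), ih,
          h2, Matrix.one_mul]
    have h4 := h3 n
    rwa [mul_div_cancel₀ _ hn0.ne'] at h4
  obtain ⟨r, p, hr0, hp, rfl⟩ := exists_smul_unitQuat hq
  have hr0' : (r : Quaternion ℝ) ≠ 0 := fun h => hr0 (Quaternion.coe_injective (h.trans Quaternion.coe_zero.symm))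
  rw [hτ.mul _ _ hr0' (ne_zero_of_normSq hp), hτ.real r hr0, hunit p hp, Matrix.one_mul]

instance compactSpace_SOSet (n : ℕ) : CompactSpace {A : Matrix (Fin n) (Fin n) ℝ // A ∈ SOSet n} := by
  have hc := (isCompact_univ_pi fun _ : Fin n => isCompact_univ_pi fun _ : Fin n =>
    isCompact_Icc (a := (-1 : ℝ)) (b := 1)).image (f := Matrix.of)
    (continuous_matrix fun i j => (continuous_apply_apply i j))
  have hcl : IsClosed (SOSet n) := by
    have h1 : Continuous fun A : Matrix (Fin n) (Fin n) ℝ => A * A.transpose :=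
      continuous_id.matrix_mul continuous_id.matrix_transpose
    have h2 : Continuous fun A : Matrix (Fin n) (Fin n) ℝ => A.det := continuous_id.matrix_det
    exact (isClosed_eq h1 continuous_const).inter (isClosed_eq h2 continuous_const)
  refine isCompact_iff_compactSpace.1 (hc.of_isClosed_subset hcl ?_)
  refine fun A hA => ⟨A, fun i _ j _ => abs_le.1 (abs_le_one_of_dotProduct (v := A i) ?_ j), rfl⟩
  have := congrFun (congrFun hA.1 i) i
  simpa [Matrix.mul_apply, dotProduct] using this

/-- The unit sphere of Euclidean space in coordinates. -/
noncomputable def sphHomeo (n : ℕ) :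
    Metric.sphere (0 : EuclideanSpace ℝ (Fin n)) 1 ≃ₜ Sph n where
  toFun x := ⟨fun i => x.1 i, by
    have h : ‖x.1‖ = 1 := by simp
    have h1 := EuclideanSpace.norm_sq_eq x.1
    rw [h] at h1
    simp [dotProduct, ← sq] at h1 ⊢
    exact h1.symm⟩
  invFun v := ⟨WithLp.toLp 2 v.1, by
    have h := v.2
    simp only [dotProduct, ← sq] at h
    rw [mem_sphere_zero_iff_norm, EuclideanSpace.norm_eq]
    simp [h]⟩
  left_inv x := rfl
  right_inv v := rfl
  continuous_toFun := by
    refine Continuous.subtype_mk (continuous_pi fun i => ?_) _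
    exact (PiLp.continuous_apply 2 _ i).comp continuous_subtype_val
  continuous_invFun := by
    refine Continuous.subtype_mk ?_ _
    exact (PiLp.continuous_toLp 2 _).comp continuous_subtype_val

section Representation

variable {ρ : {A : Matrix (Fin 3) (Fin 3) ℝ // A ∈ SOSet 3} →
      {A : Matrix (Fin 5) (Fin 5) ℝ // A ∈ SOSet 5}}

open Classical in
/-- The pullback of a map on the rotation group to the nonzero quaternions. -/
noncomputable def quatPullback (ρ : {A : Matrix (Fin 3) (Fin 3) ℝ // A ∈ SOSet 3} →
    {A : Matrix (Fin 5) (Fin 5) ℝ // A ∈ SOSet 5}) (q : Quaternion ℝ) :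
    Matrix (Fin 5) (Fin 5) ℝ :=
  if h : q ≠ 0 then ρ ⟨adMat q, adMat_mem_SOSet h⟩ else 1

lemma quatPullback_apply {q : Quaternion ℝ} (h : q ≠ 0) :
    quatPullback ρ q = ρ ⟨adMat q, adMat_mem_SOSet h⟩ := dif_pos h

lemma map_one_of_hom (hρhom : ∀ A B C : {A : Matrix (Fin 3) (Fin 3) ℝ // A ∈ SOSet 3},
      (A : Matrix (Fin 3) (Fin 3) ℝ) * B = C →
      (ρ A : Matrix (Fin 5) (Fin 5) ℝ) * (ρ B) = (ρ C)) :
    (ρ ⟨1, one_mem_SOSet⟩ : Matrix (Fin 5) (Fin 5) ℝ) = 1 := by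
  have h := hρhom ⟨1, one_mem_SOSet⟩ ⟨1, one_mem_SOSet⟩ ⟨1, one_mem_SOSet⟩ (Matrix.one_mul _)
  have h1 := transpose_mul_of_mem_SOSet (ρ ⟨1, one_mem_SOSet⟩).2
  rw [← Matrix.one_mul (ρ ⟨1, one_mem_SOSet⟩).1, ← h1, Matrix.mul_assoc, h]

lemma quatRep_quatPullback (hρcont : Continuous ρ)
    (hρhom : ∀ A B C : {A : Matrix (Fin 3) (Fin 3) ℝ // A ∈ SOSet 3},
      (A : Matrix (Fin 3) (Fin 3) ℝ) * B = C →
      (ρ A : Matrix (Fin 5) (Fin 5) ℝ) * (ρ B) = (ρ C)) : QuatRep (quatPullback ρ) where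
  cont := by
    rw [continuousOn_iff_continuous_domRestrict]
    have h : Continuous fun q : {q : Quaternion ℝ | q ≠ 0} =>
        (ρ ⟨adMat q.1, adMat_mem_SOSet q.2⟩).1 :=
      continuous_subtype_val.comp (hρcont.comp
        ((continuousOn_iff_continuous_domRestrict.1 continuousOn_adMat).subtype_mk _))
    exact h.congr fun q => (quatPullback_apply q.2).symm
  mul p q hp hq := by
    rw [quatPullback_apply hp, quatPullback_apply hq, quatPullback_apply (mul_ne_zero hp hq)]
    exact (hρhom _ _ _ (adMat_mul hp hq).symm).symm
  mem q hq := by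
    rw [quatPullback_apply hq]
    exact (ρ _).2
  real r hr := by
    have hr' : (r : Quaternion ℝ) ≠ 0 :=
      fun h => hr (Quaternion.coe_injective (h.trans Quaternion.coe_zero.symm))
    rw [quatPullback_apply hr', ← map_one_of_hom hρhom]
    congr 2
    exact Subtype.ext (adMat_coe hr)

theorem exists_null_homotopy (hρcont : Continuous ρ)
    (hρhom : ∀ A B C : {A : Matrix (Fin 3) (Fin 3) ℝ // A ∈ SOSet 3},
      (A : Matrix (Fin 3) (Fin 3) ℝ) * B = C →
      (ρ A : Matrix (Fin 5) (Fin 5) ℝ) * (ρ B) = (ρ C))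
    {f : Sph 5 → {A : Matrix (Fin 3) (Fin 3) ℝ // A ∈ SOSet 3}} (hf : Continuous f) :
    ∃ (c : {A : Matrix (Fin 5) (Fin 5) ℝ // A ∈ SOSet 5}) (K : Sph 5 → I →
      {A : Matrix (Fin 5) (Fin 5) ℝ // A ∈ SOSet 5}), (Continuous fun p : Sph 5 × I => K p.1 p.2) ∧
      (∀ x, K x 0 = ρ (f x)) ∧ ∀ x, K x 1 = c := by
  obtain ⟨F, A, hF, hA, hF1, hfA⟩ := exists_quaternion_lift (fun x => (f x).1)
    (continuous_subtype_val.comp hf) fun x => (f x).2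
  obtain ⟨K, hK, hKS, hK0, hK1⟩ := (quatRep_quatPullback hρcont hρhom).null_homotopic hF hF1
  refine ⟨ρ ⟨A, hA⟩, fun x t => ⟨K x t * (ρ ⟨A, hA⟩).1, mul_mem_SOSet (hKS x t) (ρ _).2⟩,
    (hK.matrix_mul continuous_const).subtype_mk _, fun x => Subtype.ext ?_, fun x => Subtype.ext ?_⟩
  · simp only
    rw [hK0, quatPullback_apply (ne_zero_of_normSq (hF1 x))]
    exact hρhom _ _ _ (hfA x).symm
  · simp only
    rw [hK1, Matrix.one_mul]

theorem injective_of_irreducible (hρcont : Continuous ρ)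
    (hρhom : ∀ A B C : {A : Matrix (Fin 3) (Fin 3) ℝ // A ∈ SOSet 3},
      (A : Matrix (Fin 3) (Fin 3) ℝ) * B = C →
      (ρ A : Matrix (Fin 5) (Fin 5) ℝ) * (ρ B) = (ρ C))
    (hρirr : ∀ W : Submodule ℝ (Fin 5 → ℝ),
      (∀ A : {A : Matrix (Fin 3) (Fin 3) ℝ // A ∈ SOSet 3},
        W.map (Matrix.mulVecLin (ρ A : Matrix (Fin 5) (Fin 5) ℝ)) ≤ W) →
      W = ⊥ ∨ W = ⊤) : Function.Injective ρ := by
  have hnt : ∃ A, (ρ A).1 ≠ 1 := by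
    by_contra! h
    rcases hρirr (Submodule.span ℝ {Pi.single 0 1}) (fun A => by rw [h A]; simp) with h | h
    · rw [Submodule.span_singleton_eq_bot] at h
      have := congrFun h 0
      simp at this
    · have h1 : (Pi.single 1 1 : Fin 5 → ℝ) ∈ Submodule.span ℝ {(Pi.single 0 1 : Fin 5 → ℝ)} := by
        rw [h]; trivial
      obtain ⟨a, ha⟩ := Submodule.mem_span_singleton.1 h1
      have := congrFun ha 1
      simp at this
  have hτ := quatRep_quatPullback hρcont hρhom
  have hker : ∀ A, (ρ A).1 = 1 → A.1 = 1 := by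
    intro A hA
    by_contra hA1
    obtain ⟨q, hq0, hqA⟩ := exists_adMat_eq A.2
    obtain ⟨r, p, hr, hp, rfl⟩ := exists_smul_unitQuat hq0
    have hp0 := ne_zero_of_normSq hp
    have hr' : (r : Quaternion ℝ) ≠ 0 :=
      fun h => hr (Quaternion.coe_injective (h.trans Quaternion.coe_zero.symm))
    rw [adMat_mul hr' hp0, adMat_coe hr, Matrix.one_mul] at hqA
    have hpτ : quatPullback ρ p = 1 := by
      rw [quatPullback_apply hp0, ← hA]
      congr 2
      exact Subtype.ext hqA
    have hdec : p = (p.re : Quaternion ℝ) + imQuat ![p.imI, p.imJ, p.imK] := by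
      ext <;> simp [imQuat_apply]
    obtain ⟨B, hB⟩ := hnt
    obtain ⟨b, hb0, hb⟩ := exists_adMat_eq B.2
    refine hB ?_
    have h1 := hτ.trivial (c := p.re) (m := ![p.imI, p.imJ, p.imK]) (fun h => hA1 ?_) ?_
      (hdec ▸ hpτ) hb0
    · rw [quatPullback_apply hb0] at h1
      rw [← h1]
      congr 2
      exact Subtype.ext hb.symm
    · rw [h, map_zero, add_zero] at hdec
      rw [← hqA, hdec]
      refine adMat_coe fun h0 => hp0 ?_
      rw [hdec, h0]; rfl
    · refine Eq.trans ?_ hp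
      rw [Quaternion.normSq_def']
      simp [dotProduct, Fin.sum_univ_three]; ring
  intro A B h
  have hAt := transpose_mem_SOSet A.2
  have h1 := hker ⟨A.1ᵀ * B.1, mul_mem_SOSet hAt B.2⟩ (by
    rw [← hρhom ⟨A.1ᵀ, hAt⟩ B _ rfl, ← h, hρhom ⟨A.1ᵀ, hAt⟩ A ⟨1, one_mem_SOSet⟩
      (transpose_mul_of_mem_SOSet A.2), map_one_of_hom hρhom])
  refine Subtype.ext ?_
  rw [← Matrix.one_mul B.1, ← A.2.1, Matrix.mul_assoc, show A.1ᵀ * B.1 = 1 from h1, Matrix.mul_one]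

/-- A reduction of the structure group to the image of an irreducible representation contracts
the characteristic map. -/
theorem exists_contraction_of_reduces (hρcont : Continuous ρ)
    (hρhom : ∀ A B C : {A : Matrix (Fin 3) (Fin 3) ℝ // A ∈ SOSet 3},
      (A : Matrix (Fin 3) (Fin 3) ℝ) * B = C →
      (ρ A : Matrix (Fin 5) (Fin 5) ℝ) * (ρ B) = (ρ C))
    (hρirr : ∀ W : Submodule ℝ (Fin 5 → ℝ),
      (∀ A : {A : Matrix (Fin 3) (Fin 3) ℝ // A ∈ SOSet 3},
        W.map (Matrix.mulVecLin (ρ A : Matrix (Fin 5) (Fin 5) ℝ)) ≤ W) →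
      W = ⊥ ∨ W = ⊤) (h : SphereStructureGroupReducesTo 5 (Subtype.val '' Set.range ρ)) :
    ∃ (c : Matrix (Fin 5) (Fin 5) ℝ) (H : Sph 5 → I → Matrix (Fin 5) (Fin 5) ℝ),
      (Continuous fun p : Sph 5 × I => H p.1 p.2) ∧ (∀ x t, IsUnit (H x t)) ∧
      (∀ x, H x 0 = reflMat x.1 * Matrix.diagonal (fun i => if i.val = 0 then -1 else 1)) ∧
      ∀ x, H x 1 = c := by
  obtain ⟨χ, g, hχ, hg, ⟨M⟩⟩ := h
  have hemb : IsEmbedding fun A => (ρ A).1 :=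
    IsEmbedding.subtypeVal.comp
      (hρcont.isClosedEmbedding (injective_of_irreducible hρcont hρhom hρirr)).isEmbedding
  have hg' : ∀ x, ∃ A, (ρ A).1 = g x := fun x => by
    obtain ⟨_, ⟨A, rfl⟩, h⟩ := hg x
    exact ⟨A, h⟩
  choose f hf using hg'
  have hfc : Continuous f := by
    rw [hemb.continuous_iff]
    exact g.continuous.congr fun x => (hf x).symm
  obtain ⟨c, K, hK, hK0, hK1⟩ := exists_null_homotopy hρcont hρhom
    (hfc.comp (sphHomeo 5).symm.continuous)
  obtain ⟨N⟩ := ContinuousMap.HomotopicWith.trans ⟨M⟩ (homotopicWith_of_fun (f := g)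
    (g := ContinuousMap.const _ c.1) (P := fun h => ∀ x, IsUnit (h x))
    (fun x t => (K (sphHomeo 5 x) t).1)
    (continuous_subtype_val.comp (hK.comp (((sphHomeo 5).continuous.comp continuous_fst).prodMk
      continuous_snd))) (fun x => by simp [hK0, hf]) (fun x => by simp [hK1]) fun t x => by
      rw [Matrix.isUnit_iff_isUnit_det]
      simp [(K (sphHomeo 5 x) t).2.2])
  refine ⟨c.1, fun x t => N (t, (sphHomeo 5).symm x),
    N.continuous.comp (continuous_snd.prodMk ((sphHomeo 5).symm.continuous.comp continuous_fst)),
    fun x t => N.prop' t _, fun x => ?_, fun x => N.apply_one _⟩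
  refine (N.apply_zero _).trans ((hχ _).trans ?_)
  rfl

end Representation

section GramSchmidt

open InnerProductSpace

lemma continuous_gramSchmidt {X E : Type*} [TopologicalSpace X] [NormedAddCommGroup E]
    [InnerProductSpace ℝ E] {n : ℕ} {f : X → Fin n → E} (hf : ∀ i, Continuous fun x => f x i)
    (hli : ∀ x, LinearIndependent ℝ (f x)) (i : Fin n) :
    Continuous fun x => gramSchmidt ℝ (f x) i := by
  induction i using WellFoundedLT.induction with
  | ind i ih =>
    simp only [gramSchmidt_def ℝ _ i, Submodule.starProjection_singleton]
    refine (hf i).sub (continuous_finsetSum _ fun j hj => ?_)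
    have hj' := ih j (Finset.mem_Iio.1 hj)
    refine Continuous.smul (Continuous.div (hj'.inner (hf i)) ?_ fun x => ?_) hj'
    · simp only [RCLike.ofReal_real_eq_id, id_eq]
      exact hj'.norm.pow 2
    · simpa using gramSchmidt_ne_zero j (hli x)

/-- Orthonormalization of the rows of a matrix. -/
noncomputable def orthoRows {n : ℕ} (A : Matrix (Fin n) (Fin n) ℝ) : Matrix (Fin n) (Fin n) ℝ :=
  Matrix.of fun i j => gramSchmidtNormed ℝ (fun i => WithLp.toLp 2 (A.row i)) i j

lemma linearIndependent_toLp_row {n : ℕ} {A : Matrix (Fin n) (Fin n) ℝ} (hA : IsUnit A) :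
    LinearIndependent ℝ fun i => (WithLp.toLp 2 (A.row i) : EuclideanSpace ℝ (Fin n)) :=
  (linearIndependent_rows_iff_isUnit.2 hA).map'
    (WithLp.linearEquiv 2 ℝ (Fin n → ℝ)).symm.toLinearMap (LinearEquiv.ker _)

lemma inner_toLp_row {n : ℕ} (A : Matrix (Fin n) (Fin n) ℝ) (i j : Fin n) :
    inner ℝ (WithLp.toLp 2 (A.row i) : EuclideanSpace ℝ (Fin n)) (WithLp.toLp 2 (A.row j)) =
      (A * Aᵀ) i j := by
  rw [mul_apply, PiLp.inner_apply]
  refine Finset.sum_congr rfl fun k _ => ?_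
  simp [mul_comm]

lemma orthoRows_mul_transpose {n : ℕ} {A : Matrix (Fin n) (Fin n) ℝ} (hA : IsUnit A) :
    orthoRows A * (orthoRows A)ᵀ = 1 := by
  have h := orthonormal_iff_ite.1 (gramSchmidtNormed_orthonormal (linearIndependent_toLp_row hA))
  ext i j
  rw [← inner_toLp_row, one_apply]
  exact h i j

lemma orthoRows_of_orthogonal {n : ℕ} {A : Matrix (Fin n) (Fin n) ℝ} (hA : A * Aᵀ = 1) :
    orthoRows A = A := by
  have h : Pairwise fun i j => inner ℝ (WithLp.toLp 2 (A.row i) : EuclideanSpace ℝ (Fin n))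
      (WithLp.toLp 2 (A.row j)) = 0 := fun i j hij => by
    dsimp only
    rw [inner_toLp_row, hA, one_apply_ne hij]
  ext i j
  have h1 : ‖(WithLp.toLp 2 (A.row i) : EuclideanSpace ℝ (Fin n))‖ = 1 := by
    have h2 := inner_toLp_row A i i
    rw [hA, one_apply_eq, real_inner_self_eq_norm_sq] at h2
    exact (pow_eq_one_iff_of_nonneg (norm_nonneg _) two_ne_zero).1 h2
  simp only [orthoRows, gramSchmidtNormed, gramSchmidt_of_orthogonal ℝ h, of_apply, h1]
  simp

lemma continuous_orthoRows {X : Type*} [TopologicalSpace X] {n : ℕ}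
    {H : X → Matrix (Fin n) (Fin n) ℝ} (hH : Continuous H) (hu : ∀ x, IsUnit (H x)) :
    Continuous fun x => orthoRows (H x) := by
  have hli := fun x => linearIndependent_toLp_row (hu x)
  have hg := continuous_gramSchmidt (f := fun x i => (WithLp.toLp 2 ((H x).row i) :
    EuclideanSpace ℝ (Fin n))) (fun i => (PiLp.continuous_toLp 2 _).comp
      (continuous_pi fun j => hH.matrix_elem i j)) hli
  refine continuous_matrix fun i j => ?_
  simp only [orthoRows, gramSchmidtNormed, of_apply]
  have h1 : Continuous fun x => (‖gramSchmidt ℝ (fun i => (WithLp.toLp 2 ((H x).row i) :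
      EuclideanSpace ℝ (Fin n))) i‖ : ℝ)⁻¹ :=
    (hg i).norm.inv₀ fun x => by simpa using gramSchmidt_ne_zero i (hli x)
  have h2 : Continuous fun x => (gramSchmidt ℝ (fun i => (WithLp.toLp 2 ((H x).row i) :
      EuclideanSpace ℝ (Fin n))) i) j :=
    (continuous_apply j).comp ((PiLp.continuous_ofLp 2 _).comp (hg i))
  exact h1.mul h2

end GramSchmidt

/-- The matrix of the quaternionic structure of `ℂ⁴`. -/
def quatJ : Matrix (Fin 4) (Fin 4) ℂ := !![0, -1, 0, 0; 1, 0, 0, 0; 0, 0, 0, -1; 0, 0, 1, 0]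

/-- The compact symplectic group of quaternionic unitary matrices of `ℂ⁴`. -/
def symplecticSub : Submonoid (Matrix (Fin 4) (Fin 4) ℂ) where
  carrier := {M | Mᴴ * M = 1 ∧ M * quatJ = quatJ * M.map (starRingEnd ℂ)}
  one_mem' := ⟨by simp, by simp⟩
  mul_mem' := by
    rintro M N ⟨h1, h2⟩ ⟨h3, h4⟩
    refine ⟨?_, ?_⟩
    · rw [conjTranspose_mul, Matrix.mul_assoc, ← Matrix.mul_assoc Mᴴ, h1, Matrix.one_mul, h3]
    · rw [Matrix.map_mul, Matrix.mul_assoc, h4, ← Matrix.mul_assoc, h2, Matrix.mul_assoc]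

lemma gamma5_mem_symplecticSub {u : Fin 5 → ℝ} (hu : u ⬝ᵥ u = 1) :
    gamma5 u ∈ symplecticSub := by
  have h : (gamma5 u)ᴴ = gamma5 u := by
    rw [gamma5_apply]
    ext i j
    fin_cases i <;> fin_cases j <;> simp [Complex.ext_iff]
  refine ⟨by rw [h, gamma5_mul_self, hu]; simp, ?_⟩
  rw [gamma5_apply, quatJ]
  ext i j
  rw [mul_apply, mul_apply, Fin.sum_univ_four, Fin.sum_univ_four]
  fin_cases i <;> fin_cases j <;> simp [Complex.ext_iff]

lemma eq_smul_one_of_commute_gamma5 {M : Matrix (Fin 4) (Fin 4) ℂ}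
    (h : ∀ v, M * gamma5 v = gamma5 v * M) : M = M 0 0 • (1 : Matrix (Fin 4) (Fin 4) ℂ) := by
  have key : ∀ v i j, (M * gamma5 v) i j = (gamma5 v * M) i j := fun v i j => by rw [h]
  simp only [mul_apply, Fin.sum_univ_four, gamma5_apply] at key
  have k0 := key (Pi.single 0 1)
  have k1 := key (Pi.single 1 1)
  have k2 := key (Pi.single 2 1)
  have k3 := key (Pi.single 3 1)
  have k4 := key (Pi.single 4 1)
  clear key h
  have hI : Complex.I * Complex.I = -1 := Complex.I_mul_I
  simp [Fin.forall_fin_succ] at k0 k1 k2 k3 k4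
  ext i j
  fin_cases i <;> fin_cases j <;> simp <;> grind

lemma exists_symplectic_symbol (c : Matrix (Fin 5) (Fin 5) ℝ)
    (H : Sph 5 → I → Matrix (Fin 5) (Fin 5) ℝ) (hH : Continuous fun p : Sph 5 × I => H p.1 p.2)
    (hu : ∀ x t, IsUnit (H x t))
    (h0 : ∀ x, H x 0 = reflMat x.1 * Matrix.diagonal (fun i => if i.val = 0 then -1 else 1))
    (h1 : ∀ x, H x 1 = c) :
    ∃ (f : Sph 5 → I → Matrix (Fin 4) (Fin 4) ℂ) (r : ℝ),
      (Continuous fun p : Sph 5 × I => f p.1 p.2) ∧ (∀ x t, f x t ∈ symplecticSub) ∧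
      (∀ x, f x 0 = gamma5 x.1 * gamma5 (Pi.single 0 1)) ∧ r ^ 2 = 1 ∧
      ∀ x, f x 1 = (r : ℂ) • (1 : Matrix (Fin 4) (Fin 4) ℂ) := by
  set e : Fin 5 → ℝ := Pi.single 0 1 with he
  have hee : e ⬝ᵥ e = 1 := single_dotProduct_self 0
  have hD : Matrix.diagonal (fun i : Fin 5 => if i.val = 0 then (-1 : ℝ) else 1) = reflMat e := by
    ext i j
    fin_cases i <;> fin_cases j <;>
      (simp [reflMat, he, vecMulVec_apply, Matrix.smul_apply]; try norm_num)
  rw [hD] at h0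
  set Q : Sph 5 → I → Matrix (Fin 5) (Fin 5) ℝ := fun x t => orthoRows (H x t) with hQ
  have hQc : Continuous fun p : Sph 5 × I => Q p.1 p.2 :=
    continuous_orthoRows hH fun p => hu p.1 p.2
  have hQQ : ∀ x t, Q x t * (Q x t)ᵀ = 1 := fun x t => orthoRows_mul_transpose (hu x t)
  have hQ0 : ∀ x, Q x 0 = reflMat x.1 * reflMat e := fun x => by
    rw [hQ]; dsimp only
    rw [orthoRows_of_orthogonal, h0]
    rw [h0]
    exact (reflMat_mul_reflMat_mem_SOSet x.2 hee).1
  have hQdet : ∀ x t, (Q x t).det = 1 := fun x t => by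
    have h2 : (Q x 0).det = 1 := by
      rw [hQ0]; exact (reflMat_mul_reflMat_mem_SOSet x.2 hee).2
    rw [← h2]
    have h3 : Continuous fun t => (Q x t).det :=
      (hQc.comp (Continuous.prodMk_right x)).matrix_det
    refine constant_of_integer_valued h3 (fun t => ?_) t 0
    have h4 := congrArg Matrix.det (hQQ x t)
    rw [det_mul, det_transpose, det_one] at h4
    rcases mul_self_eq_one_iff.1 h4 with h | h
    · exact ⟨1, by simp [h]⟩
    · exact ⟨-1, by simp [h]⟩
  have hQSO : ∀ x t, Q x t ∈ SOSet 5 := fun x t => ⟨hQQ x t, hQdet x t⟩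
  let e' : Sph 5 := ⟨e, hee⟩
  set G : Sph 5 → I → Matrix (Fin 5) (Fin 5) ℝ := fun x t => Q x t * (Q e' t)ᵀ with hG
  have hGc : Continuous fun p : Sph 5 × I => G p.1 p.2 :=
    hQc.mul (hQc.comp (continuous_const.prodMk continuous_snd)).matrix_transpose
  have hGSO : ∀ x t, G x t ∈ SOSet 5 := fun x t =>
    mul_mem_SOSet (hQSO x t) (transpose_mem_SOSet (hQSO e' t))
  obtain ⟨s, hs, hs0, hsγ, hsS⟩ := exists_spin_lift (γ := gamma5) (ε := 1) (by norm_num)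
    gamma5_mul_self G hGc hGSO
  have hG0 : ∀ x, G x 0 = reflMat x.1 * reflMat e := fun x => by
    rw [hG]; dsimp only
    rw [hQ0, hQ0, reflMat_mul_self hee, transpose_one, Matrix.mul_one]
  have hG1 : ∀ x, G x 1 = 1 := fun x => by
    have h2 : Q x 1 = Q e' 1 := by rw [hQ]; dsimp only; rw [h1, h1]
    rw [hG]; dsimp only
    rw [h2, hQQ]
  have hrefl : ∀ u v : Fin 5 → ℝ, u ⬝ᵥ u = 1 → gamma5 u * gamma5 v =
      -(gamma5 (reflMat u *ᵥ v) * gamma5 u) := fun u v hu' => by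
    have h2 := gamma5_mul_self (u + v)
    have h3 := gamma5_mul_self u
    have h4 := gamma5_mul_self v
    have h5 : (u + v) ⬝ᵥ (u + v) = u ⬝ᵥ u + 2 * (u ⬝ᵥ v) + v ⬝ᵥ v := by
      rw [add_dotProduct, dotProduct_add, dotProduct_add, dotProduct_comm v u]; ring
    rw [h5, map_add, add_mul, mul_add, mul_add, h3, h4] at h2
    rw [reflMat_mulVec, map_sub, map_smul, sub_mul, smul_mul_assoc, h3, hu']
    have h6 : gamma5 u * gamma5 v + gamma5 v * gamma5 u = (2 * (u ⬝ᵥ v)) • 1 := by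
      have h7 := congrArg (fun M => M - (1 * (u ⬝ᵥ u)) • (1 : Matrix (Fin 4) (Fin 4) ℂ) -
        (1 * (v ⬝ᵥ v)) • (1 : Matrix (Fin 4) (Fin 4) ℂ)) h2
      refine Eq.trans ?_ (h7.trans ?_)
      · abel
      · module
    rw [one_mul, one_smul, ← h6]
    abel
  set f : Sph 5 → I → Matrix (Fin 4) (Fin 4) ℂ := fun x t =>
    s x t * (gamma5 x.1 * gamma5 e) with hf
  have hγc : Continuous fun x : Fin 5 → ℝ => gamma5 x := gamma5.continuous_of_finiteDimensional
  have hfc : Continuous fun p : Sph 5 × I => f p.1 p.2 :=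
    hs.mul ((hγc.comp (continuous_subtype_val.comp continuous_fst)).mul continuous_const)
  have hfS : ∀ x t, f x t ∈ symplecticSub := fun x t =>
    mul_mem (hsS symplecticSub (fun u v hu' hv' => by
      rw [one_smul]
      exact mul_mem (gamma5_mem_symplecticSub hu') (gamma5_mem_symplecticSub hv')) x t)
      (mul_mem (gamma5_mem_symplecticSub x.2) (gamma5_mem_symplecticSub hee))
  have hfγ : ∀ x v, f x 1 * gamma5 v = gamma5 v * f x 1 := fun x v => by
    have h2 : gamma5 x.1 * gamma5 e * gamma5 v =
        gamma5 ((reflMat x.1 * reflMat e) *ᵥ v) * (gamma5 x.1 * gamma5 e) := by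
      rw [Matrix.mul_assoc, hrefl e v hee, Matrix.mul_neg, ← Matrix.mul_assoc, hrefl x.1 _ x.2,
        mulVec_mulVec, Matrix.neg_mul, neg_neg, Matrix.mul_assoc]
    rw [hf]; dsimp only
    rw [Matrix.mul_assoc, h2, ← Matrix.mul_assoc, hsγ, hG1, hG0, mulVec_mulVec, Matrix.one_mul,
      ← hG0, transpose_mul_of_mem_SOSet (hGSO x 0), one_mulVec, Matrix.mul_assoc]
  have hscal := fun x => eq_smul_one_of_commute_gamma5 (hfγ x)
  have hreal : ∀ x, ((f x 1 0 0).re : ℂ) = f x 1 0 0 ∧ (f x 1 0 0).re ^ 2 = 1 := fun x => by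
    obtain ⟨h2, h3⟩ := hfS x 1
    rw [hscal x] at h2 h3
    have h4 := congrFun (congrFun h3 1) 0
    have h5 := congrFun (congrFun h2 0) 0
    simp [quatJ, mul_apply, Fin.sum_univ_four, one_apply] at h4 h5
    have h6 := Complex.conj_eq_iff_re.1 h4.symm
    refine ⟨h6, ?_⟩
    rw [← h4, ← h6] at h5
    rw [sq]
    exact_mod_cast h5
  refine ⟨f, (f e' 1 0 0).re, hfc, hfS, fun x => ?_, (hreal e').2, fun x => ?_⟩
  · rw [hf]; dsimp only
    rw [hs0, Matrix.one_mul]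
  · have h2 : (f x 1 0 0).re = (f e' 1 0 0).re := by
      have h3 : Continuous fun x => (f x 1 0 0).re := Complex.continuous_re.comp
        ((hfc.comp (Continuous.prodMk_left 1)).matrix_elem 0 0)
      refine constant_of_integer_valued h3 (fun x => ?_) x e'
      rcases mul_self_eq_one_iff.1 ((sq _).symm.trans (hreal x).2) with h | h
      · exact ⟨1, by simp [h]⟩
      · exact ⟨-1, by simp [h]⟩
    rw [← h2, (hreal x).1]
    exact hscal x

section Moments

open MeasureTheory

/-- The unit sphere of `ℂ⁴`. -/
abbrev S7 := {z : Fin 4 → ℂ // ∑ a, Complex.normSq (z a) = 1}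

lemma norm_le_one_of_S7 (z : S7) (a : Fin 4) : ‖z.1 a‖ ≤ 1 := by
  have h : Complex.normSq (z.1 a) ≤ 1 :=
    (Finset.single_le_sum (f := fun a => Complex.normSq (z.1 a))
      (fun i _ => Complex.normSq_nonneg _) (Finset.mem_univ a)).trans z.2.le
  rw [Complex.normSq_eq_norm_sq] at h
  nlinarith [norm_nonneg (z.1 a)]

instance : CompactSpace S7 := by
  refine (isCompact_iff_compactSpace (s := {z : Fin 4 → ℂ | ∑ a, Complex.normSq (z a) = 1})).1 ?_
  refine (isCompact_univ_pi fun _ : Fin 4 => isCompact_closedBall (0 : ℂ) 1).of_isClosed_subset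
    (isClosed_eq ?_ continuous_const) fun z hz a _ => ?_
  · exact continuous_finsetSum _ fun a _ => Complex.continuous_normSq.comp (continuous_apply a)
  · rw [mem_closedBall_zero_iff]
    exact norm_le_one_of_S7 ⟨z, hz⟩ a

/-- The involution of the index set underlying the quaternionic structure. -/
def swapIdx : Fin 4 → Fin 4 := ![1, 0, 3, 2]

/-- The signs of the quaternionic structure. -/
def swapSign : Fin 4 → ℝ := ![-1, 1, -1, 1]

/-- The quaternionic structure on the unit sphere. -/
noncomputable def sigma7 : C(S7, S7) where
  toFun z := ⟨fun a => swapSign a * (starRingEnd ℂ) (z.1 (swapIdx a)), by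
    have h := z.2
    rw [Fin.sum_univ_four] at h ⊢
    simp [swapSign, swapIdx, Complex.normSq_conj] at h ⊢
    linarith⟩
  continuous_toFun := Continuous.subtype_mk (continuous_pi fun a => continuous_const.mul
    (Complex.continuous_conj.comp ((continuous_apply (swapIdx a)).comp
      continuous_subtype_val))) fun z => by
        have h := z.2
        rw [Fin.sum_univ_four] at h ⊢
        simp [swapSign, swapIdx, Complex.normSq_conj] at h ⊢
        linarith

/-- Monomials on the unit sphere. -/
def mono (α : Fin 4 → ℕ) : C(S7, ℂ) where
  toFun z := ∏ a, z.1 a ^ α a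
  continuous_toFun := continuous_finsetProd _ fun a _ =>
    ((continuous_apply a).comp continuous_subtype_val).pow _

lemma mono_apply (α : Fin 4 → ℕ) (z : S7) : mono α z = ∏ a, z.1 a ^ α a := rfl

/-- Stick-breaking coordinates for the moduli of a point of the unit sphere. -/
noncomputable def stick (k : Fin 7 → I) : Fin 4 → ℝ :=
  ![√(k 0), √(1 - k 0) * √(k 1), √(1 - k 0) * √(1 - k 1) * √(k 2),
    √(1 - k 0) * √(1 - k 1) * √(1 - k 2)]

/-- The phases of a point of the unit sphere. -/
noncomputable def phase (x : ℝ) : ℂ := Complex.exp (2 * Real.pi * Complex.I * x)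

lemma continuous_phase : Continuous phase := by unfold phase; fun_prop

lemma phase_mul_conj (x : ℝ) : phase x * (starRingEnd ℂ) (phase x) = 1 := by
  rw [phase, ← Complex.exp_conj, ← Complex.exp_add]
  simp [Complex.conj_ofNat]

/-- A parametrization of the unit sphere by a cube. -/
noncomputable def cubeS7 : C(Fin 7 → I, S7) where
  toFun k := ⟨fun a => stick k a * phase (k (![3, 4, 5, 6] a)), by
    have hn : ∀ x, Complex.normSq (phase x) = 1 := fun x => by
      have h := phase_mul_conj x
      rw [Complex.mul_conj] at h
      exact_mod_cast h
    have h0 : ∀ i, 0 ≤ (k i : ℝ) := fun i => (k i).2.1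
    have h1 : ∀ i, 0 ≤ 1 - (k i : ℝ) := fun i => sub_nonneg.2 (k i).2.2
    simp only [Complex.normSq_mul, hn, Complex.normSq_ofReal, mul_one]
    rw [Fin.sum_univ_four]
    simp only [stick, cons_val_zero, cons_val_one, cons_val]
    simp only [mul_mul_mul_comm, Real.mul_self_sqrt, h0, h1]
    ring⟩
  continuous_toFun := by
    refine Continuous.subtype_mk (continuous_pi fun a => ?_) _
    have h : Continuous fun k : Fin 7 → I => stick k a := by
      fin_cases a <;> simp [stick] <;> fun_prop
    exact (Complex.continuous_ofReal.comp h).mul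
      (continuous_phase.comp (continuous_subtype_val.comp (continuous_apply _)))

/-- The density of the uniform measure of the sphere in stick-breaking coordinates. -/
def density (k : Fin 7 → I) : ℝ := 6 * (1 - k 0) ^ 2 * (1 - k 1)

lemma continuous_density : Continuous density := by
  unfold density; fun_prop

lemma density_nonneg (k : Fin 7 → I) : 0 ≤ density k := by
  have h1 : 0 ≤ 1 - (k 1 : ℝ) := sub_nonneg.2 (k 1).2.2
  unfold density
  positivity

lemma density_le (k : Fin 7 → I) : density k ≤ 6 := by
  have h0 := (k 0).2.1
  have h1 := (k 1).2.1
  have h2 := (k 0).2.2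
  have h3 := (k 1).2.2
  unfold density
  nlinarith [mul_nonneg (sub_nonneg.2 h2) (sub_nonneg.2 h3), sq_nonneg (1 - (k 0 : ℝ)),
    mul_nonneg (sq_nonneg (1 - (k 0 : ℝ))) h1]

lemma integral_unitInterval (g : ℝ → ℂ) : ∫ x : I, g x = ∫ x in (0 : ℝ)..1, g x := by
  rw [intervalIntegral.integral_of_le zero_le_one, ← integral_Icc_eq_integral_Ioc]
  exact unitInterval.measurePreserving_coe.integral_comp unitInterval.measurableEmbedding_coe g

lemma integral_phase (a b : ℕ) :
    ∫ x : I, (starRingEnd ℂ) (phase x) ^ a * phase x ^ b = if a = b then 1 else 0 := by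
  split_ifs with h
  · subst h
    simp [← mul_pow, mul_comm _ (phase _), phase_mul_conj]
  · have h1 : ∀ x : ℝ, (starRingEnd ℂ) (phase x) ^ a * phase x ^ b =
        Complex.exp ((2 * Real.pi * Complex.I * ((b : ℤ) - (a : ℤ) : ℤ)) * x) := fun x => by
      rw [phase, ← Complex.exp_conj, ← Complex.exp_nat_mul, ← Complex.exp_nat_mul,
        ← Complex.exp_add]
      congr 1
      simp [Complex.conj_ofNat]
      ring
    simp only [h1]
    rw [integral_unitInterval fun x : ℝ =>
      Complex.exp ((2 * Real.pi * Complex.I * ((b : ℤ) - (a : ℤ) : ℤ)) * x),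
      integral_exp_mul_complex]
    · have h2 : Complex.exp (2 * Real.pi * Complex.I * ((b : ℤ) - (a : ℤ) : ℤ)) = 1 := by
        rw [mul_comm]
        exact Complex.exp_int_mul_two_pi_mul_I _
      simp only [Complex.ofReal_one, mul_one, h2, Complex.ofReal_zero, mul_zero, Complex.exp_zero,
        sub_self, zero_div]
    · have h3 : ((b : ℤ) - (a : ℤ) : ℤ) ≠ 0 := by omega
      have h4 : (((b : ℤ) - (a : ℤ) : ℤ) : ℂ) ≠ 0 := Int.cast_ne_zero.2 h3
      simp only [ne_eq, mul_eq_zero, h4, Complex.ofReal_eq_zero, Real.pi_ne_zero,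
        Complex.I_ne_zero, or_self, OfNat.ofNat_ne_zero, not_false_eq_true]

lemma integral_pow_mul_one_sub_pow (a b : ℕ) :
    ∫ x : I, ((x : ℝ) : ℂ) ^ a * (1 - ((x : ℝ) : ℂ)) ^ b =
      a.factorial * b.factorial / (a + b + 1).factorial := by
  rw [integral_unitInterval fun x : ℝ => (x : ℂ) ^ a * (1 - (x : ℂ)) ^ b]
  have h := Complex.Gamma_mul_Gamma_eq_betaIntegral (s := a + 1) (t := b + 1)
    (by simp; positivity) (by simp; positivity)
  rw [Complex.Gamma_nat_eq_factorial, Complex.Gamma_nat_eq_factorial,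
    show (a + 1 + (b + 1) : ℂ) = ((a + b + 1 : ℕ) : ℂ) + 1 by push_cast; ring,
    Complex.Gamma_nat_eq_factorial] at h
  have h1 : ((a + b + 1).factorial : ℂ) ≠ 0 := Nat.cast_ne_zero.2 (Nat.factorial_ne_zero _)
  rw [eq_div_iff h1, h, mul_comm]
  congr 1
  rw [Complex.betaIntegral]
  simp

/-- The square norm of a monomial on the unit sphere. -/
noncomputable def moment (α : Fin 4 → ℕ) : ℝ :=
  6 * (∏ a, ((α a).factorial : ℝ)) / ((∑ a, α a) + 3).factorial

lemma moment_pos (α : Fin 4 → ℕ) : 0 < moment α := by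
  have h : ∀ a, (0 : ℝ) < (α a).factorial := fun a => by positivity
  have h1 := Finset.prod_pos (s := Finset.univ) fun a _ => h a
  unfold moment
  positivity

lemma moment_add_single (α : Fin 4 → ℕ) (b : Fin 4) :
    moment (α + Pi.single b 1) * (((∑ a, α a) + 4 : ℕ) : ℝ) = moment α * ((α b + 1 : ℕ) : ℝ) := by
  have h1 : ∑ a, (α + Pi.single b 1 : Fin 4 → ℕ) a = (∑ a, α a) + 1 := by
    simp [Finset.sum_add_distrib]
  have h2 : ∏ a, (((α + Pi.single b 1 : Fin 4 → ℕ) a).factorial : ℝ) =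
      (∏ a, ((α a).factorial : ℝ)) * ((α b + 1 : ℕ) : ℝ) := by
    rw [← Finset.mul_prod_erase _ _ (Finset.mem_univ b),
      ← Finset.mul_prod_erase _ (fun a => ((α a).factorial : ℝ)) (Finset.mem_univ b)]
    have h3 : ∏ a ∈ Finset.univ.erase b, (((α + Pi.single b 1 : Fin 4 → ℕ) a).factorial : ℝ) =
        ∏ a ∈ Finset.univ.erase b, ((α a).factorial : ℝ) :=
      Finset.prod_congr rfl fun a ha => by simp [Finset.ne_of_mem_erase ha]
    rw [h3]
    simp [Nat.factorial_succ]
    ring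
  rw [moment, moment, h1, h2, show (∑ a, α a) + 1 + 3 = ((∑ a, α a) + 3) + 1 by ring,
    Nat.factorial_succ]
  have h4 : (((∑ a, α a) + 3).factorial : ℝ) ≠ 0 := Nat.cast_ne_zero.2 (Nat.factorial_ne_zero _)
  push_cast
  field_simp

lemma integral_cube_moment (α β : Fin 4 → ℕ) :
    ∫ k : Fin 7 → I, (density k : ℂ) * ((starRingEnd ℂ) (mono α (cubeS7 k)) * mono β (cubeS7 k)) =
      if α = β then (moment α : ℂ) else 0 := by
  let g : Fin 7 → I → ℂ := ![
    fun x => 3 * (1 - (x : ℝ) : ℂ) ^ 2 * (√(x : ℝ) : ℂ) ^ (α 0 + β 0) *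
      (√(1 - x : ℝ) : ℂ) ^ (α 1 + β 1 + (α 2 + β 2) + (α 3 + β 3)),
    fun x => 2 * (1 - (x : ℝ) : ℂ) * (√(x : ℝ) : ℂ) ^ (α 1 + β 1) *
      (√(1 - x : ℝ) : ℂ) ^ ((α 2 + β 2) + (α 3 + β 3)),
    fun x => (√(x : ℝ) : ℂ) ^ (α 2 + β 2) * (√(1 - x : ℝ) : ℂ) ^ (α 3 + β 3),
    fun x => (starRingEnd ℂ) (phase x) ^ α 0 * phase x ^ β 0,
    fun x => (starRingEnd ℂ) (phase x) ^ α 1 * phase x ^ β 1,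
    fun x => (starRingEnd ℂ) (phase x) ^ α 2 * phase x ^ β 2,
    fun x => (starRingEnd ℂ) (phase x) ^ α 3 * phase x ^ β 3]
  have hg : ∀ k : Fin 7 → I, (density k : ℂ) *
      ((starRingEnd ℂ) (mono α (cubeS7 k)) * mono β (cubeS7 k)) = ∏ i, g i (k i) := by
    intro k
    rw [Fin.prod_univ_seven]
    simp only [mono_apply, Fin.prod_univ_four, cubeS7, ContinuousMap.coe_mk, stick,
      density, g, cons_val_zero, cons_val_one, cons_val, map_pow, map_mul, Complex.conj_ofReal,
      mul_pow, Complex.ofReal_mul]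
    push_cast
    ring
  simp only [hg]
  rw [integral_fintype_prod_volume_eq_prod, Fin.prod_univ_seven]
  simp only [g, cons_val_zero, cons_val_one, cons_val, integral_phase]
  by_cases h : α = β
  swap
  · have h1 : ∃ a, α a ≠ β a := Function.ne_iff.1 h
    obtain ⟨a, ha⟩ := h1
    rw [if_neg h]
    fin_cases a <;> simp at ha <;> simp [ha]
  subst h
  simp only [if_true, mul_one]
  have hs : ∀ x : I, ∀ n : ℕ, (√(x : ℝ) : ℂ) ^ (n + n) = ((x : ℝ) : ℂ) ^ n := fun x n => by
    rw [← two_mul, pow_mul]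
    congr 1
    exact_mod_cast Real.sq_sqrt x.2.1
  have hs' : ∀ x : I, ∀ n : ℕ, (√(1 - x : ℝ) : ℂ) ^ (n + n) = (1 - ((x : ℝ) : ℂ)) ^ n :=
    fun x n => by
    rw [← two_mul, pow_mul]
    congr 1
    exact_mod_cast Real.sq_sqrt (sub_nonneg.2 x.2.2)
  have e0 : ∫ x : I, (3 : ℂ) * (1 - (x : ℝ) : ℂ) ^ 2 * (√(x : ℝ) : ℂ) ^ (α 0 + α 0) *
      (√(1 - x : ℝ) : ℂ) ^ (α 1 + α 1 + (α 2 + α 2) + (α 3 + α 3)) =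
      (3 : ℂ) * (((α 0).factorial : ℂ) * (α 1 + α 2 + α 3 + 2).factorial /
        (α 0 + (α 1 + α 2 + α 3 + 2) + 1).factorial) := by
    rw [← integral_pow_mul_one_sub_pow, ← integral_const_mul]
    congr 1 with x
    rw [hs, show α 1 + α 1 + (α 2 + α 2) + (α 3 + α 3) =
      (α 1 + α 2 + α 3) + (α 1 + α 2 + α 3) by ring, hs']
    ring
  have e1 : ∫ x : I, (2 : ℂ) * (1 - (x : ℝ) : ℂ) * (√(x : ℝ) : ℂ) ^ (α 1 + α 1) *
      (√(1 - x : ℝ) : ℂ) ^ ((α 2 + α 2) + (α 3 + α 3)) =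
      (2 : ℂ) * (((α 1).factorial : ℂ) * (α 2 + α 3 + 1).factorial /
        (α 1 + (α 2 + α 3 + 1) + 1).factorial) := by
    rw [← integral_pow_mul_one_sub_pow, ← integral_const_mul]
    congr 1 with x
    rw [hs, show (α 2 + α 2) + (α 3 + α 3) = (α 2 + α 3) + (α 2 + α 3) by ring, hs']
    ring
  have e2 : ∫ x : I, (√(x : ℝ) : ℂ) ^ (α 2 + α 2) * (√(1 - x : ℝ) : ℂ) ^ (α 3 + α 3) =
      (α 2).factorial * (α 3).factorial / (α 2 + α 3 + 1).factorial := by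
    rw [← integral_pow_mul_one_sub_pow]
    congr 1 with x
    rw [hs, hs']
  rw [e0, e1, e2, moment, Fin.prod_univ_four, Fin.sum_univ_four,
    show α 0 + (α 1 + α 2 + α 3 + 2) + 1 = α 0 + α 1 + α 2 + α 3 + 3 by ring,
    show α 1 + (α 2 + α 3 + 1) + 1 = α 1 + α 2 + α 3 + 2 by ring]
  have f1 : ((α 1 + α 2 + α 3 + 2).factorial : ℂ) ≠ 0 := Nat.cast_ne_zero.2 (Nat.factorial_ne_zero _)
  have f2 : ((α 2 + α 3 + 1).factorial : ℂ) ≠ 0 := Nat.cast_ne_zero.2 (Nat.factorial_ne_zero _)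
  have f3 : ((α 0 + α 1 + α 2 + α 3 + 3).factorial : ℂ) ≠ 0 :=
    Nat.cast_ne_zero.2 (Nat.factorial_ne_zero _)
  push_cast
  field_simp
  ring

end Moments

section SphereIntegral

open MeasureTheory

lemma integrable_cube {F : (Fin 7 → I) → ℂ} (hF : Continuous F) : Integrable F :=
  hF.integrable_of_hasCompactSupport (HasCompactSupport.of_compactSpace F)

lemma integrable_density_mul (F : C(S7, ℂ)) : Integrable fun k : Fin 7 → I => (density k : ℂ) *
    ((F (cubeS7 k) + F (sigma7 (cubeS7 k))) / 2) :=
  integrable_cube ((Complex.continuous_ofReal.comp continuous_density).mul (by fun_prop))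

/-- Integration over the unit sphere. -/
noncomputable def sphInt : C(S7, ℂ) →L[ℂ] ℂ :=
  LinearMap.mkContinuous
    { toFun := fun F => ∫ k : Fin 7 → I, (density k : ℂ) *
        ((F (cubeS7 k) + F (sigma7 (cubeS7 k))) / 2)
      map_add' := fun F G => by
        rw [← integral_add (integrable_density_mul F) (integrable_density_mul G)]
        congr 1 with k
        simp only [ContinuousMap.add_apply]
        ring
      map_smul' := fun c F => by
        rw [RingHom.id_apply, smul_eq_mul, ← integral_const_mul]
        congr 1 with k
        simp only [ContinuousMap.smul_apply, smul_eq_mul]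
        ring } 6 fun F => by
    have h := norm_integral_le_of_norm_le_const (μ := (volume : Measure (Fin 7 → I)))
      (f := fun k : Fin 7 → I => (density k : ℂ) *
        ((F (cubeS7 k) + F (sigma7 (cubeS7 k))) / 2)) (C := 6 * ‖F‖) (ae_of_all _ fun k => by
      rw [norm_mul, norm_div, Complex.norm_real, Real.norm_of_nonneg (density_nonneg k)]
      have h1 := F.norm_coe_le_norm (cubeS7 k)
      have h2 := F.norm_coe_le_norm (sigma7 (cubeS7 k))
      have h3 := norm_add_le (F (cubeS7 k)) (F (sigma7 (cubeS7 k)))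
      refine mul_le_mul (density_le k) ?_ (by positivity) (by norm_num)
      rw [div_le_iff₀ (by simp)]
      simp only [Complex.norm_ofNat]
      linarith)
    simpa using h

lemma sphInt_apply (F : C(S7, ℂ)) : sphInt F = ∫ k : Fin 7 → I, (density k : ℂ) *
    ((F (cubeS7 k) + F (sigma7 (cubeS7 k))) / 2) := rfl

lemma sphInt_star (F : C(S7, ℂ)) : sphInt (star F) = (starRingEnd ℂ) (sphInt F) := by
  rw [sphInt_apply, sphInt_apply, ← integral_conj]
  congr 1 with k
  simp [Complex.conj_ofNat]

lemma sphInt_comp_sigma7 (F : C(S7, ℂ)) (hF : ∀ z, F (sigma7 (sigma7 z)) = F z) :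
    sphInt (F.comp sigma7) = sphInt F := by
  rw [sphInt_apply, sphInt_apply]
  congr 1 with k
  simp only [ContinuousMap.comp_apply, hF]
  ring

lemma sphInt_re_mono {F G : C(S7, ℂ)} (h : ∀ z, (F z).re ≤ (G z).re) :
    (sphInt F).re ≤ (sphInt G).re := by
  have hre : ∀ F : C(S7, ℂ), (sphInt F).re = ∫ k : Fin 7 → I, ((density k : ℂ) *
      ((F (cubeS7 k) + F (sigma7 (cubeS7 k))) / 2)).re := fun F => by
    rw [sphInt_apply]
    exact (integral_re (integrable_density_mul F)).symm
  rw [hre, hre]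
  refine integral_mono (integrable_density_mul F).re (integrable_density_mul G).re fun k => ?_
  have h1 := h (cubeS7 k)
  have h2 := h (sigma7 (cubeS7 k))
  have h3 : ∀ w : ℂ, (w / 2).re = w.re / 2 := fun w => by simp
  dsimp only
  rw [Complex.re_ofReal_mul, Complex.re_ofReal_mul, h3, h3, Complex.add_re, Complex.add_re]
  exact mul_le_mul_of_nonneg_left (by linarith) (density_nonneg k)

lemma swapIdx_swapIdx (a : Fin 4) : swapIdx (swapIdx a) = a := by
  fin_cases a <;> rfl

lemma swapSign_mul_self (a : Fin 4) : swapSign a * swapSign a = 1 := by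
  fin_cases a <;> simp [swapSign]

lemma swapSign_swapIdx (a : Fin 4) : swapSign (swapIdx a) = -swapSign a := by
  fin_cases a <;> simp [swapSign, swapIdx]

/-- The involution of `Fin 4` underlying the quaternionic structure. -/
def swapEquiv : Fin 4 ≃ Fin 4 := ⟨swapIdx, swapIdx, swapIdx_swapIdx, swapIdx_swapIdx⟩

lemma sigma7_apply (z : S7) (a : Fin 4) :
    (sigma7 z).1 a = swapSign a * (starRingEnd ℂ) (z.1 (swapIdx a)) := rfl

lemma sigma7_sigma7 (z : S7) : (sigma7 (sigma7 z)).1 = -z.1 := by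
  ext a
  have h : (swapSign a : ℂ) * swapSign a = 1 := by exact_mod_cast swapSign_mul_self a
  rw [sigma7_apply, sigma7_apply, swapIdx_swapIdx, swapSign_swapIdx, map_mul, Complex.conj_ofReal,
    Complex.conj_conj, ← mul_assoc, Complex.ofReal_neg, mul_neg, h, Pi.neg_apply]
  ring

/-- The sign by which the quaternionic structure acts on a monomial. -/
def monoSign (α : Fin 4 → ℕ) : ℝ := ∏ a, swapSign a ^ α a

lemma monoSign_mul_self (α : Fin 4 → ℕ) : monoSign α * monoSign α = 1 := by
  rw [monoSign, ← Finset.prod_mul_distrib]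
  exact Finset.prod_eq_one fun a _ => by rw [← mul_pow, swapSign_mul_self, one_pow]

lemma mono_sigma7 (α : Fin 4 → ℕ) (z : S7) :
    mono α (sigma7 z) = monoSign α * (starRingEnd ℂ) (mono (α ∘ swapIdx) z) := by
  simp only [mono_apply, sigma7_apply, mul_pow, Finset.prod_mul_distrib, monoSign, map_prod,
    map_pow, Complex.ofReal_prod, Complex.ofReal_pow]
  congr 1
  refine Fintype.prod_equiv swapEquiv _ _ fun a => ?_
  change _ = (starRingEnd ℂ) (z.1 (swapIdx a)) ^ α (swapIdx (swapIdx a))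
  rw [swapIdx_swapIdx]

lemma moment_comp_swapIdx (α : Fin 4 → ℕ) : moment (α ∘ swapIdx) = moment α := by
  have h1 : ∑ a, (α ∘ swapIdx) a = ∑ a, α a := Equiv.sum_comp swapEquiv α
  have h2 : ∏ a, (((α ∘ swapIdx) a).factorial : ℝ) = ∏ a, ((α a).factorial : ℝ) :=
    Equiv.prod_comp swapEquiv fun a => ((α a).factorial : ℝ)
  rw [moment, moment, h1, h2]

lemma sphInt_mono (α β : Fin 4 → ℕ) :
    sphInt (star (mono α) * mono β) = if α = β then (moment α : ℂ) else 0 := by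
  have hd := Complex.continuous_ofReal.comp continuous_density
  have h1 : sphInt (star (mono α) * mono β) = 1 / 2 * (∫ k : Fin 7 → I, (density k : ℂ) *
      ((starRingEnd ℂ) (mono α (cubeS7 k)) * mono β (cubeS7 k))) +
      (monoSign α * monoSign β / 2 : ℂ) * (∫ k : Fin 7 → I, (density k : ℂ) *
      ((starRingEnd ℂ) (mono (β ∘ swapIdx) (cubeS7 k)) * mono (α ∘ swapIdx) (cubeS7 k))) := by
    rw [← integral_const_mul, ← integral_const_mul, sphInt_apply, ← integral_add]
    · congr 1 with k
      simp only [ContinuousMap.mul_apply, ContinuousMap.star_apply, mono_sigma7, star_mul',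
        RCLike.star_def, Complex.conj_ofReal, Complex.conj_conj]
      ring
    · exact integrable_cube (continuous_const.mul (hd.mul
        ((Complex.continuous_conj.comp (by fun_prop)).mul (by fun_prop))))
    · exact integrable_cube (continuous_const.mul (hd.mul
        ((Complex.continuous_conj.comp (by fun_prop)).mul (by fun_prop))))
  rw [h1, integral_cube_moment, integral_cube_moment]
  by_cases h : α = β
  · subst h
    rw [if_pos rfl, if_pos rfl, moment_comp_swapIdx]
    have h2 : (monoSign α : ℂ) * monoSign α = 1 := by exact_mod_cast monoSign_mul_self α
    rw [h2]
    ring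
  · have h2 : ¬ β ∘ swapIdx = α ∘ swapIdx := fun h2 => h (by
      ext a
      have h3 := congrFun h2 (swapIdx a)
      simpa [swapIdx_swapIdx] using h3.symm)
    rw [if_neg h, if_neg h2]
    simp

end SphereIntegral

section Approximation

/-- The square of the `L²` norm on the unit sphere. -/
noncomputable def sqNorm (F : C(S7, ℂ)) : ℝ := (sphInt (star F * F)).re

lemma star_mul_self_apply (F : C(S7, ℂ)) (z : S7) : (star F * F) z = ((‖F z‖ ^ 2 : ℝ) : ℂ) := by
  rw [ContinuousMap.mul_apply, ContinuousMap.star_apply, RCLike.star_def, Complex.conj_mul']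
  push_cast
  rfl

lemma sum_sqNorm_le {ι κ : Type*} [Fintype ι] [Fintype κ] (F : ι → C(S7, ℂ)) (G : κ → C(S7, ℂ))
    (c : κ → ℝ) (h : ∀ z, ∑ i, ‖F i z‖ ^ 2 ≤ ∑ j, c j * ‖G j z‖ ^ 2) :
    ∑ i, sqNorm (F i) ≤ ∑ j, c j * sqNorm (G j) := by
  have h1 := sphInt_re_mono (F := ∑ i, star (F i) * F i)
    (G := ∑ j, (c j : ℂ) • (star (G j) * G j)) fun z => by
    rw [ContinuousMap.coe_sum, ContinuousMap.coe_sum, Finset.sum_apply, Finset.sum_apply,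
      Complex.re_sum, Complex.re_sum]
    refine (le_of_eq ?_).trans ((h z).trans (le_of_eq ?_))
    · exact Finset.sum_congr rfl fun i _ => by rw [star_mul_self_apply, Complex.ofReal_re]
    · refine Finset.sum_congr rfl fun i _ => ?_
      rw [ContinuousMap.smul_apply, star_mul_self_apply, smul_eq_mul, Complex.re_ofReal_mul,
        Complex.ofReal_re]
  rw [map_sum, map_sum, Complex.re_sum, Complex.re_sum] at h1
  refine h1.trans (le_of_eq (Finset.sum_congr rfl fun j _ => ?_))
  rw [map_smul, smul_eq_mul, Complex.re_ofReal_mul, sqNorm]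

lemma sqNorm_le {F G : C(S7, ℂ)} {c : ℝ} (h : ∀ z, ‖F z‖ ^ 2 ≤ c * ‖G z‖ ^ 2) :
    sqNorm F ≤ c * sqNorm G := by
  simpa using sum_sqNorm_le (fun _ : Unit => F) (fun _ : Unit => G) (fun _ => c) (by simpa using h)

lemma sqNorm_mul_le {h F : C(S7, ℂ)} {C : ℝ} (hC : ∀ z, ‖h z‖ ≤ C) :
    sqNorm (h * F) ≤ C ^ 2 * sqNorm F :=
  sqNorm_le fun z => by
    rw [ContinuousMap.mul_apply, norm_mul, mul_pow]
    gcongr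
    exact hC z

lemma sqNorm_add_le (F G : C(S7, ℂ)) : sqNorm (F + G) ≤ 2 * sqNorm F + 2 * sqNorm G := by
  have h := sum_sqNorm_le (fun _ : Unit => F + G) ![F, G] (fun _ => 2) fun z => by
    simp only [Finset.univ_unique, Finset.sum_singleton, Fin.sum_univ_two, cons_val_zero,
      cons_val_one, ContinuousMap.add_apply]
    have h1 := norm_add_le (F z) (G z)
    nlinarith [norm_nonneg (F z + G z), sq_nonneg (‖F z‖ - ‖G z‖), norm_nonneg (F z),
      norm_nonneg (G z)]
  simpa [Fin.sum_univ_two] using h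

lemma sqNorm_nonneg (F : C(S7, ℂ)) : 0 ≤ sqNorm F := by
  have h := sqNorm_le (F := 0) (G := F) (c := 1) fun z => by simp
  simpa [sqNorm] using h

lemma sqNorm_sum {ι : Type*} [Fintype ι] [DecidableEq ι] (p : ι → C(S7, ℂ)) (w : ι → ℝ)
    (h : ∀ i j, sphInt (star (p i) * p j) = if i = j then (w i : ℂ) else 0) (c : ι → ℂ) :
    sqNorm (∑ i, c i • p i) = ∑ i, ‖c i‖ ^ 2 * w i := by
  have h1 : star (∑ i, c i • p i) * (∑ i, c i • p i) =
      ∑ i, ∑ j, ((starRingEnd ℂ) (c i) * c j) • (star (p i) * p j) := by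
    rw [star_sum, Finset.sum_mul_sum]
    refine Finset.sum_congr rfl fun i _ => Finset.sum_congr rfl fun j _ => ?_
    rw [star_smul, smul_mul_smul_comm]
    rfl
  rw [sqNorm, h1, map_sum, Complex.re_sum]
  refine Finset.sum_congr rfl fun i _ => ?_
  simp only [map_sum, map_smul, h, smul_eq_mul, mul_ite, mul_zero, Finset.sum_ite_eq,
    Finset.mem_univ, if_true]
  rw [Complex.conj_mul', Complex.re_mul_ofReal]
  norm_cast

/-- The multi-indices of degree `N`. -/
abbrev Idx (N : ℕ) := {α : Fin 4 → ℕ // α ∈ Finset.Nat.antidiagonalTuple 4 N}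

lemma Idx.sum_eq {N : ℕ} (α : Idx N) : ∑ a, α.1 a = N :=
  Finset.Nat.mem_antidiagonalTuple.1 α.2

/-- The homogeneous polynomials of degree `N`. -/
noncomputable def homPoly (N : ℕ) : Submodule ℂ C(S7, ℂ) :=
  Submodule.span ℂ (Set.range fun α : Idx N => mono α.1)

lemma mono_mem_homPoly {N : ℕ} {α : Fin 4 → ℕ} (h : ∑ a, α a = N) : mono α ∈ homPoly N :=
  Submodule.subset_span ⟨⟨α, Finset.Nat.mem_antidiagonalTuple.2 h⟩, rfl⟩

lemma sphInt_mono_idx {N : ℕ} (α β : Idx N) :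
    sphInt (star (mono α.1) * mono β.1) = if α = β then (moment α.1 : ℂ) else 0 := by
  rw [sphInt_mono]
  simp only [Subtype.ext_iff]

/-- The coordinates on the unit sphere. -/
def coord (a : Fin 4) : C(S7, ℂ) := ⟨fun z => z.1 a, (continuous_apply a).comp continuous_subtype_val⟩

lemma coord_mul_mono (b : Fin 4) (α : Fin 4 → ℕ) :
    coord b * mono α = mono (α + Pi.single b 1) := by
  ext z
  simp only [ContinuousMap.mul_apply, mono_apply, coord, ContinuousMap.coe_mk, Pi.add_apply,
    pow_add, Finset.prod_mul_distrib]
  rw [mul_comm]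
  congr 1
  rw [Finset.prod_eq_single b (fun a _ h => by simp [h]) (by simp)]
  simp

lemma sub_single_add_single {α : Fin 4 → ℕ} {b : Fin 4} (h : α b ≠ 0) :
    α - Pi.single b 1 + Pi.single b 1 = α := by
  ext a
  by_cases hab : a = b
  · subst hab; simp; omega
  · simp [hab]

lemma smul_coord_mul_mono (b : Fin 4) (α : Fin 4 → ℕ) :
    (α b : ℂ) • (coord b * mono (α - Pi.single b 1)) = (α b : ℂ) • mono α := by
  by_cases h : α b = 0
  · simp [h]
  · rw [coord_mul_mono, sub_single_add_single h]

lemma sphInt_conj_coord_mul_mono_sub {N : ℕ} (b : Fin 4) (α β : Idx N) :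
    sphInt (star (star (coord b) * mono α.1 -
        ((α.1 b : ℂ) / (N + 3)) • mono (α.1 - Pi.single b 1)) *
      (star (coord b) * mono β.1 - ((β.1 b : ℂ) / (N + 3)) • mono (β.1 - Pi.single b 1))) =
    if α = β then ((moment α.1 * ((α.1 b + 1) / (N + 4) - α.1 b / (N + 3)) : ℝ) : ℂ) else 0 := by
  have hN3 : ((N : ℂ) + 3) ≠ 0 := by exact_mod_cast (Nat.succ_ne_zero (N + 2))
  have hN3' : ((N : ℝ) + 3) ≠ 0 := by positivity
  have hN4' : ((N : ℝ) + 4) ≠ 0 := by positivity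
  have hr : ∀ γ : Idx N, ((γ.1 b : ℂ) / (N + 3)) • (coord b * mono (γ.1 - Pi.single b 1)) =
      ((γ.1 b : ℂ) / (N + 3)) • mono γ.1 := fun γ => by
    rw [div_eq_inv_mul, mul_smul, mul_smul, smul_coord_mul_mono]
  have hs : ∀ γ : Idx N, star ((γ.1 b : ℂ) / (N + 3)) = (γ.1 b : ℂ) / (N + 3) := fun γ => by simp
  have h1 : star (star (coord b) * mono α.1 -
        ((α.1 b : ℂ) / (N + 3)) • mono (α.1 - Pi.single b 1)) *
      (star (coord b) * mono β.1 - ((β.1 b : ℂ) / (N + 3)) • mono (β.1 - Pi.single b 1)) =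
      star (mono (α.1 + Pi.single b 1)) * mono (β.1 + Pi.single b 1) -
      ((β.1 b : ℂ) / (N + 3)) • (star (mono α.1) * mono β.1) -
      ((α.1 b : ℂ) / (N + 3)) • (star (mono α.1) * mono β.1) +
      ((α.1 b : ℂ) / (N + 3) * ((β.1 b : ℂ) / (N + 3))) •
        (star (mono (α.1 - Pi.single b 1)) * mono (β.1 - Pi.single b 1)) := by
    have hβ : ((β.1 b : ℂ) / (N + 3)) • (star (mono α.1) * mono β.1) =
        ((β.1 b : ℂ) / (N + 3)) •
          (star (mono α.1) * (coord b * mono (β.1 - Pi.single b 1))) := by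
      rw [← mul_smul_comm, ← hr β, mul_smul_comm]
    have hα : ((α.1 b : ℂ) / (N + 3)) • (star (mono α.1) * mono β.1) =
        ((α.1 b : ℂ) / (N + 3)) •
          (star (coord b * mono (α.1 - Pi.single b 1)) * mono β.1) := by
      rw [← smul_mul_assoc, ← smul_mul_assoc]
      congr 1
      rw [← hs α, ← star_smul, ← star_smul, hr α]
    rw [hβ, hα, ← coord_mul_mono, ← coord_mul_mono]
    simp only [star_sub, star_mul', star_star, star_smul, hs, sub_mul, mul_sub,
      smul_mul_assoc, mul_smul_comm]
    rw [show star (coord b) * star (mono α.1) * (coord b * mono β.1) =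
      coord b * star (mono α.1) * (star (coord b) * mono β.1) by ring,
      show star (mono α.1) * (coord b * mono (β.1 - Pi.single b 1)) =
        coord b * star (mono α.1) * mono (β.1 - Pi.single b 1) by ring,
      show star (coord b) * star (mono (α.1 - Pi.single b 1)) * mono β.1 =
        star (mono (α.1 - Pi.single b 1)) * (star (coord b) * mono β.1) by ring,
      smul_sub, smul_smul, mul_comm ((β.1 b : ℂ) / (N + 3))]
    abel
  rw [h1, map_add, map_sub, map_sub, map_smul, map_smul, map_smul, sphInt_mono, sphInt_mono,
    sphInt_mono]
  by_cases h : α = β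
  · subst h
    simp only [if_true, smul_eq_mul]
    have h2 := moment_add_single α.1 b
    rw [α.sum_eq] at h2
    have h3 : (α.1 b : ℝ) / (N + 3) * (α.1 b / (N + 3)) * moment (α.1 - Pi.single b 1) =
        α.1 b / (N + 3) * moment α.1 := by
      by_cases h0 : α.1 b = 0
      · simp [h0]
      · have h4 := moment_add_single (α.1 - Pi.single b 1) b
        have h5 : ∑ a, (α.1 - Pi.single b 1 : Fin 4 → ℕ) a + 1 = N := by
          have h6 := α.sum_eq
          conv_lhs at h6 => rw [← sub_single_add_single h0]
          simpa [Finset.sum_add_distrib] using h6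
        rw [sub_single_add_single h0, show ∑ a, (α.1 - Pi.single b 1 : Fin 4 → ℕ) a + 4 = N + 3 by
          omega, show (α.1 - Pi.single b 1 : Fin 4 → ℕ) b + 1 = α.1 b by simp; omega] at h4
        push_cast at h4
        field_simp
        linear_combination -h4
    have h6 : moment (α.1 + Pi.single b 1) = moment α.1 * ((α.1 b + 1) / (N + 4)) := by
      push_cast at h2
      field_simp
      linear_combination h2
    rw [h6]
    have h7 : ((α.1 b : ℂ) / (N + 3) * (α.1 b / (N + 3)) * (moment (α.1 - Pi.single b 1) : ℝ)) =
        α.1 b / (N + 3) * (moment α.1 : ℝ) := by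
      have h8 := congrArg (fun r : ℝ => (r : ℂ)) h3
      push_cast at h8
      exact h8
    rw [h7]
    push_cast
    ring
  · have hne : ¬ α.1 = β.1 := fun h' => h (Subtype.ext h')
    have hne' : ¬ α.1 + Pi.single b 1 = β.1 + Pi.single b 1 := fun h' => hne (add_right_cancel h')
    rw [if_neg hne, if_neg hne', if_neg h]
    by_cases h0 : α.1 b = 0
    · simp [h0]
    by_cases h0' : β.1 b = 0
    · simp [h0']
    rw [if_neg fun h' => hne (by
      rw [← sub_single_add_single h0, h', sub_single_add_single h0'])]
    simp

lemma exists_approx_coord_mul_conj_coord (a b : Fin 4) {N : ℕ} {ψ : C(S7, ℂ)}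
    (hψ : ψ ∈ homPoly N) :
    ∃ χ ∈ homPoly N, sqNorm (coord a * star (coord b) * ψ - χ) ≤ 1 / (N + 4) * sqNorm ψ := by
  obtain ⟨c, rfl⟩ := (Submodule.mem_span_range_iff_exists_fun ℂ).1 hψ
  refine ⟨∑ α : Idx N, (c α * (α.1 b / (N + 3))) • (coord a * mono (α.1 - Pi.single b 1)),
    Submodule.sum_mem _ fun α _ => ?_, ?_⟩
  · by_cases h0 : α.1 b = 0
    · simp [h0]
    · refine Submodule.smul_mem _ _ ?_
      rw [coord_mul_mono]
      refine mono_mem_homPoly ?_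
      have h6 := α.sum_eq
      conv_lhs at h6 => rw [← sub_single_add_single h0]
      simp only [Pi.add_apply, Finset.sum_add_distrib, Finset.sum_pi_single', Finset.mem_univ,
        if_true] at h6 ⊢
      simpa using h6
  · have h1 : coord a * star (coord b) * (∑ α : Idx N, c α • mono α.1) -
        ∑ α : Idx N, (c α * (α.1 b / (N + 3))) • (coord a * mono (α.1 - Pi.single b 1)) =
        coord a * ∑ α : Idx N, c α • (star (coord b) * mono α.1 -
          ((α.1 b : ℂ) / (N + 3)) • mono (α.1 - Pi.single b 1)) := by
      rw [Finset.mul_sum, Finset.mul_sum, ← Finset.sum_sub_distrib]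
      refine Finset.sum_congr rfl fun α _ => ?_
      rw [smul_sub, mul_sub, mul_smul_comm, mul_smul_comm, smul_smul, mul_smul_comm, mul_assoc]
    rw [h1]
    refine (sqNorm_mul_le (C := 1) fun z => norm_le_one_of_S7 z a).trans ?_
    rw [one_pow, one_mul, sqNorm_sum _ _ (sphInt_conj_coord_mul_mono_sub b),
      sqNorm_sum _ _ sphInt_mono_idx, Finset.mul_sum]
    refine Finset.sum_le_sum fun α _ => ?_
    have h2 : ((α.1 b : ℝ) + 1) / (N + 4) - α.1 b / (N + 3) ≤ 1 / (N + 4) := by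
      have h3 : (α.1 b : ℝ) / (N + 4) ≤ α.1 b / (N + 3) := by gcongr; norm_num
      rw [add_div]
      linarith
    have h3 := mul_le_mul_of_nonneg_left h2
      (mul_nonneg (sq_nonneg ‖c α‖) (moment_pos α.1).le)
    linarith

end Approximation

section Symbols

/-- The restriction of a function on `S⁷ × I` to a slice. -/
noncomputable def slice (h : C(S7 × I, ℂ)) (t : I) : C(S7, ℂ) := ⟨fun z => h (z, t), by fun_prop⟩

lemma slice_apply (h : C(S7 × I, ℂ)) (t : I) (z : S7) : slice h t z = h (z, t) := rfl

/-- Multiplication by the function asymptotically preserves homogeneous polynomials. -/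
def Approx (h : C(S7 × I, ℂ)) : Prop :=
  ∀ ε > 0, ∃ N₀ : ℕ, ∀ N ≥ N₀, ∀ t, ∀ ψ ∈ homPoly N, ∃ χ ∈ homPoly N,
    sqNorm (slice h t * ψ - χ) ≤ ε * sqNorm ψ

lemma exists_bound (h : C(S7 × I, ℂ)) : ∃ C : ℝ, 1 ≤ C ∧ ∀ t z, ‖slice h t z‖ ≤ C :=
  ⟨max 1 ‖h‖, le_max_left _ _, fun t z => (h.norm_coe_le_norm (z, t)).trans (le_max_right _ _)⟩

lemma approx_of_slice_eq {h : C(S7 × I, ℂ)} (c : I → ℂ) (hc : ∀ z t, h (z, t) = c t) :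
    Approx h := fun ε hε => ⟨0, fun N _ t ψ hψ => ⟨c t • ψ, Submodule.smul_mem _ _ hψ, by
  have h1 : slice h t * ψ - c t • ψ = 0 := by
    ext z
    simp [slice_apply, hc]
  rw [h1]
  simpa [sqNorm] using mul_nonneg hε.le (sqNorm_nonneg ψ)⟩⟩

lemma Approx.add {h k : C(S7 × I, ℂ)} (hh : Approx h) (hk : Approx k) : Approx (h + k) := by
  intro ε hε
  obtain ⟨N₁, h₁⟩ := hh (ε / 4) (by positivity)
  obtain ⟨N₂, h₂⟩ := hk (ε / 4) (by positivity)
  refine ⟨max N₁ N₂, fun N hN t ψ hψ => ?_⟩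
  obtain ⟨χ₁, hχ₁, e₁⟩ := h₁ N ((le_max_left _ _).trans hN) t ψ hψ
  obtain ⟨χ₂, hχ₂, e₂⟩ := h₂ N ((le_max_right _ _).trans hN) t ψ hψ
  refine ⟨χ₁ + χ₂, Submodule.add_mem _ hχ₁ hχ₂, ?_⟩
  rw [show slice (h + k) t * ψ - (χ₁ + χ₂) = (slice h t * ψ - χ₁) + (slice k t * ψ - χ₂) by
    ext z; simp [slice_apply]; ring]
  have h3 := sqNorm_add_le (slice h t * ψ - χ₁) (slice k t * ψ - χ₂)
  linarith

lemma Approx.mul {h k : C(S7 × I, ℂ)} (hh : Approx h) (hk : Approx k) : Approx (h * k) := by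
  intro ε hε
  obtain ⟨C, hC1, hC⟩ := exists_bound h
  obtain ⟨D, hD1, hD⟩ := exists_bound k
  have hC0 : 0 < C := by linarith
  set δ := ε / (4 * C ^ 2) with hδ
  have hδ0 : 0 < δ := by positivity
  set η := ε / (4 * (2 * D ^ 2 + 2 * δ)) with hη
  have hη0 : 0 < η := by positivity
  obtain ⟨N₁, h₁⟩ := hh η hη0
  obtain ⟨N₂, h₂⟩ := hk δ hδ0
  refine ⟨max N₁ N₂, fun N hN t ψ hψ => ?_⟩
  obtain ⟨χ₂, hχ₂, e₂⟩ := h₂ N ((le_max_right _ _).trans hN) t ψ hψ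
  obtain ⟨χ₁, hχ₁, e₁⟩ := h₁ N ((le_max_left _ _).trans hN) t χ₂ hχ₂
  refine ⟨χ₁, hχ₁, ?_⟩
  rw [show slice (h * k) t * ψ - χ₁ =
      slice h t * (slice k t * ψ - χ₂) + (slice h t * χ₂ - χ₁) by
    ext z; simp [slice_apply]; ring]
  have h3 := sqNorm_add_le (slice h t * (slice k t * ψ - χ₂)) (slice h t * χ₂ - χ₁)
  have h4 := sqNorm_mul_le (F := slice k t * ψ - χ₂) (hC t)
  have h5 : sqNorm χ₂ ≤ (2 * D ^ 2 + 2 * δ) * sqNorm ψ := by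
    have h6 := sqNorm_add_le (slice k t * ψ) (-(slice k t * ψ - χ₂))
    rw [show slice k t * ψ + -(slice k t * ψ - χ₂) = χ₂ by abel] at h6
    have h7 : sqNorm (-(slice k t * ψ - χ₂)) ≤ 1 * sqNorm (slice k t * ψ - χ₂) :=
      sqNorm_le fun z => by rw [ContinuousMap.neg_apply, norm_neg, one_mul]
    have h8 := sqNorm_mul_le (F := ψ) (hD t)
    linarith
  have h9 : C ^ 2 * sqNorm (slice k t * ψ - χ₂) ≤ C ^ 2 * (δ * sqNorm ψ) := by gcongr
  have h10 : η * sqNorm χ₂ ≤ η * ((2 * D ^ 2 + 2 * δ) * sqNorm ψ) := by gcongr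
  have h11 : C ^ 2 * (δ * sqNorm ψ) = ε / 4 * sqNorm ψ := by rw [hδ]; field_simp
  have h12 : η * ((2 * D ^ 2 + 2 * δ) * sqNorm ψ) = ε / 4 * sqNorm ψ := by
    have : 2 * D ^ 2 + 2 * δ ≠ 0 := by positivity
    rw [hη]; field_simp
  linarith

lemma approx_of_near {h : C(S7 × I, ℂ)}
    (hn : ∀ ε > 0, ∃ k, Approx k ∧ ∀ x, ‖h x - k x‖ ≤ ε) : Approx h := by
  intro ε hε
  obtain ⟨k, hk, hkh⟩ := hn (√(ε / 4)) (by positivity)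
  obtain ⟨N₀, h₀⟩ := hk (ε / 4) (by positivity)
  refine ⟨N₀, fun N hN t ψ hψ => ?_⟩
  obtain ⟨χ, hχ, e⟩ := h₀ N hN t ψ hψ
  refine ⟨χ, hχ, ?_⟩
  rw [show slice h t * ψ - χ = (slice h t - slice k t) * ψ + (slice k t * ψ - χ) by ring]
  have h3 := sqNorm_add_le ((slice h t - slice k t) * ψ) (slice k t * ψ - χ)
  have h4 := sqNorm_mul_le (h := slice h t - slice k t) (F := ψ) fun z => hkh (z, t)
  rw [Real.sq_sqrt (by positivity)] at h4
  linarith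

lemma approx_coord_mul_conj_coord (a b : Fin 4) {h : C(S7 × I, ℂ)}
    (hh : ∀ z t, h (z, t) = z.1 a * (starRingEnd ℂ) (z.1 b)) : Approx h := by
  intro ε hε
  obtain ⟨N₀, hN₀⟩ := exists_nat_gt (1 / ε)
  refine ⟨N₀, fun N hN t ψ hψ => ?_⟩
  obtain ⟨χ, hχ, e⟩ := exists_approx_coord_mul_conj_coord a b hψ
  refine ⟨χ, hχ, ?_⟩
  rw [show slice h t = coord a * star (coord b) by
    ext z; simp [slice_apply, hh, coord]]
  refine e.trans (mul_le_mul_of_nonneg_right ?_ (sqNorm_nonneg ψ))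
  rw [div_le_iff₀ (by positivity)]
  rw [div_lt_iff₀ hε] at hN₀
  have : (N₀ : ℝ) ≤ N := Nat.cast_le.2 hN
  nlinarith

/-- The quadratic Hopf map `ℂ⁴ → ℝ⁵`. -/
noncomputable def hopfVec (v : Fin 4 → ℂ) : Fin 5 → ℝ :=
  ![Complex.normSq (v 0) + Complex.normSq (v 1) - Complex.normSq (v 2) - Complex.normSq (v 3),
    (2 * (v 0 * (starRingEnd ℂ) (v 2) + v 3 * (starRingEnd ℂ) (v 1))).re,
    (2 * (v 0 * (starRingEnd ℂ) (v 2) + v 3 * (starRingEnd ℂ) (v 1))).im,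
    (2 * (v 1 * (starRingEnd ℂ) (v 2) - v 3 * (starRingEnd ℂ) (v 0))).re,
    (2 * (v 1 * (starRingEnd ℂ) (v 2) - v 3 * (starRingEnd ℂ) (v 0))).im]

lemma hopfVec_dotProduct_self {v : Fin 4 → ℂ} (h : ∑ a, Complex.normSq (v a) = 1) :
    hopfVec v ⬝ᵥ hopfVec v = 1 := by
  rw [Fin.sum_univ_four] at h
  simp only [dotProduct, Fin.sum_univ_five, Complex.normSq_apply, hopfVec] at h ⊢
  simp
  have h2 := congrArg (fun x : ℝ => x ^ 2) h
  linear_combination h2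

lemma continuous_hopfVec : Continuous hopfVec := by
  refine continuous_pi fun i => ?_
  have hn := Complex.continuous_normSq
  have hr := Complex.continuous_re
  have hi := Complex.continuous_im
  have hc := Complex.continuous_conj
  fin_cases i <;> simp only [hopfVec, Fin.zero_eta, Fin.mk_one, Fin.reduceFinMk, cons_val]
  · fun_prop
  · exact hr.comp (by fun_prop)
  · exact hi.comp (by fun_prop)
  · exact hr.comp (by fun_prop)
  · exact hi.comp (by fun_prop)

/-- The quotient map from the unit sphere of `ℂ⁴` to the four-sphere. -/
noncomputable def hopf7 : C(S7, Sph 5) where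
  toFun z := ⟨hopfVec z.1, hopfVec_dotProduct_self z.2⟩
  continuous_toFun :=
    Continuous.subtype_mk (continuous_hopfVec.comp continuous_subtype_val) _

lemma approx_hopf7_coord (i : Fin 5) {h : C(S7 × I, ℂ)}
    (hh : ∀ z t, h (z, t) = (((hopf7 z).1 i : ℝ) : ℂ)) : Approx h := by
  have hc : ∀ a, Continuous fun p : S7 × I => p.1.1 a := fun a =>
    (continuous_apply a).comp (continuous_subtype_val.comp continuous_fst)
  let w : Fin 4 → Fin 4 → C(S7 × I, ℂ) := fun a b =>
    ⟨fun p => p.1.1 a * (starRingEnd ℂ) (p.1.1 b),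
      (hc a).mul (Complex.continuous_conj.comp (hc b))⟩
  have hw : ∀ a b, Approx (w a b) := fun a b => approx_coord_mul_conj_coord a b fun _ _ => rfl
  have hcw : ∀ (c : ℂ) a b, Approx (ContinuousMap.const _ c * w a b) := fun c a b =>
    (approx_of_slice_eq (fun _ => c) fun _ _ => rfl).mul (hw a b)
  have key : ∀ c₁ c₂ c₃ c₄ a₁ b₁ a₂ b₂ a₃ b₃ a₄ b₄, (∀ z : S7, (((hopf7 z).1 i : ℝ) : ℂ) =
      c₁ * (z.1 a₁ * (starRingEnd ℂ) (z.1 b₁)) + c₂ * (z.1 a₂ * (starRingEnd ℂ) (z.1 b₂)) +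
      c₃ * (z.1 a₃ * (starRingEnd ℂ) (z.1 b₃)) + c₄ * (z.1 a₄ * (starRingEnd ℂ) (z.1 b₄))) →
      Approx h := by
    intro c₁ c₂ c₃ c₄ a₁ b₁ a₂ b₂ a₃ b₃ a₄ b₄ he
    have h1 := (((hcw c₁ a₁ b₁).add (hcw c₂ a₂ b₂)).add (hcw c₃ a₃ b₃)).add (hcw c₄ a₄ b₄)
    convert h1 using 1
    ext p
    exact (hh p.1 p.2).trans (he p.1)
  fin_cases i
  · refine key 1 1 (-1) (-1) 0 0 1 1 2 2 3 3 fun z => ?_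
    simp [hopf7, hopfVec, Complex.mul_conj]
    ring
  · refine key 1 1 1 1 0 2 2 0 3 1 1 3 fun z => ?_
    apply Complex.ext <;> simp [hopf7, hopfVec] <;> ring
  · refine key (-Complex.I) Complex.I (-Complex.I) Complex.I 0 2 2 0 3 1 1 3 fun z => ?_
    apply Complex.ext <;> simp [hopf7, hopfVec] <;> ring
  · refine key 1 1 (-1) (-1) 1 2 2 1 3 0 0 3 fun z => ?_
    apply Complex.ext <;> simp [hopf7, hopfVec] <;> ring
  · refine key (-Complex.I) Complex.I Complex.I (-Complex.I) 1 2 2 1 3 0 0 3 fun z => ?_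
    apply Complex.ext <;> simp [hopf7, hopfVec] <;> ring

/-- The pullback along the Hopf map of a function on the product of the four-sphere with `I`. -/
noncomputable def hopfPull (F : C(Sph 5 × I, ℂ)) : C(S7 × I, ℂ) :=
  F.comp (hopf7.prodMap (ContinuousMap.id I))

/-- A real function as a complex one. -/
noncomputable def ofRealMap {X : Type*} [TopologicalSpace X] (g : C(X, ℝ)) : C(X, ℂ) :=
  ⟨fun x => (g x : ℂ), Complex.continuous_ofReal.comp g.continuous⟩

/-- The real functions whose pullbacks asymptotically preserve homogeneous polynomials. -/
noncomputable def approxSubalgebra : Subalgebra ℝ C(Sph 5 × I, ℝ) where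
  carrier := {g | Approx (hopfPull (ofRealMap g))}
  mul_mem' {g k} hg hk := by
    have h : hopfPull (ofRealMap (g * k)) = hopfPull (ofRealMap g) * hopfPull (ofRealMap k) := by
      ext x; simp [hopfPull, ofRealMap]
    rw [Set.mem_ofPred_eq, h]
    exact Approx.mul hg hk
  add_mem' {g k} hg hk := by
    have h : hopfPull (ofRealMap (g + k)) = hopfPull (ofRealMap g) + hopfPull (ofRealMap k) := by
      ext x; simp [hopfPull, ofRealMap]
    rw [Set.mem_ofPred_eq, h]
    exact Approx.add hg hk
  algebraMap_mem' r := approx_of_slice_eq (fun _ => r) fun _ _ => rfl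

lemma approx_hopfPull_ofRealMap (g : C(Sph 5 × I, ℝ)) : Approx (hopfPull (ofRealMap g)) := by
  have hsep : approxSubalgebra.SeparatesPoints := by
    rintro ⟨x, s⟩ ⟨y, t⟩ hne
    by_cases hst : s = t
    · have hxy : x.1 ≠ y.1 := fun h => hne (by rw [Subtype.ext h, hst])
      obtain ⟨i, hi⟩ := Function.ne_iff.1 hxy
      refine ⟨_, ⟨⟨fun p : Sph 5 × I => p.1.1 i, (continuous_apply i).comp
        (continuous_subtype_val.comp continuous_fst)⟩, ?_, rfl⟩, hi⟩
      exact approx_hopf7_coord i fun _ _ => rfl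
    · refine ⟨_, ⟨⟨fun p : Sph 5 × I => (p.2 : ℝ), continuous_subtype_val.comp continuous_snd⟩,
        ?_, rfl⟩, fun h => hst (Subtype.ext h)⟩
      exact approx_of_slice_eq (fun t => ((t : ℝ) : ℂ)) fun _ _ => rfl
  refine approx_of_near fun ε hε => ?_
  obtain ⟨k, hk⟩ := ContinuousMap.exists_mem_subalgebra_near_continuousMap_of_separatesPoints
    approxSubalgebra hsep g ε hε
  refine ⟨_, k.2, fun p => ?_⟩
  have h1 := (ContinuousMap.norm_coe_le_norm (k.1 - g) (hopf7 p.1, p.2)).trans hk.le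
  rw [norm_sub_rev]
  calc _ = ‖(((k.1 - g) (hopf7 p.1, p.2) : ℝ) : ℂ)‖ := by
        rw [ContinuousMap.sub_apply, Complex.ofReal_sub]
        rfl
    _ ≤ ε := by rwa [Complex.norm_real]

lemma approx_hopfPull (F : C(Sph 5 × I, ℂ)) : Approx (hopfPull F) := by
  have h1 := approx_hopfPull_ofRealMap ⟨fun p => (F p).re, Complex.continuous_re.comp F.continuous⟩
  have h2 := approx_hopfPull_ofRealMap ⟨fun p => (F p).im, Complex.continuous_im.comp F.continuous⟩
  have h3 : Approx (ContinuousMap.const _ Complex.I) :=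
    approx_of_slice_eq (fun _ => Complex.I) fun _ _ => rfl
  convert h1.add (h2.mul h3) using 1
  ext p
  exact (Complex.re_add_im (F (hopf7 p.1, p.2))).symm

end Symbols

section Toeplitz

lemma sqNorm_le_sqNorm_sub {Φ χ : C(S7, ℂ)} (h : sphInt (star χ * Φ) = 0) :
    sqNorm Φ ≤ sqNorm (Φ - χ) := by
  have h1 : star (Φ - χ) * (Φ - χ) = star Φ * Φ - star χ * Φ - star (star χ * Φ) + star χ * χ := by
    rw [star_sub, star_mul', star_star]
    ring
  have h2 : sqNorm (Φ - χ) = sqNorm Φ + sqNorm χ := by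
    rw [sqNorm, h1, map_add, map_sub, map_sub, sphInt_star, h]
    simp [sqNorm]
  have := sqNorm_nonneg χ
  linarith

lemma sphInt_star_mul_eq_zero {N : ℕ} {Φ χ : C(S7, ℂ)}
    (h : ∀ α : Idx N, sphInt (star (mono α.1) * Φ) = 0) (hχ : χ ∈ homPoly N) :
    sphInt (star χ * Φ) = 0 := by
  obtain ⟨c, rfl⟩ := (Submodule.mem_span_range_iff_exists_fun ℂ).1 hχ
  rw [star_sum, Finset.sum_mul, map_sum]
  refine Finset.sum_eq_zero fun α _ => ?_
  rw [star_smul, smul_mul_assoc, map_smul, h α, smul_zero]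

lemma sqNorm_sum_le (F : Fin 4 → C(S7, ℂ)) : sqNorm (∑ j, F j) ≤ 4 * ∑ j, sqNorm (F j) := by
  have h := sum_sqNorm_le (fun _ : Unit => ∑ j, F j) F (fun _ => 4) fun z => by
    rw [Finset.univ_unique, Finset.sum_singleton, ContinuousMap.coe_sum, Finset.sum_apply]
    have h1 := norm_sum_le Finset.univ fun j => F j z
    have h2 := sq_sum_le_card_mul_sum_sq (s := Finset.univ) (f := fun j => ‖F j z‖)
    rw [← Finset.mul_sum]
    refine (pow_le_pow_left₀ (norm_nonneg _) h1 2).trans (h2.trans (le_of_eq ?_))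
    simp
  simpa [Finset.mul_sum] using h

/-- The compression of multiplication by a matrix of functions to homogeneous polynomials. -/
noncomputable def toep (N : ℕ) (F : Fin 4 → Fin 4 → C(S7, ℂ)) :
    Matrix (Fin 4 × Idx N) (Fin 4 × Idx N) ℂ :=
  Matrix.of fun p q => sphInt (star (mono p.2.1) * (F p.1 q.1 * mono q.2.1)) / moment p.2.1

lemma toep_mulVec {N : ℕ} (F : Fin 4 → Fin 4 → C(S7, ℂ)) (c : Fin 4 × Idx N → ℂ) (i : Fin 4)
    (α : Idx N) : (toep N F *ᵥ c) (i, α) =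
      sphInt (star (mono α.1) * ∑ j, F i j * ∑ β, c (j, β) • mono β.1) / moment α.1 := by
  simp only [mulVec, dotProduct, toep, of_apply, Fintype.sum_prod_type, Finset.mul_sum, map_sum,
    Finset.sum_div, mul_smul_comm, map_smul, smul_eq_mul]
  exact Finset.sum_congr rfl fun j _ => Finset.sum_congr rfl fun β _ => by ring

lemma exists_det_toep_ne_zero (F : Fin 4 → Fin 4 → C(S7 × I, ℂ)) (happ : ∀ i j, Approx (F i j))
    (hu : ∀ t z (v : Fin 4 → ℂ), ∑ i, ‖∑ j, F i j (z, t) * v j‖ ^ 2 = ∑ j, ‖v j‖ ^ 2) :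
    ∃ N₀, ∀ N ≥ N₀, ∀ t, (toep N fun i j => slice (F i j) t).det ≠ 0 := by
  choose n hn using fun i j => happ i j (1 / 32) (by norm_num)
  refine ⟨∑ i, ∑ j, n i j, fun N hN t hdet => ?_⟩
  have hle : ∀ i j, n i j ≤ N := fun i j =>
    ((Finset.single_le_sum (f := fun j => n i j) (fun _ _ => Nat.zero_le _) (Finset.mem_univ j)).trans
      (Finset.single_le_sum (f := fun i => ∑ j, n i j) (fun _ _ => Nat.zero_le _)
        (Finset.mem_univ i))).trans hN
  obtain ⟨c, hc0, hc⟩ := Matrix.exists_mulVec_eq_zero_iff.2 hdet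
  set ψ : Fin 4 → C(S7, ℂ) := fun j => ∑ β : Idx N, c (j, β) • mono β.1 with hψ
  have hψN : ∀ j, ψ j ∈ homPoly N := fun j =>
    Submodule.sum_mem _ fun β _ => Submodule.smul_mem _ _ (mono_mem_homPoly β.sum_eq)
  set Φ : Fin 4 → C(S7, ℂ) := fun i => ∑ j, slice (F i j) t * ψ j with hΦ
  have horth : ∀ i (α : Idx N), sphInt (star (mono α.1) * Φ i) = 0 := fun i α => by
    have h1 := congrFun hc (i, α)
    rw [toep_mulVec, Pi.zero_apply, div_eq_zero_iff] at h1
    exact h1.resolve_right (Complex.ofReal_ne_zero.2 (moment_pos _).ne')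
  choose χ hχ hχe using fun i j => hn i j N (hle i j) t (ψ j) (hψN j)
  have h1 : ∀ i, sqNorm (Φ i) ≤ 4 * ∑ j, 1 / 32 * sqNorm (ψ j) := fun i => by
    refine (sqNorm_le_sqNorm_sub (sphInt_star_mul_eq_zero (horth i)
      (Submodule.sum_mem _ fun j _ => hχ i j : ∑ j, χ i j ∈ homPoly N))).trans ?_
    rw [hΦ, ← Finset.sum_sub_distrib]
    refine (sqNorm_sum_le _).trans ?_
    gcongr with j
    exact hχe i j
  have h2 : ∑ j, sqNorm (ψ j) ≤ ∑ i, 1 * sqNorm (Φ i) := by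
    refine sum_sqNorm_le ψ Φ (fun _ => 1) fun z => ?_
    rw [← hu t z fun j => ψ j z]
    refine le_of_eq (Finset.sum_congr rfl fun i _ => ?_)
    rw [hΦ, ContinuousMap.coe_sum, Finset.sum_apply, one_mul]
    rfl
  have h3 : ∑ j, sqNorm (ψ j) ≤ 0 := by
    simp only [one_mul] at h2
    have h4 := Finset.sum_le_sum fun i (_ : i ∈ Finset.univ) => h1 i
    rw [Finset.sum_const, Finset.card_univ, Fintype.card_fin, ← Finset.mul_sum] at h4
    norm_num at h4
    linarith
  have h5 : ∀ j, sqNorm (ψ j) = 0 := fun j =>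
    le_antisymm ((Finset.single_le_sum (f := fun j => sqNorm (ψ j)) (fun j _ => sqNorm_nonneg _)
      (Finset.mem_univ j)).trans h3) (sqNorm_nonneg _)
  refine hc0 (funext fun p => ?_)
  have h6 := h5 p.1
  rw [hψ, sqNorm_sum _ _ sphInt_mono_idx, Finset.sum_eq_zero_iff_of_nonneg
    fun β _ => mul_nonneg (sq_nonneg _) (moment_pos _).le] at h6
  have h7 := h6 p.2 (Finset.mem_univ _)
  simpa [(moment_pos p.2.1).ne'] using h7

lemma continuous_det_toep (N : ℕ) (F : Fin 4 → Fin 4 → C(S7 × I, ℂ)) :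
    Continuous fun t => (toep N fun i j => slice (F i j) t).det := by
  refine Continuous.matrix_det (continuous_matrix fun p q => ?_)
  have h : Continuous fun t => slice (F p.1 q.1) t := by
    have h1 : (fun t => slice (F p.1 q.1) t) =
        ((F p.1 q.1).comp ContinuousMap.prodSwap).curry := rfl
    rw [h1]
    exact ContinuousMap.continuous _
  simp only [toep, of_apply]
  refine Continuous.div_const ?_ _
  exact sphInt.continuous.comp (continuous_const.mul (h.mul continuous_const))

end Toeplitz

section Ladder

lemma card_idx (N : ℕ) : Fintype.card (Idx N) = (N + 3).choose 3 := by
  have h1 : Fintype.card (Idx N) = (Finset.finsuppAntidiag (Finset.univ : Finset (Fin 4)) N).card := by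
    rw [Fintype.card_coe, ← Finset.piAntidiag_univ_fin_eq_antidiagonalTuple]
    refine (Finset.card_nbij' (fun g => Finsupp.equivFunOnFinite.symm g) (fun f => (f : Fin 4 → ℕ))
      ?_ ?_ ?_ ?_)
    · intro f hf
      simpa using hf
    · intro f hf
      simpa using hf
    · intro f _
      ext; simp
    · intro f _
      ext; simp
  rw [h1, Finset.card_finsuppAntidiag_nat_eq_choose, Finset.card_univ, Fintype.card_fin,
    show 4 + N - 1 = N + 3 by omega, ← Nat.choose_symm_add]

lemma odd_card_idx_add {M : ℕ} (hM : Even M) :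
    Odd (Fintype.card (Idx M) + Fintype.card (Idx (M + 2))) := by
  rw [card_idx, card_idx]
  have h1 := Nat.choose_succ_succ' (M + 4) 2
  have h2 := Nat.choose_succ_succ' (M + 3) 2
  have h3 := Nat.choose_succ_succ' (M + 3) 1
  rw [Nat.choose_one_right] at h3
  obtain ⟨k, rfl⟩ := hM
  refine ⟨(k + k + 3).choose 3 + (k + k + 3).choose 2 + k + 1, ?_⟩
  simp only [show k + k + 2 + 3 = k + k + 4 + 1 by ring] at *
  norm_num [add_assoc] at *
  omega

lemma sum_idx_eq {N : ℕ} {γ : Fin 4 → ℕ} (hγ : ∑ a, γ a = N) {g : Idx N → ℂ}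
    (h : ∀ α : Idx N, α.1 ≠ γ → g α = 0) :
    ∑ α, g α = g ⟨γ, Finset.Nat.mem_antidiagonalTuple.2 hγ⟩ :=
  Finset.sum_eq_single _ (fun α _ hα => h α fun h' => hα (Subtype.ext h')) (by simp)

lemma sum_add_single (α : Fin 4 → ℕ) (b : Fin 4) :
    ∑ a, (α + Pi.single b 1 : Fin 4 → ℕ) a = ∑ a, α a + 1 := by
  simp [Finset.sum_add_distrib]

lemma sum_swapSign_mul (g : Fin 4 → ℂ) (hg : ∀ j, g (swapIdx j) = g j) :
    ∑ j, (swapSign j : ℂ) * g j = 0 := by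
  have h0 : g 1 = g 0 := hg 0
  have h2 : g 3 = g 2 := hg 2
  rw [Fin.sum_univ_four, h0, h2]
  simp [swapSign]

lemma swapIdx_ne (j : Fin 4) : swapIdx j ≠ j := by
  fin_cases j <;> decide

/-- The raising ladder operator. -/
noncomputable def ladderA (M : ℕ) : Matrix (Fin 4 × Idx (M + 1)) (Idx M ⊕ Idx (M + 2)) ℂ :=
  Matrix.of fun p => Sum.elim (fun δ => if p.2.1 = δ.1 + Pi.single p.1 1 then 1 else 0)
    fun η => if η.1 = p.2.1 + Pi.single (swapIdx p.1) 1 then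
      swapSign p.1 * (η.1 (swapIdx p.1) : ℂ) else 0

/-- The lowering ladder operator. -/
noncomputable def ladderB (M : ℕ) : Matrix (Idx M ⊕ Idx (M + 2)) (Fin 4 × Idx (M + 1)) ℂ :=
  Matrix.of fun r p => Sum.elim
    (fun δ => if p.2.1 = δ.1 + Pi.single p.1 1 then (p.2.1 p.1 : ℂ) else 0)
    (fun η => if η.1 = p.2.1 + Pi.single (swapIdx p.1) 1 then (swapSign p.1 : ℂ) else 0) r

lemma eq_add_single_iff {α δ : Fin 4 → ℕ} {i : Fin 4} :
    α = δ + Pi.single i 1 ↔ α i ≠ 0 ∧ δ = α - Pi.single i 1 := by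
  constructor
  · rintro rfl
    exact ⟨by simp, by ext a; simp⟩
  · rintro ⟨h, rfl⟩
    exact (sub_single_add_single h).symm

lemma ladderA_mul_ladderB {M : ℕ} (i j : Fin 4) (α β : Idx (M + 1)) :
    (ladderA M * ladderB M) (i, α) (j, β) =
      (if α.1 + Pi.single j 1 = β.1 + Pi.single i 1 then ((α.1 j : ℂ) + 1) else 0) -
      (if (i, α) = (j, β) then 1 else 0) +
      swapSign i * swapSign j * (if α.1 + Pi.single (swapIdx i) 1 = β.1 + Pi.single (swapIdx j) 1
        then ((α.1 (swapIdx i) : ℂ) + 1) else 0) := by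
  rw [mul_apply, Fintype.sum_sum_type]
  congr 1
  · simp only [ladderA, ladderB, of_apply, Sum.elim_inl]
    by_cases hα : α.1 i = 0
    · rw [Finset.sum_eq_zero fun δ _ => by
        rw [if_neg fun h => (eq_add_single_iff.1 h).1 hα, zero_mul]]
      by_cases hij : i = j
      · subst hij
        by_cases hab : α = β
        · subst hab; simp [hα]
        · rw [if_neg fun h => hab (Subtype.ext (add_right_cancel h)),
            if_neg fun h => hab (Prod.ext_iff.1 h).2, sub_zero]
      · rw [if_neg fun h => by simpa [hα, Ne.symm hij, hij] using congrFun h i,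
          if_neg fun h => hij (Prod.ext_iff.1 h).1, sub_zero]
    · have hs : ∑ a, (α.1 - Pi.single i 1 : Fin 4 → ℕ) a = M := by
        have h := sum_add_single (α.1 - Pi.single i 1) i
        rw [sub_single_add_single hα, α.sum_eq] at h
        omega
      rw [sum_idx_eq hs fun δ hδ => by
        rw [if_neg fun h => hδ (eq_add_single_iff.1 h).2, zero_mul]]
      simp only [sub_single_add_single hα, if_true, one_mul]
      have h1 : β.1 = α.1 - Pi.single i 1 + Pi.single j 1 ↔
          α.1 + Pi.single j 1 = β.1 + Pi.single i 1 := by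
        conv_rhs => rw [← sub_single_add_single hα, add_right_comm]
        exact ⟨fun h => by rw [← h], fun h => (add_right_cancel h).symm⟩
      simp only [h1]
      by_cases hij : i = j
      · subst hij
        by_cases hab : α = β
        · subst hab; simp
        · rw [if_neg fun h => hab (Subtype.ext (add_right_cancel h)),
            if_neg fun h => hab (Subtype.ext (add_right_cancel h)),
            if_neg fun h => hab (Prod.ext_iff.1 h).2, sub_zero]
      · rw [if_neg fun h => hij (Prod.ext_iff.1 h).1, sub_zero]
        split_ifs with h
        · have h2 := congrFun h j
          simp [Ne.symm hij] at h2
          rw [← h2]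
          push_cast
          ring
        · rfl
  · simp only [ladderA, ladderB, of_apply, Sum.elim_inr]
    have hs : ∑ a, (α.1 + Pi.single (swapIdx i) 1 : Fin 4 → ℕ) a = M + 2 := by
      rw [sum_add_single, α.sum_eq]
    rw [sum_idx_eq hs fun η hη => by rw [if_neg hη, zero_mul]]
    simp only [if_true]
    split_ifs with h
    · simp
      ring
    · simp

lemma ladderB_mul_ladderA (M : ℕ) : ladderB M * ladderA M =
    Matrix.diagonal (Sum.elim (fun _ => (M : ℂ) + 4) fun _ => (M : ℂ) + 2) := by
  ext r s
  rw [mul_apply, Fintype.sum_prod_type]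
  rcases r with δ | η <;> rcases s with δ' | η' <;>
    simp only [ladderA, ladderB, of_apply, Sum.elim_inl, Sum.elim_inr]
  · have h1 : ∀ j, (∑ β : Idx (M + 1), (if β.1 = δ.1 + Pi.single j 1 then (β.1 j : ℂ) else 0) *
        (if β.1 = δ'.1 + Pi.single j 1 then 1 else 0)) =
        if δ = δ' then (δ.1 j : ℂ) + 1 else 0 := fun j => by
      rw [sum_idx_eq (γ := δ.1 + Pi.single j 1) (by rw [sum_add_single, δ.sum_eq]) fun β hβ => by rw [if_neg hβ, zero_mul]]
      by_cases h : δ = δ'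
      · subst h; simp
      · have h' : δ.1 ≠ δ'.1 := fun h' => h (Subtype.ext h')
        simp [h, h']
    rw [Finset.sum_congr rfl fun j _ => h1 j]
    by_cases h : δ = δ'
    · subst h
      simp only [if_true, diagonal_apply_eq, Sum.elim_inl]
      rw [Finset.sum_add_distrib, ← Nat.cast_sum, δ.sum_eq]
      simp
    · simp [h]
  · have h1 : ∀ j, (∑ β : Idx (M + 1), (if β.1 = δ.1 + Pi.single j 1 then (β.1 j : ℂ) else 0) *
        (if η'.1 = β.1 + Pi.single (swapIdx j) 1 then swapSign j * (η'.1 (swapIdx j) : ℂ) else 0)) =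
        swapSign j * if η'.1 = δ.1 + Pi.single j 1 + Pi.single (swapIdx j) 1 then
          ((δ.1 j : ℂ) + 1) * (δ.1 (swapIdx j) + 1) else 0 := fun j => by
      rw [sum_idx_eq (γ := δ.1 + Pi.single j 1) (by rw [sum_add_single, δ.sum_eq]) fun β hβ => by rw [if_neg hβ, zero_mul]]
      simp only [if_true]
      split_ifs with h
      · rw [h]
        simp [swapIdx_ne j]
        ring
      · simp
    rw [Finset.sum_congr rfl fun j _ => h1 j, sum_swapSign_mul, diagonal_apply_ne _ (by simp)]
    intro j
    rw [swapIdx_swapIdx, add_right_comm, mul_comm (((δ.1 (swapIdx j)) : ℂ) + 1)]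
  · have h1 : ∀ j, (∑ β : Idx (M + 1),
        (if η.1 = β.1 + Pi.single (swapIdx j) 1 then (swapSign j : ℂ) else 0) *
        (if β.1 = δ'.1 + Pi.single j 1 then 1 else 0)) =
        swapSign j * if η.1 = δ'.1 + Pi.single j 1 + Pi.single (swapIdx j) 1 then 1 else 0 :=
        fun j => by
      rw [sum_idx_eq (γ := δ'.1 + Pi.single j 1) (by rw [sum_add_single, δ'.sum_eq]) fun β hβ => by rw [if_neg hβ, mul_zero]]
      simp
    rw [Finset.sum_congr rfl fun j _ => h1 j, sum_swapSign_mul, diagonal_apply_ne _ (by simp)]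
    intro j
    rw [swapIdx_swapIdx, add_right_comm]
  · have h1 : ∀ j, (∑ β : Idx (M + 1),
        (if η.1 = β.1 + Pi.single (swapIdx j) 1 then (swapSign j : ℂ) else 0) *
        (if η'.1 = β.1 + Pi.single (swapIdx j) 1 then swapSign j * (η'.1 (swapIdx j) : ℂ) else 0)) =
        if η = η' then (η.1 (swapIdx j) : ℂ) else 0 := fun j => by
      have hs : (swapSign j : ℂ) * swapSign j = 1 := by exact_mod_cast swapSign_mul_self j
      by_cases hη : η.1 (swapIdx j) = 0
      · rw [Finset.sum_eq_zero fun β _ => by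
          rw [if_neg fun h => (eq_add_single_iff.1 h).1 hη, zero_mul]]
        simp [hη]
      · have hs' : ∑ a, (η.1 - Pi.single (swapIdx j) 1 : Fin 4 → ℕ) a = M + 1 := by
          have h := sum_add_single (η.1 - Pi.single (swapIdx j) 1) (swapIdx j)
          rw [sub_single_add_single hη, η.sum_eq] at h
          omega
        rw [sum_idx_eq hs' fun β hβ => by
          rw [if_neg fun h => hβ (eq_add_single_iff.1 h).2, zero_mul]]
        simp only [sub_single_add_single hη, if_true]
        by_cases h : η = η'
        · subst h
          simp only [if_true]
          rw [← mul_assoc, hs, one_mul]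
        · rw [if_neg fun h' => h (Subtype.ext h'.symm), if_neg h, mul_zero]
    rw [Finset.sum_congr rfl fun j _ => h1 j]
    by_cases h : η = η'
    · subst h
      simp only [if_true, diagonal_apply_eq, Sum.elim_inr]
      have h2 : ∑ j, η.1 (swapIdx j) = ∑ j, η.1 j := Equiv.sum_comp swapEquiv η.1
      rw [← Nat.cast_sum, h2, η.sum_eq]
      push_cast
      rfl
    · simp [h]

lemma det_ladder_re_neg {M : ℕ} (hM : Even M) :
    ((-((M : ℂ) + 3) • 1 + (2 : ℂ) • (ladderA M * ladderB M)).det).re < 0 := by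
  have h3 : (M : ℂ) + 3 ≠ 0 := by exact_mod_cast Nat.succ_ne_zero (M + 2)
  have h3' : (0 : ℝ) < (M : ℝ) + 3 := by positivity
  have h1 : -((M : ℂ) + 3) • (1 : Matrix (Fin 4 × Idx (M + 1)) (Fin 4 × Idx (M + 1)) ℂ) +
      (2 : ℂ) • (ladderA M * ladderB M) =
      (-((M : ℂ) + 3)) • (1 - ladderA M * ((2 / ((M : ℂ) + 3)) • ladderB M)) := by
    rw [smul_sub, Matrix.mul_smul, smul_smul, sub_eq_add_neg, ← neg_smul]
    congr 2
    field_simp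
  have h2 : 1 - ((2 / ((M : ℂ) + 3)) • ladderB M) * ladderA M =
      Matrix.diagonal fun r : Idx M ⊕ Idx (M + 2) =>
        (-((Sum.elim (fun _ => (M : ℝ) + 5) (fun _ => (M : ℝ) + 1) r) / (M + 3) : ℝ) : ℂ) := by
    rw [Matrix.smul_mul, ladderB_mul_ladderA, ← diagonal_one, ← diagonal_smul, diagonal_sub]
    congr 1
    ext r
    rcases r with r | r <;> simp <;> field_simp <;> ring
  rw [h1, det_smul, det_one_sub_mul_comm, h2, det_diagonal, Fintype.prod_sum_type]
  simp only [Sum.elim_inl, Sum.elim_inr, Finset.prod_const, Finset.card_univ, Fintype.card_prod,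
    Fintype.card_fin]
  rw [pow_mul, show (-((M : ℂ) + 3)) ^ 4 = ((((M : ℝ) + 3) ^ 4 : ℝ) : ℂ) by push_cast; ring]
  norm_cast
  rw [neg_pow, neg_pow (_ / _)]
  have h4 := (odd_card_idx_add hM).neg_one_pow (α := ℝ)
  rw [pow_add] at h4
  set p := Fintype.card (Idx M)
  set q := Fintype.card (Idx (M + 2))
  have h5 : 0 < (((M : ℝ) + 3) ^ 4) ^ Fintype.card (Idx (M + 1)) *
      ((((M : ℝ) + 5) / (M + 3)) ^ p * (((M : ℝ) + 1) / (M + 3)) ^ q) := by positivity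
  push_cast
  linear_combination h4 * ((((M : ℝ) + 3) ^ 4) ^ Fintype.card (Idx (M + 1)) *
      ((((M : ℝ) + 5) / (M + 3)) ^ p * (((M : ℝ) + 1) / (M + 3)) ^ q)) + h5

end Ladder

section Reality

/-- The involution of multi-indices underlying the quaternionic structure. -/
def Idx.swap {N : ℕ} : Idx N ≃ Idx N :=
  Function.Involutive.toPerm
    (fun α => ⟨α.1 ∘ swapIdx, Finset.Nat.mem_antidiagonalTuple.2
      ((Equiv.sum_comp swapEquiv α.1).trans α.sum_eq)⟩)
    fun α => Subtype.ext (funext fun a => congrArg α.1 (swapIdx_swapIdx a))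

lemma Idx.swap_val {N : ℕ} (α : Idx N) : (Idx.swap α).1 = α.1 ∘ swapIdx := rfl

lemma mono_sigma7_sigma7 {N : ℕ} (α : Idx N) (z : S7) :
    mono α.1 (sigma7 (sigma7 z)) = (-1) ^ N * mono α.1 z := by
  have h : (-1 : ℂ) ^ N = ∏ a, (-1) ^ α.1 a := by rw [Finset.prod_pow_eq_pow_sum, α.sum_eq]
  rw [mono_apply, sigma7_sigma7, mono_apply, h, ← Finset.prod_mul_distrib]
  exact Finset.prod_congr rfl fun a _ => by rw [Pi.neg_apply, neg_pow]

lemma conj_toep_apply {N : ℕ} {F : Fin 4 → Fin 4 → C(S7, ℂ)}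
    (hF : ∀ i j z, (starRingEnd ℂ) (F i j z) =
      (swapSign i * swapSign j : ℝ) * F (swapIdx i) (swapIdx j) z)
    (hs : ∀ i j z, F i j (sigma7 z) = F i j z) (i j : Fin 4) (α β : Idx N) :
    (starRingEnd ℂ) (toep N F (i, α) (j, β)) =
      ((swapSign i * monoSign α.1 : ℝ) : ℂ) *
        toep N F (swapIdx i, Idx.swap α) (swapIdx j, Idx.swap β) *
        ((swapSign j * monoSign β.1 : ℝ) : ℂ) := by
  simp only [toep, of_apply, Idx.swap_val, moment_comp_swapIdx]
  rw [map_div₀, Complex.conj_ofReal, ← sphInt_star, ← sphInt_comp_sigma7]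
  · have h : (star (star (mono α.1) * (F i j * mono β.1))).comp sigma7 =
        ((swapSign i * swapSign j * monoSign α.1 * monoSign β.1 : ℝ) : ℂ) •
          (star (mono (α.1 ∘ swapIdx)) *
            (F (swapIdx i) (swapIdx j) * mono (β.1 ∘ swapIdx))) := by
      ext z
      simp only [ContinuousMap.comp_apply, ContinuousMap.star_apply, ContinuousMap.mul_apply,
        ContinuousMap.smul_apply, RCLike.star_def, map_mul, Complex.conj_conj, mono_sigma7, hs, hF,
        Complex.conj_ofReal, smul_eq_mul]
      push_cast
      ring
    rw [h, map_smul, smul_eq_mul]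
    push_cast
    ring
  · intro z
    have h1 : ((-1 : ℂ) ^ N) * (-1) ^ N = 1 := by
      rw [← mul_pow]; simp
    simp only [ContinuousMap.star_apply, ContinuousMap.mul_apply, mono_sigma7_sigma7, hs,
      RCLike.star_def, map_mul, map_pow, map_neg, map_one, Complex.conj_conj]
    linear_combination (mono α.1 z * ((starRingEnd ℂ) (F i j z) * (starRingEnd ℂ) (mono β.1 z))) * h1

/-- The Toeplitz determinant of a quaternionic symbol is real. -/
lemma det_toep_im {N : ℕ} {F : Fin 4 → Fin 4 → C(S7, ℂ)}
    (hF : ∀ i j z, (starRingEnd ℂ) (F i j z) =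
      (swapSign i * swapSign j : ℝ) * F (swapIdx i) (swapIdx j) z)
    (hs : ∀ i j z, F i j (sigma7 z) = F i j z) : (toep N F).det.im = 0 := by
  rw [← Complex.conj_eq_iff_im, RingHom.map_det]
  set d : Fin 4 × Idx N → ℂ := fun p => ((swapSign p.1 * monoSign p.2.1 : ℝ) : ℂ) with hd
  have hdd : (diagonal d).det * (diagonal d).det = 1 := by
    rw [← det_mul, diagonal_mul_diagonal, det_diagonal]
    refine Finset.prod_eq_one fun p _ => ?_
    rw [hd, ← Complex.ofReal_mul, mul_mul_mul_comm, swapSign_mul_self, monoSign_mul_self]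
    simp
  have h : (starRingEnd ℂ).mapMatrix (toep N F) =
      diagonal d * (toep N F).submatrix (swapEquiv.prodCongr Idx.swap)
        (swapEquiv.prodCongr Idx.swap) * diagonal d := by
    ext ⟨i, α⟩ ⟨j, β⟩
    rw [mul_diagonal, diagonal_mul]
    exact conj_toep_apply hF hs i j α β
  rw [h, det_mul, det_mul, det_submatrix_equiv_self, mul_right_comm, hdd, one_mul]

lemma conj_apply_of_mem_symplecticSub {A : Matrix (Fin 4) (Fin 4) ℂ} (hA : A ∈ symplecticSub)
    (i j : Fin 4) : (starRingEnd ℂ) (A i j) =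
      (swapSign i * swapSign j : ℝ) * A (swapIdx i) (swapIdx j) := by
  have h : ∀ a b, (A * quatJ) a b = (quatJ * A.map (starRingEnd ℂ)) a b := fun a b => by rw [hA.2]
  have h1 := h (swapIdx i) j
  simp only [mul_apply, Fin.sum_univ_four, map_apply] at h1
  fin_cases i <;> fin_cases j <;> simp [quatJ, swapIdx, swapSign] at h1 ⊢ <;> simp [h1]

end Reality

section Symbol

/-- The Clifford symbol pulled back to the seven-sphere. -/
noncomputable def gammaSym (i j : Fin 4) : C(S7, ℂ) :=
  (2 : ℂ) • (coord i * star (coord j) +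
    (swapSign i * swapSign j : ℂ) • (star (coord (swapIdx i)) * coord (swapIdx j))) -
    (if i = j then (1 : ℂ) else 0) • 1

lemma gammaSym_apply (i j : Fin 4) (z : S7) : gammaSym i j z = gamma5 (hopf7 z).1 i j := by
  have h : ∑ a, z.1 a * (starRingEnd ℂ) (z.1 a) = 1 := by
    simp only [Complex.mul_conj]
    exact_mod_cast congrArg (fun x : ℝ => (x : ℂ)) z.2
  rw [Fin.sum_univ_four] at h
  have hre : ∀ w : ℂ, (w.re : ℂ) + w.im * Complex.I = w := Complex.re_add_im
  have him : ∀ w : ℂ, (w.re : ℂ) - w.im * Complex.I = (starRingEnd ℂ) w := fun w => by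
    apply Complex.ext <;> simp
  change 2 * (z.1 i * (starRingEnd ℂ) (z.1 j) + (swapSign i * swapSign j : ℂ) *
    ((starRingEnd ℂ) (z.1 (swapIdx i)) * z.1 (swapIdx j))) - (if i = j then (1 : ℂ) else 0) * 1 =
    gamma5 (hopfVec z.1) i j
  rw [gamma5_apply]
  fin_cases i <;> fin_cases j <;>
    simp [hopfVec, swapIdx, swapSign, -Complex.mul_re, -Complex.mul_im, -Complex.add_re,
      -Complex.add_im, -Complex.sub_re, -Complex.sub_im, hre, him, ← Complex.mul_conj,
      Complex.conj_ofNat] <;>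
    first | (ring; done) | linear_combination h

lemma gammaSym_sigma7 (z : S7) : hopf7 (sigma7 z) = hopf7 z := by
  apply Subtype.ext
  change hopfVec (sigma7 z).1 = hopfVec z.1
  have h : (sigma7 z).1 = fun a => swapSign a * (starRingEnd ℂ) (z.1 (swapIdx a)) := rfl
  rw [h]
  ext k
  fin_cases k <;> simp [hopfVec, swapIdx, swapSign, Complex.normSq_conj] <;> ring

lemma moment_add_single_div {M : ℕ} (α : Idx (M + 1)) (b : Fin 4) :
    ((M : ℂ) + 5) * (moment (α.1 + Pi.single b 1) / moment α.1) = (α.1 b : ℂ) + 1 := by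
  have h := moment_add_single α.1 b
  rw [α.sum_eq] at h
  have h' : (moment (α.1 + Pi.single b 1) : ℂ) * ((M : ℂ) + 5) = moment α.1 * ((α.1 b : ℂ) + 1) := by
    have := congrArg (fun x : ℝ => (x : ℂ)) h
    push_cast at this
    linear_combination this
  have h0 : (moment α.1 : ℂ) ≠ 0 := by exact_mod_cast (moment_pos α.1).ne'
  field_simp
  linear_combination h'

lemma smul_toep_gammaSym (M : ℕ) : ((M : ℂ) + 5) • toep (M + 1) gammaSym =
    -((M : ℂ) + 3) • 1 + (2 : ℂ) • (ladderA M * ladderB M) := by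
  ext ⟨i, α⟩ ⟨j, β⟩
  have h : star (mono α.1) * (gammaSym i j * mono β.1) =
      (2 : ℂ) • (star (mono (α.1 + Pi.single j 1)) * mono (β.1 + Pi.single i 1)) +
      (2 * (swapSign i * swapSign j) : ℂ) • (star (mono (α.1 + Pi.single (swapIdx i) 1)) *
        mono (β.1 + Pi.single (swapIdx j) 1)) -
      (if i = j then (1 : ℂ) else 0) • (star (mono α.1) * mono β.1) := by
    simp only [← coord_mul_mono]
    ext z
    simp only [gammaSym, ContinuousMap.sub_apply, ContinuousMap.add_apply, ContinuousMap.smul_apply,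
      ContinuousMap.mul_apply, ContinuousMap.star_apply, ContinuousMap.one_apply, RCLike.star_def,
      map_mul, smul_eq_mul]
    ring
  have h0 : (moment α.1 : ℂ) ≠ 0 := by exact_mod_cast (moment_pos α.1).ne'
  have h1 := moment_add_single_div α j
  have h2 := moment_add_single_div α (swapIdx i)
  rw [Matrix.add_apply, Matrix.smul_apply, Matrix.smul_apply, Matrix.smul_apply,
    ladderA_mul_ladderB, Matrix.one_apply]
  simp only [toep, of_apply, h, map_sub, map_add, map_smul, sphInt_mono, smul_eq_mul,
    Prod.mk.injEq]
  have hab : α.1 = β.1 ↔ α = β := Subtype.ext_iff.symm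
  simp only [hab]
  rw [← h1, ← h2]
  have h3 : ((if i = j then (1 : ℂ) else 0) * if α = β then (moment α.1 : ℂ) else 0) =
      if i = j ∧ α = β then (moment α.1 : ℂ) else 0 := by
    by_cases hi : i = j <;> by_cases ha : α = β <;> simp [hi, ha]
  rw [h3]
  by_cases hR : i = j ∧ α = β
  · rw [if_pos hR, if_pos hR]
    by_cases hP : α.1 + Pi.single j 1 = β.1 + Pi.single i 1 <;>
      by_cases hQ : α.1 + Pi.single (swapIdx i) 1 = β.1 + Pi.single (swapIdx j) 1 <;>
      simp only [hP, hQ, if_true, if_false] <;> field_simp <;> ring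
  · rw [if_neg hR, if_neg hR]
    by_cases hP : α.1 + Pi.single j 1 = β.1 + Pi.single i 1 <;>
      by_cases hQ : α.1 + Pi.single (swapIdx i) 1 = β.1 + Pi.single (swapIdx j) 1 <;>
      simp only [hP, hQ, if_true, if_false] <;> field_simp <;> ring

lemma det_toep_gammaSym_re_neg {M : ℕ} (hM : Even M) : ((toep (M + 1) gammaSym).det).re < 0 := by
  have h := det_ladder_re_neg hM
  rw [← smul_toep_gammaSym, det_smul,
    show ((M : ℂ) + 5) ^ Fintype.card (Fin 4 × Idx (M + 1)) =
      ((((M : ℝ) + 5) ^ Fintype.card (Fin 4 × Idx (M + 1)) : ℝ) : ℂ) by push_cast; rfl,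
    Complex.re_ofReal_mul] at h
  by_contra! h'
  exact h.not_ge (mul_nonneg (by positivity) h')

lemma gamma5_single : gamma5 (Pi.single 0 1) = diagonal ![1, 1, -1, -1] := by
  rw [gamma5_apply]
  ext i j
  fin_cases i <;> fin_cases j <;> simp

lemma toep_mul_const {N : ℕ} (F : Fin 4 → Fin 4 → C(S7, ℂ)) (g : Fin 4 → ℂ) :
    (toep N fun i j => g j • F i j) = toep N F * diagonal fun p => g p.1 := by
  ext p q
  rw [mul_diagonal]
  simp only [toep, of_apply, smul_mul_assoc, mul_smul_comm, map_smul, smul_eq_mul]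
  ring

lemma toep_one (N : ℕ) (r : ℂ) :
    (toep N fun i j => (if i = j then r else 0) • (1 : C(S7, ℂ))) = r • 1 := by
  ext ⟨i, α⟩ ⟨j, β⟩
  have h0 : (moment α.1 : ℂ) ≠ 0 := by exact_mod_cast (moment_pos α.1).ne'
  have hab : α.1 = β.1 ↔ α = β := Subtype.ext_iff.symm
  simp only [toep, of_apply, smul_mul_assoc, mul_smul_comm, map_smul, smul_eq_mul, one_mul,
    sphInt_mono, Matrix.smul_apply, Matrix.one_apply, Prod.mk.injEq, hab]
  by_cases hi : i = j <;> by_cases ha : α = β <;> simp only [hi, ha, and_true, and_false,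
    if_true, if_false, zero_mul, mul_zero, zero_div, mul_one]
  rw [← ha, mul_div_assoc, div_self h0, mul_one]

lemma sum_norm_sq_mulVec {A : Matrix (Fin 4) (Fin 4) ℂ} (hA : Aᴴ * A = 1) (v : Fin 4 → ℂ) :
    ∑ i, ‖∑ j, A i j * v j‖ ^ 2 = ∑ j, ‖v j‖ ^ 2 := by
  have h1 : ∀ w : Fin 4 → ℂ, star w ⬝ᵥ w = ((∑ i, ‖w i‖ ^ 2 : ℝ) : ℂ) := fun w => by
    push_cast
    exact Finset.sum_congr rfl fun i _ => by
      rw [Pi.star_apply, RCLike.star_def, Complex.conj_mul']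
  have h2 : star (A *ᵥ v) ⬝ᵥ (A *ᵥ v) = star v ⬝ᵥ v := by
    rw [star_mulVec, ← dotProduct_mulVec, mulVec_mulVec, hA, one_mulVec]
  rw [h1, h1] at h2
  exact_mod_cast h2

/-- The Clifford symbol of `S⁵` is not symplectically contractible: its Toeplitz determinants are
real and negative, whereas those of a constant symbol are positive. -/
theorem not_symplectic_contraction {f : Sph 5 → I → Matrix (Fin 4) (Fin 4) ℂ} {r : ℝ}
    (hf : Continuous fun p : Sph 5 × I => f p.1 p.2) (hsp : ∀ x t, f x t ∈ symplecticSub)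
    (h0 : ∀ x, f x 0 = gamma5 x.1 * gamma5 (Pi.single 0 1)) (hr : r ^ 2 = 1)
    (h1 : ∀ x, f x 1 = (r : ℂ) • 1) : False := by
  set F : Fin 4 → Fin 4 → C(S7 × I, ℂ) := fun i j =>
    hopfPull ⟨fun p => f p.1 p.2 i j, (continuous_apply_apply i j).comp hf⟩ with hF
  have hFa : ∀ i j z t, F i j (z, t) = f (hopf7 z) t i j := fun i j z t => rfl
  obtain ⟨N₀, hN⟩ := exists_det_toep_ne_zero F (fun i j => approx_hopfPull _) fun t z v => by
    simp only [hFa]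
    exact sum_norm_sq_mulVec (hsp _ _).1 v
  set N := 2 * N₀ + 1
  set D : I → ℂ := fun t => (toep N fun i j => slice (F i j) t).det with hD
  have hDc : Continuous D := continuous_det_toep N F
  have hDim : ∀ t, (D t).im = 0 := fun t => det_toep_im
    (fun i j z => by
      simp only [slice_apply, hFa]
      exact conj_apply_of_mem_symplecticSub (hsp _ _) i j)
    fun i j z => by simp only [slice_apply, hFa, gammaSym_sigma7]
  have hD0 : (D 0).re < 0 := by
    have h : (fun i j => slice (F i j) 0) =
        fun i j => (![1, 1, -1, -1] : Fin 4 → ℂ) j • gammaSym i j := by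
      ext i j z
      rw [slice_apply, hFa, h0, gamma5_single, mul_diagonal, ContinuousMap.smul_apply,
        gammaSym_apply, smul_eq_mul, mul_comm]
    have hg : ∏ p : Fin 4 × Idx N, (![1, 1, -1, -1] : Fin 4 → ℂ) p.1 = 1 := by
      rw [Fintype.prod_prod_type_right]
      exact Finset.prod_eq_one fun α _ => by simp [Fin.prod_univ_four]
    simp only [hD]
    rw [h, toep_mul_const, det_mul, det_diagonal, hg, mul_one]
    exact det_toep_gammaSym_re_neg (even_two_mul N₀)
  have hD1 : 0 < (D 1).re := by
    have h : (fun i j => slice (F i j) 1) =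
        fun i j => (if i = j then (r : ℂ) else 0) • (1 : C(S7, ℂ)) := by
      ext i j z
      rw [slice_apply, hFa, h1, Matrix.smul_apply, Matrix.one_apply, ContinuousMap.smul_apply,
        ContinuousMap.one_apply]
      split_ifs <;> simp
    have hr' : (r : ℂ) ^ 4 = 1 := by
      have : r ^ 4 = 1 := by linear_combination (r ^ 2 + 1) * hr
      exact_mod_cast this
    simp only [hD]
    rw [h, toep_one, det_smul, det_one, Fintype.card_prod, Fintype.card_fin, pow_mul, hr']
    simp
  obtain ⟨t, -, ht⟩ := isPreconnected_univ.intermediate_value (Set.mem_univ (0 : I))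
    (Set.mem_univ (1 : I)) (Complex.continuous_re.comp hDc).continuousOn ⟨hD0.le, hD1.le⟩
  exact hN N (by omega) t (Complex.ext ht (hDim t))

end Symbol

end

/-- For the irreducible 5-dimensional representation ρ : SO(3) → SO(5) (characterized
here as a continuous homomorphism with no nontrivial invariant subspace of ℝ⁵), every
composition S⁴ → SO(3) → SO(5) is null-homotopic; consequently the structure group of
S⁵ cannot be reduced to ρ(SO(3)). -/
theorem irreducible_so3_so5_composition_nullhomotopic
    (ρ : {A : Matrix (Fin 3) (Fin 3) ℝ // A ∈ SOSet 3} →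
      {A : Matrix (Fin 5) (Fin 5) ℝ // A ∈ SOSet 5})
    (hρcont : Continuous ρ)
    (hρhom : ∀ A B C : {A : Matrix (Fin 3) (Fin 3) ℝ // A ∈ SOSet 3},
      (A : Matrix (Fin 3) (Fin 3) ℝ) * B = C →
      (ρ A : Matrix (Fin 5) (Fin 5) ℝ) * (ρ B) = (ρ C))
    (hρirr : ∀ W : Submodule ℝ (Fin 5 → ℝ),
      (∀ A : {A : Matrix (Fin 3) (Fin 3) ℝ // A ∈ SOSet 3},
        W.map (Matrix.mulVecLin (ρ A : Matrix (Fin 5) (Fin 5) ℝ)) ≤ W) →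
      W = ⊥ ∨ W = ⊤) :
    (∀ f : C(Metric.sphere (0 : EuclideanSpace ℝ (Fin 5)) 1,
        {A : Matrix (Fin 3) (Fin 3) ℝ // A ∈ SOSet 3}),
      ∃ c, ContinuousMap.Homotopic
        (⟨fun x => ρ (f x), hρcont.comp f.continuous⟩ :
          C(Metric.sphere (0 : EuclideanSpace ℝ (Fin 5)) 1,
            {A : Matrix (Fin 5) (Fin 5) ℝ // A ∈ SOSet 5}))
        (ContinuousMap.const _ c)) ∧
    ¬ SphereStructureGroupReducesTo 5 (Subtype.val '' Set.range ρ) := by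
  refine ⟨fun f => ?_, fun h => ?_⟩
  · obtain ⟨c, K, hK, hK0, hK1⟩ := exists_null_homotopy hρcont hρhom
      (f := fun v => f ((sphHomeo 5).symm v)) (f.continuous.comp (sphHomeo 5).symm.continuous)
    refine ⟨c, ⟨{
      toFun := fun p => K (sphHomeo 5 p.2) p.1
      continuous_toFun := hK.comp
        (((sphHomeo 5).continuous.comp continuous_snd).prodMk continuous_fst)
      map_zero_left := fun x => by simp [hK0]
      map_one_left := fun x => hK1 _ }⟩⟩
  · obtain ⟨c, H, hH, hu, h0, h1⟩ := exists_contraction_of_reduces hρcont hρhom hρirr h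
    obtain ⟨f, r, hf, hsp, hf0, hr, hf1⟩ := exists_symplectic_symbol c H hH hu h0 h1
    exact not_symplectic_contraction hf hsp hf0 hr hf1
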